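/- Let X be a convergent 𝓘-space of based topological spaces, and let ΩX denote the 𝓘-space obtained by applying the based loop space functor levelwise, (ΩX)(n) := Ω(X(n)). Then ΩX is a convergent 𝓘-space, and the canonical comparison map (ΩX)_{h𝓘} → Ω(X_{h𝓘}) induces isomorphisms of all homotopy groups at all basepoints (i.e., it is a weak homotopy equivalence). -/

import Mathlib

/-!
Statement 2: for a convergent 𝓘-space `X`, the levelwise based loop space `ΩX` is a convergent
𝓘-space, and the canonical comparison map `(ΩX)_{h𝓘} → Ω(X_{h𝓘})` is a weak homotopy
equivalence.
-/

noncomputable section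

/-- The standard topological `k`-simplex. -/
def Simplex (k : ℕ) : Type :=
  {t : Fin (k + 1) → ℝ // (∀ i, 0 ≤ t i) ∧ ∑ i, t i = 1}

instance (k : ℕ) : TopologicalSpace (Simplex k) := by
  unfold Simplex; infer_instance

/-- The affine map of standard simplices induced by a monotone map of vertex sets. -/
def simplexMap {k l : ℕ} (α : Fin (k + 1) →o Fin (l + 1)) (t : Simplex k) : Simplex l :=
  ⟨fun j => ∑ i ∈ Finset.univ.filter (fun i => α i = j), t.1 i,
    fun _ => Finset.sum_nonneg fun i _ => t.2.1 i,
    (Finset.sum_fiberwise Finset.univ (fun i => α i) t.1).trans t.2.2⟩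

/-- The vertex of the standard `0`-simplex. -/
def vertex : Simplex 0 :=
  ⟨fun _ => 1, fun _ => zero_le_one, by simp⟩

/-- The map induced by a continuous map on sets of path components. -/
def pi0Map {X Y : Type*} [TopologicalSpace X] [TopologicalSpace Y] {f : X → Y}
    (hf : Continuous f) : ZerothHomotopy X → ZerothHomotopy Y :=
  Quotient.map f (fun _ _ h => Nonempty.map (fun p => p.map hf) h)

/-- The map induced by a continuous based map on homotopy groups (composition of generalized
loops with `f`). -/
def piMap (i : ℕ) {X Y : Type*} [TopologicalSpace X] [TopologicalSpace Y] {f : X → Y}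
    (hf : Continuous f) (x : X) :
    HomotopyGroup (Fin i) X x → HomotopyGroup (Fin i) Y (f x) :=
  Quotient.map
    (fun p => ⟨ContinuousMap.comp ⟨f, hf⟩ p.1, fun y hy => by
      simp only [ContinuousMap.comp_apply, ContinuousMap.coe_mk]
      exact congrArg f (p.2 y hy)⟩)
    (fun p q h => Nonempty.map (fun F => F.compContinuousMap ⟨f, hf⟩) h)

/-- A continuous map is `k`-connected if it induces a bijection on path components,
isomorphisms of homotopy groups `πᵢ` for `i < k` at all basepoints, and a surjection on
`π_k` at all basepoints. -/
def IsConnMap (k : ℕ) {X Y : Type*} [TopologicalSpace X] [TopologicalSpace Y] {f : X → Y}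
    (hf : Continuous f) : Prop :=
  Function.Bijective (pi0Map hf) ∧
  (∀ i : ℕ, i < k → ∀ x : X, Function.Bijective (piMap i hf x)) ∧
  (∀ x : X, Function.Surjective (piMap k hf x))

/-- A continuous map is a weak homotopy equivalence if it induces a bijection on path
components and isomorphisms of all homotopy groups at all basepoints. -/
def IsWeakHomotopyEquiv {X Y : Type*} [TopologicalSpace X] [TopologicalSpace Y] {f : X → Y}
    (hf : Continuous f) : Prop :=
  Function.Bijective (pi0Map hf) ∧ ∀ (i : ℕ) (x : X), Function.Bijective (piMap i hf x)

/-- A based 𝓘-space: a functor from the category 𝓘 of finite sets `[n] = {1,…,n}` and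
injections to based topological spaces. -/
structure ISpace where
  obj : ℕ → Type
  topo : ∀ n, TopologicalSpace (obj n)
  pt : ∀ n, obj n
  map : ∀ {n m : ℕ}, (Fin n ↪ Fin m) → obj n → obj m
  map_cont : ∀ {n m : ℕ} (f : Fin n ↪ Fin m), @Continuous _ _ (topo n) (topo m) (map f)
  map_id : ∀ (n : ℕ) (x : obj n), map (Function.Embedding.refl (Fin n)) x = x
  map_comp : ∀ {n m l : ℕ} (f : Fin n ↪ Fin m) (g : Fin m ↪ Fin l) (x : obj n),
      map (f.trans g) x = map g (map f x)
  map_pt : ∀ {n m : ℕ} (f : Fin n ↪ Fin m), map f (pt n) = pt m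

attribute [instance] ISpace.topo

/-- An 𝓘-space is convergent if the connectivity of its structure maps `X(n) → X(m)` tends to
infinity with `n`. -/
def ISpace.Convergent (X : ISpace) : Prop :=
  ∀ k : ℕ, ∃ N : ℕ, ∀ (n m : ℕ), N ≤ n → ∀ f : Fin n ↪ Fin m,
    IsConnMap k (X.map_cont f)

/-- A chain of `k` composable morphisms in the category 𝓘, encoded as a functor from the
poset `{0 ≤ 1 ≤ ⋯ ≤ k}`.  (The 𝓘-space will be evaluated at the object indexed by `0`.) -/
structure IChain (k : ℕ) where
  o : Fin (k + 1) → ℕ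
  hom : ∀ i j : Fin (k + 1), i ≤ j → (Fin (o i) ↪ Fin (o j))
  hom_refl : ∀ i, hom i i le_rfl = Function.Embedding.refl _
  hom_trans : ∀ (i j l : Fin (k + 1)) (hij : i ≤ j) (hjl : j ≤ l),
      hom i l (hij.trans hjl) = (hom i j hij).trans (hom j l hjl)

/-- Restriction of a chain along a monotone reindexing map `[k] → [l]`. -/
def IChain.restrict {k l : ℕ} (c : IChain l) (α : Fin (k + 1) →o Fin (l + 1)) : IChain k where
  o := fun i => c.o (α i)
  hom := fun i j h => c.hom (α i) (α j) (α.monotone h)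
  hom_refl := fun i => c.hom_refl (α i)
  hom_trans := fun i j l hij hjl =>
    c.hom_trans (α i) (α j) (α l) (α.monotone hij) (α.monotone hjl)

/-- The constant chain of length `0` at level `n`. -/
def constChain (n : ℕ) : IChain 0 where
  o := fun _ => n
  hom := fun _ _ _ => Function.Embedding.refl _
  hom_refl := fun _ => rfl
  hom_trans := fun _ _ _ _ _ => by ext x; rfl

/-- The total space of the simplicial space computing the homotopy colimit `X_{h𝓘}` of an
𝓘-space. -/
def HocolimPre (X : ISpace) : Type :=
  Σ (k : ℕ) (c : IChain k), X.obj (c.o 0) × Simplex k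

instance (X : ISpace) : TopologicalSpace (HocolimPre X) := by
  unfold HocolimPre; infer_instance

/-- The identifications defining the homotopy colimit (all face and degeneracy
identifications at once). -/
inductive HocolimRel (X : ISpace) : HocolimPre X → HocolimPre X → Prop
  | glue {k l : ℕ} (α : Fin (k + 1) →o Fin (l + 1)) (c : IChain l)
      (p : X.obj (c.o 0)) (t : Simplex k) :
      HocolimRel X ⟨l, c, p, simplexMap α t⟩
        ⟨k, c.restrict α, X.map (c.hom 0 (α 0) (Fin.zero_le _)) p, t⟩

/-- The homotopy colimit `X_{h𝓘}` of an 𝓘-space, with the quotient topology. -/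
def Hocolim (X : ISpace) : Type :=
  Quot (HocolimRel X)

instance (X : ISpace) : TopologicalSpace (Hocolim X) := by
  unfold Hocolim; infer_instance

/-- The inclusion of a simplex into the homotopy colimit. -/
def incl (X : ISpace) {k : ℕ} (c : IChain k) (p : X.obj (c.o 0)) (t : Simplex k) :
    Hocolim X :=
  Quot.mk _ ⟨k, c, p, t⟩

/-- The basepoint of `X_{h𝓘}`: the image of the basepoint of `X(0)` under the inclusion of
`0`-simplices. -/
def basept (X : ISpace) : Hocolim X :=
  incl X (constChain 0) (X.pt 0) vertex

/-- The based loop space of a based space: continuous loops `[0,1] → Z` at the basepoint. -/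
abbrev OmegaSpace (Z : Type*) [TopologicalSpace Z] (z : Z) : Type _ :=
  {γ : C(unitInterval, Z) // γ 0 = z ∧ γ 1 = z}

/-- The levelwise based loop space `ΩX` of a based 𝓘-space, `(ΩX)(n) = Ω(X(n))`, with the
induced structure maps. -/
def loopISpace (X : ISpace) : ISpace where
  obj := fun n => OmegaSpace (X.obj n) (X.pt n)
  topo := fun _ => inferInstance
  pt := fun n => ⟨ContinuousMap.const _ (X.pt n), rfl, rfl⟩
  map := fun {n m} f γ =>
    ⟨ContinuousMap.comp ⟨X.map f, X.map_cont f⟩ γ.1, by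
      refine ⟨?_, ?_⟩
      · show X.map f (γ.1 0) = X.pt m
        rw [γ.2.1, X.map_pt]
      · show X.map f (γ.1 1) = X.pt m
        rw [γ.2.2, X.map_pt]⟩
  map_cont := fun {n m} f => by
    apply Continuous.subtype_mk
    exact (ContinuousMap.continuous_postcomp _).comp continuous_subtype_val
  map_id := fun n γ =>
    Subtype.ext (ContinuousMap.ext fun s => X.map_id n (γ.1 s))
  map_comp := fun {n m l} f g γ =>
    Subtype.ext (ContinuousMap.ext fun s => X.map_comp f g (γ.1 s))
  map_pt := fun {n m} f =>
    Subtype.ext (ContinuousMap.ext fun s => by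
      show X.map f (X.pt n) = X.pt m; rw [X.map_pt])

section

open Set

section Lifting

/-- Closed unit ball. -/
abbrev uBall (E : Type*) [Norm E] : Set E := {x | ‖x‖ ≤ 1}
/-- Unit sphere. -/
abbrev uSph (E : Type*) [Norm E] : Set E := {x | ‖x‖ = 1}
/-- Unit interval as a set of reals. -/
abbrev uI : Set ℝ := Set.Icc 0 1

lemma uSph_subset {E : Type*} [Norm E] {x : E} (hx : x ∈ uSph E) : x ∈ uBall E := le_of_eq hx

lemma isClosed_uBall (E : Type*) [NormedAddCommGroup E] : IsClosed (uBall E) :=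
  isClosed_le continuous_norm continuous_const

lemma isClosed_uSph (E : Type*) [NormedAddCommGroup E] : IsClosed (uSph E) :=
  isClosed_eq continuous_norm continuous_const

lemma zero_mem_uI : (0 : ℝ) ∈ uI := ⟨le_rfl, zero_le_one⟩
lemma one_mem_uI : (1 : ℝ) ∈ uI := ⟨zero_le_one, le_rfl⟩

lemma continuousOn_ite_le {X Y : Type*} [TopologicalSpace X] [TopologicalSpace Y] {s : Set X}
    {φ χ : X → ℝ} {F G : X → Y} (hφ : Continuous φ) (hχ : Continuous χ) (hs : IsClosed s)
    (hF : ContinuousOn F (s ∩ {x | φ x ≤ χ x})) (hG : ContinuousOn G (s ∩ {x | χ x ≤ φ x}))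
    (h : ∀ x ∈ s, φ x = χ x → F x = G x) :
    ContinuousOn (fun x => if φ x ≤ χ x then F x else G x) s := by
  have h1 : s = (s ∩ {x | φ x ≤ χ x}) ∪ (s ∩ {x | χ x ≤ φ x}) := by
    ext x
    simp only [mem_union, mem_inter_iff, mem_ofPred_eq, ← and_or_left]
    exact ⟨fun hx => ⟨hx, le_total _ _⟩, fun hx => hx.1⟩
  rw [h1]
  refine ContinuousOn.union_of_isClosed (hF.congr ?_) (hG.congr ?_)
    (hs.inter (isClosed_le hφ hχ)) (hs.inter (isClosed_le hχ hφ))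
  · rintro x ⟨_, hx⟩
    exact if_pos hx
  · rintro x ⟨hxs, hx⟩
    by_cases h2 : φ x ≤ χ x
    · simp only [if_pos h2]
      exact h x hxs (le_antisymm h2 hx)
    · simp only [if_neg h2]

variable {E : Type} [NormedAddCommGroup E] [NormedSpace ℝ E] {A B C : Type}
  [TopologicalSpace A] [TopologicalSpace B] [TopologicalSpace C]

/-- The homotopy extension property of the unit sphere in the unit ball. -/
lemma hep {F : E → B} {h : E × ℝ → B} {U : Set B} (hF : ContinuousOn F (uBall E))
    (hh : ContinuousOn h (uSph E ×ˢ uI)) (h0 : ∀ x ∈ uSph E, h (x, 0) = F x)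
    (hFU : ∀ x ∈ uBall E, F x ∈ U) (hhU : ∀ x ∈ uSph E, ∀ s ∈ uI, h (x, s) ∈ U) :
    ∃ H : E × ℝ → B, ContinuousOn H (uBall E ×ˢ uI) ∧ (∀ x ∈ uBall E, H (x, 0) = F x) ∧
      (∀ x ∈ uSph E, ∀ s ∈ uI, H (x, s) = h (x, s)) ∧
      ∀ x ∈ uBall E, ∀ s ∈ uI, H (x, s) ∈ U := by
  have key : ∀ x ∈ uBall E, ∀ s ∈ uI, 1 ≤ (1 + s) * ‖x‖ →
      0 < ‖x‖ ∧ ‖x‖⁻¹ • x ∈ uSph E ∧ (1 + s) * ‖x‖ - 1 ∈ uI := by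
    intro x hx s hs h1
    have hx' : ‖x‖ ≤ 1 := hx
    have hpos : 0 < ‖x‖ := by
      by_contra hcon
      have : ‖x‖ = 0 := le_antisymm (not_lt.mp hcon) (norm_nonneg _)
      rw [this] at h1; norm_num at h1
    refine ⟨hpos, ?_, by linarith, ?_⟩
    · simp [norm_smul, hpos.ne']
    · nlinarith [hs.1, hs.2]
  refine ⟨fun p => if (1 + p.2) * ‖p.1‖ ≤ 1 then F ((1 + p.2) • p.1)
      else h (‖p.1‖⁻¹ • p.1, (1 + p.2) * ‖p.1‖ - 1), ?_, ?_, ?_, ?_⟩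
  · refine continuousOn_ite_le (φ := fun p : E × ℝ => (1 + p.2) * ‖p.1‖) (χ := fun _ => 1)
      (by fun_prop) continuous_const ((isClosed_uBall E).prod isClosed_Icc) ?_ ?_ ?_
    · refine hF.comp (by fun_prop) ?_
      rintro ⟨x, s⟩ ⟨⟨hx, hs⟩, h1⟩
      simp only [mem_ofPred_eq] at h1 ⊢
      rw [norm_smul, Real.norm_of_nonneg (by linarith [hs.1])]; exact h1
    · refine hh.comp ?_ ?_
      · refine ContinuousOn.prodMk (ContinuousOn.smul (ContinuousOn.inv₀ (by fun_prop) ?_)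
          (by fun_prop)) (by fun_prop)
        rintro ⟨x, s⟩ ⟨⟨hx, hs⟩, h1⟩
        exact (key x hx s hs h1).1.ne'
      · rintro ⟨x, s⟩ ⟨⟨hx, hs⟩, h1⟩
        exact ⟨(key x hx s hs h1).2.1, (key x hx s hs h1).2.2⟩
    · rintro ⟨x, s⟩ ⟨hx, hs⟩ h1
      have h1 : (1 + s) * ‖x‖ = 1 := h1
      obtain ⟨k1, k2, k3⟩ := key x hx s hs h1.ge
      simp only [h1, sub_self]
      rw [h0 _ k2, eq_inv_of_mul_eq_one_left h1]
  · intro x hx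
    have : ‖x‖ ≤ 1 := hx
    simp [this]
  · intro x hx s hs
    have hx' : ‖x‖ = 1 := hx
    simp only [hx', mul_one, inv_one, one_smul, add_sub_cancel_left]
    split_ifs with h1
    · have : s = 0 := le_antisymm (by linarith) hs.1
      subst this
      simp [h0 x hx]
    · rfl
  · intro x hx s hs
    simp only
    split_ifs with h1
    · refine hFU _ ?_
      simp only [mem_ofPred_eq]
      rw [norm_smul, Real.norm_of_nonneg (by linarith [hs.1])]; exact h1
    · obtain ⟨k1, k2, k3⟩ := key x hx s hs (not_le.mp h1).le
      exact hhU _ k2 _ k3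

/-- Homotopy extension for the boundary of the box `uBall E × uI`: if the boundary data
`(l, ρ, σ)` extend over the box at time `1`, they extend at time `0`. -/
lemma box_hep {l ρ : E × ℝ → B} {σ : (E × ℝ) × ℝ → B} {Φ : E × ℝ → B} {U : Set B}
    (hl : ContinuousOn l (uBall E ×ˢ uI)) (hρ : ContinuousOn ρ (uBall E ×ˢ uI))
    (hσ : ContinuousOn σ ((uSph E ×ˢ uI) ×ˢ uI))
    (hΦ : ContinuousOn Φ (uBall E ×ˢ uI))
    (c0 : ∀ x ∈ uSph E, ∀ r ∈ uI, σ ((x, 0), r) = l (x, r))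
    (c1 : ∀ x ∈ uSph E, ∀ r ∈ uI, σ ((x, 1), r) = ρ (x, r))
    (d0 : ∀ x ∈ uBall E, Φ (x, 0) = l (x, 1)) (d1 : ∀ x ∈ uBall E, Φ (x, 1) = ρ (x, 1))
    (ds : ∀ x ∈ uSph E, ∀ s ∈ uI, Φ (x, s) = σ ((x, s), 1))
    (hlU : ∀ x ∈ uBall E, ∀ r ∈ uI, l (x, r) ∈ U) (hρU : ∀ x ∈ uBall E, ∀ r ∈ uI, ρ (x, r) ∈ U)
    (hσU : ∀ x ∈ uSph E, ∀ s ∈ uI, ∀ r ∈ uI, σ ((x, s), r) ∈ U)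
    (hΦU : ∀ x ∈ uBall E, ∀ s ∈ uI, Φ (x, s) ∈ U) :
    ∃ Ψ : E × ℝ → B, ContinuousOn Ψ (uBall E ×ˢ uI) ∧ (∀ x ∈ uBall E, Ψ (x, 0) = l (x, 0)) ∧
      (∀ x ∈ uBall E, Ψ (x, 1) = ρ (x, 0)) ∧
      (∀ x ∈ uSph E, ∀ s ∈ uI, Ψ (x, s) = σ ((x, s), 0)) ∧
      ∀ x ∈ uBall E, ∀ s ∈ uI, Ψ (x, s) ∈ U := by
  have ball : ∀ {x : E} {u : ℝ}, (x, u) ∈ uBall (E × ℝ) ↔ x ∈ uBall E ∧ (u + 1) / 2 ∈ uI := by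
    intro x u
    simp only [mem_ofPred_eq, Prod.norm_def, sup_le_iff, Real.norm_eq_abs, abs_le, uI, mem_Icc]
    refine and_congr_right fun _ => ⟨fun h => ⟨by linarith [h.1], by linarith [h.2]⟩,
      fun h => ⟨by linarith [h.1], by linarith [h.2]⟩⟩
  have sph : ∀ {x : E} {u : ℝ}, (x, u) ∈ uSph (E × ℝ) → x ∈ uBall E ∧ (u + 1) / 2 ∈ uI ∧
      (u ≤ -1 → u = -1) ∧ (1 ≤ u → u = 1) ∧ (u = -1 ∨ u = 1 ∨ x ∈ uSph E) := by
    intro x u h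
    have h1 := ball.1 (uSph_subset h)
    have h2 : max ‖x‖ |u| = 1 := h
    refine ⟨h1.1, h1.2, fun h => by linarith [h1.2.1], fun h => by linarith [h1.2.2], ?_⟩
    rcases max_choice ‖x‖ |u| with h3 | h3
    · right; right; rw [h3] at h2; exact h2
    · rw [h3] at h2
      rcases abs_eq zero_le_one |>.1 h2 with h | h
      · exact .inr (.inl h)
      · exact .inl h
  have rev : ∀ {r : ℝ}, r ∈ uI → 1 - r ∈ uI := fun h => ⟨by linarith [h.2], by linarith [h.1]⟩
  let b : (E × ℝ) × ℝ → B := fun p =>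
    if p.1.2 ≤ -1 then l (p.1.1, 1 - p.2) else
      if 1 ≤ p.1.2 then ρ (p.1.1, 1 - p.2) else σ ((p.1.1, (p.1.2 + 1) / 2), 1 - p.2)
  have bσ : ∀ x ∈ uSph E, ∀ u, (u + 1) / 2 ∈ uI → ∀ r ∈ uI,
      b ((x, u), r) = σ ((x, (u + 1) / 2), 1 - r) := by
    intro x hx u hu r hr
    simp only [b]
    split_ifs with h1 h2
    · have : u = -1 := by linarith [hu.1]
      subst this; rw [← c0 x hx _ (rev hr)]; norm_num
    · have : u = 1 := by linarith [hu.2]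
      subst this; rw [← c1 x hx _ (rev hr)]; norm_num
    · rfl
  have b0 : ∀ x r, b ((x, -1), r) = l (x, 1 - r) := by intro x r; simp [b]
  have b1 : ∀ x r, b ((x, 1), r) = ρ (x, 1 - r) := by
    intro x r; simp only [b]; rw [if_neg (by norm_num), if_pos le_rfl]
  have hb : ContinuousOn b (uSph (E × ℝ) ×ˢ uI) := by
    have hsub : uSph (E × ℝ) ×ˢ uI ⊆ ((uBall E ×ˢ {-1}) ×ˢ uI) ∪ (((uBall E ×ˢ {1}) ×ˢ uI) ∪
        ((uSph E ×ˢ Icc (-1) 1) ×ˢ uI)) := by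
      rintro ⟨⟨x, u⟩, r⟩ ⟨h, hr⟩
      obtain ⟨k1, k2, -, -, rfl | rfl | h5⟩ := sph h
      · exact .inl ⟨⟨k1, rfl⟩, hr⟩
      · exact .inr (.inl ⟨⟨k1, rfl⟩, hr⟩)
      · exact .inr (.inr ⟨⟨h5, by constructor <;> linarith [k2.1, k2.2]⟩, hr⟩)
    refine ContinuousOn.mono ?_ hsub
    have cB := isClosed_uBall E
    have cS := isClosed_uSph E
    have cI : IsClosed uI := isClosed_Icc
    refine ContinuousOn.union_of_isClosed ?_ (ContinuousOn.union_of_isClosed ?_ ?_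
      ((cB.prod isClosed_singleton).prod cI) ((cS.prod isClosed_Icc).prod cI))
      ((cB.prod isClosed_singleton).prod cI)
      (((cB.prod isClosed_singleton).prod cI).union ((cS.prod isClosed_Icc).prod cI))
    · refine (hl.comp (f := fun p : (E × ℝ) × ℝ => (p.1.1, 1 - p.2)) (by fun_prop) ?_).congr ?_
      · rintro ⟨⟨x, u⟩, r⟩ ⟨⟨h, -⟩, hr⟩
        exact ⟨h, rev hr⟩
      · rintro ⟨⟨x, u⟩, r⟩ ⟨⟨h, hu⟩, hr⟩
        obtain rfl : u = -1 := hu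
        exact b0 _ _
    · refine (hρ.comp (f := fun p : (E × ℝ) × ℝ => (p.1.1, 1 - p.2)) (by fun_prop) ?_).congr ?_
      · rintro ⟨⟨x, u⟩, r⟩ ⟨⟨h, -⟩, hr⟩
        exact ⟨h, rev hr⟩
      · rintro ⟨⟨x, u⟩, r⟩ ⟨⟨h, hu⟩, hr⟩
        obtain rfl : u = 1 := hu
        exact b1 _ _
    · refine (hσ.comp (f := fun p : (E × ℝ) × ℝ => ((p.1.1, (p.1.2 + 1) / 2), 1 - p.2))
        (by fun_prop) ?_).congr ?_
      · rintro ⟨⟨x, u⟩, r⟩ ⟨⟨h, hu⟩, hr⟩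
        exact ⟨⟨h, by constructor <;> simp only <;> linarith [hu.1, hu.2]⟩, rev hr⟩
      · rintro ⟨⟨x, u⟩, r⟩ ⟨⟨h, hu⟩, hr⟩
        exact bσ x h u (by constructor <;> linarith [hu.1, hu.2]) r hr
  obtain ⟨H, hH, H0, HS, HU⟩ := hep (E := E × ℝ) (F := fun p => Φ (p.1, (p.2 + 1) / 2)) (h := b)
    (U := U)
    (hΦ.comp (f := fun p : E × ℝ => (p.1, (p.2 + 1) / 2)) (by fun_prop)
      (by rintro ⟨x, u⟩ h; exact ball.1 h)) hb
    (by
      rintro ⟨x, u⟩ h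
      obtain ⟨k1, k2, -, -, rfl | rfl | h5⟩ := sph h
      · simp [b0, d0 x k1]
      · simp [b1, d1 x k1]
      · rw [bσ x h5 u k2 0 zero_mem_uI, ds x h5 _ k2]; simp)
    (by rintro ⟨x, u⟩ h; exact hΦU _ (ball.1 h).1 _ (ball.1 h).2)
    (by
      rintro ⟨x, u⟩ h r hr
      obtain ⟨k1, k2, -, -, rfl | rfl | h5⟩ := sph h
      · rw [b0]; exact hlU x k1 _ (rev hr)
      · rw [b1]; exact hρU x k1 _ (rev hr)
      · rw [bσ x h5 u k2 r hr]; exact hσU x h5 _ k2 _ (rev hr))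
  have bal' : ∀ x ∈ uBall E, ∀ s ∈ uI, (x, 2 * s - 1) ∈ uBall (E × ℝ) := by
    intro x hx s hs
    refine ball.2 ⟨hx, ?_⟩
    constructor <;> linarith [hs.1, hs.2]
  have sph' : ∀ x ∈ uBall E, ∀ s ∈ uI, (x ∈ uSph E ∨ s = 0 ∨ s = 1) →
      (x, 2 * s - 1) ∈ uSph (E × ℝ) := by
    intro x hx s hs h
    refine le_antisymm (bal' x hx s hs) ?_
    rcases h with h | rfl | rfl
    · exact le_max_of_le_left (ge_of_eq h)
    · exact le_max_of_le_right (by norm_num)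
    · exact le_max_of_le_right (by norm_num)
  refine ⟨fun p => H ((p.1, 2 * p.2 - 1), 1), ?_, ?_, ?_, ?_, ?_⟩
  · refine hH.comp (by fun_prop) ?_
    rintro ⟨x, s⟩ ⟨hx, hs⟩
    exact ⟨bal' x hx s hs, one_mem_uI⟩
  · intro x hx
    simp only
    rw [HS _ (sph' x hx 0 zero_mem_uI (.inr (.inl rfl))) 1 one_mem_uI]
    norm_num [b0]
  · intro x hx
    simp only
    rw [HS _ (sph' x hx 1 one_mem_uI (.inr (.inr rfl))) 1 one_mem_uI]
    norm_num [b1]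
  · intro x hx s hs
    simp only
    rw [HS _ (sph' x (uSph_subset hx) s hs (.inl hx)) 1 one_mem_uI,
      bσ x hx _ (by constructor <;> linarith [hs.1, hs.2]) 1 one_mem_uI]
    congr 2
    · simp
    · simp
  · intro x hx s hs
    exact HU _ (bal' x hx s hs) 1 one_mem_uI

end Lifting

end

section

open Set

section Lifting
variable {E : Type} [NormedAddCommGroup E] [NormedSpace ℝ E] {A B C : Type}
  [TopologicalSpace A] [TopologicalSpace B] [TopologicalSpace C]

/-- The lifting problem `(F, g)` for `f` on the ball of `E` is solvable up to a homotopy in `U`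
relative to the sphere. -/
def Solvable (f : A → B) (U : Set B) (F : E → B) (g : E → A) : Prop :=
  ∃ (G : E → A) (H : E × ℝ → B), ContinuousOn G (uBall E) ∧ ContinuousOn H (uBall E ×ˢ uI) ∧
    (∀ x ∈ uSph E, G x = g x) ∧ (∀ x ∈ uBall E, H (x, 0) = F x) ∧
    (∀ x ∈ uBall E, H (x, 1) = f (G x)) ∧ (∀ x ∈ uSph E, ∀ s ∈ uI, H (x, s) = F x) ∧
    ∀ x ∈ uBall E, ∀ s ∈ uI, H (x, s) ∈ U

variable (E) in
/-- All lifting problems for `f` on the ball of `E` over `U` are solvable up to homotopy. -/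
def LiftsOn (f : A → B) (U : Set B) : Prop :=
  ∀ (F : E → B) (g : E → A), ContinuousOn F (uBall E) → ContinuousOn g (uSph E) →
    (∀ x ∈ uSph E, f (g x) = F x) → (∀ x ∈ uBall E, F x ∈ U) → Solvable f U F g

variable (E) in
/-- All lifting problems for `f` on the ball of `E` are solvable up to homotopy. -/
abbrev Lifts (f : A → B) : Prop := LiftsOn E f univ

lemma rev_mem_uI {r : ℝ} (h : r ∈ uI) : 1 - r ∈ uI := ⟨by linarith [h.2], by linarith [h.1]⟩

lemma ContinuousOn.rev {F : E × ℝ → B} {s : Set E} (h : ContinuousOn F (s ×ˢ uI)) :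
    ContinuousOn (fun p : E × ℝ => F (p.1, 1 - p.2)) (s ×ˢ uI) :=
  h.comp (by fun_prop) (fun _ hp => ⟨hp.1, rev_mem_uI hp.2⟩)

lemma Solvable.of_homotopy {f : A → B} {U : Set B} (hf : Continuous f) {F : E × ℝ → B}
    {g : E × ℝ → A} (hF : ContinuousOn F (uBall E ×ˢ uI)) (hg : ContinuousOn g (uSph E ×ˢ uI))
    (hfg : ∀ x ∈ uSph E, ∀ r ∈ uI, f (g (x, r)) = F (x, r))
    (hU : ∀ x ∈ uBall E, ∀ r ∈ uI, F (x, r) ∈ U)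
    (h : Solvable f U (fun x => F (x, 1)) (fun x => g (x, 1))) :
    Solvable f U (fun x => F (x, 0)) (fun x => g (x, 0)) := by
  obtain ⟨G, H, cG, cH, Gg, H0, H1, HS, HU⟩ := h
  obtain ⟨K, cK, K0, KS, KU⟩ := hep (F := G) (h := fun p => g (p.1, 1 - p.2)) (U := f ⁻¹' U) cG
    hg.rev (by intro x hx; simp [Gg x hx])
    (by intro x hx; rw [mem_preimage, ← H1 x hx]; exact HU x hx 1 one_mem_uI)
    (by
      intro x hx s hs
      rw [mem_preimage, hfg x hx _ (rev_mem_uI hs)]; exact hU x (uSph_subset hx) _ (rev_mem_uI hs))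
  obtain ⟨Ψ, cΨ, Ψ0, Ψ1, ΨS, ΨU⟩ := box_hep (l := F) (ρ := fun p => f (K (p.1, 1 - p.2)))
    (σ := fun p => F (p.1.1, p.2)) (Φ := H) (U := U) hF (hf.comp_continuousOn cK.rev)
    (hF.comp (by fun_prop) (fun p hp => ⟨uSph_subset hp.1.1, hp.2⟩)) cH (by simp)
    (by
      intro x hx r hr
      simp only
      rw [KS x hx _ (rev_mem_uI hr), sub_sub_cancel, hfg x hx r hr])
    H0 (by intro x hx; simp [H1 x hx, K0 x hx]) HS hU
    (fun x hx r hr => KU x hx _ (rev_mem_uI hr))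
    (fun x hx s hs r hr => hU x (uSph_subset hx) r hr) HU
  refine ⟨fun x => K (x, 1), Ψ, cK.comp (by fun_prop) (fun x hx => ⟨hx, one_mem_uI⟩), cΨ, ?_, Ψ0,
    ?_, ΨS, ΨU⟩
  · intro x hx
    simp [KS x hx 1 one_mem_uI]
  · intro x hx
    simp [Ψ1 x hx]

/-- Extension form of the lifting property: the homotopy on the sphere need not be constant. -/
lemma LiftsOn.extend {f : A → B} {U : Set B} (hf : Continuous f) (hL : LiftsOn E f U)
    {F : E → B} {g : E → A} {h : E × ℝ → B} (hF : ContinuousOn F (uBall E))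
    (hg : ContinuousOn g (uSph E)) (hh : ContinuousOn h (uSph E ×ˢ uI))
    (h0 : ∀ x ∈ uSph E, h (x, 0) = F x) (h1 : ∀ x ∈ uSph E, h (x, 1) = f (g x))
    (hFU : ∀ x ∈ uBall E, F x ∈ U) (hhU : ∀ x ∈ uSph E, ∀ s ∈ uI, h (x, s) ∈ U) :
    ∃ (G : E → A) (H : E × ℝ → B), ContinuousOn G (uBall E) ∧ ContinuousOn H (uBall E ×ˢ uI) ∧
      (∀ x ∈ uSph E, G x = g x) ∧ (∀ x ∈ uBall E, H (x, 0) = F x) ∧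
      (∀ x ∈ uBall E, H (x, 1) = f (G x)) ∧ (∀ x ∈ uSph E, ∀ s ∈ uI, H (x, s) = h (x, s)) ∧
      ∀ x ∈ uBall E, ∀ s ∈ uI, H (x, s) ∈ U := by
  obtain ⟨K, cK, K0, KS, KU⟩ := hep hF hh h0 hFU hhU
  obtain ⟨G, H, cG, cH, Gg, H0, H1, HS, HU⟩ := hL (fun x => K (x, 1)) g
    (cK.comp (by fun_prop) (fun x hx => ⟨hx, one_mem_uI⟩)) hg
    (by intro x hx; rw [KS x hx 1 one_mem_uI, h1 x hx]) (fun x hx => KU x hx 1 one_mem_uI)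
  have hsr : ∀ {s r : ℝ}, s ∈ uI → r ∈ uI → s + r - s * r ∈ uI := by
    intro s r hs hr
    constructor <;> nlinarith [hs.1, hs.2, hr.1, hr.2]
  obtain ⟨Ψ, cΨ, Ψ0, Ψ1, ΨS, ΨU⟩ := box_hep (l := K) (ρ := fun p => f (G p.1))
    (σ := fun p => h (p.1.1, p.1.2 + p.2 - p.1.2 * p.2)) (Φ := H) (U := U) cK
    (hf.comp_continuousOn (cG.comp (by fun_prop) (fun p hp => hp.1)))
    (hh.comp (by fun_prop) (fun p hp => ⟨hp.1.1, hsr hp.1.2 hp.2⟩)) cH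
    (by intro x hx r hr; simp [KS x hx r hr]) (by intro x hx r hr; simp [h1 x hx, Gg x hx])
    H0 H1 (by intro x hx s hs; simp [HS x hx s hs, KS x hx 1 one_mem_uI]) KU
    (by intro x hx r hr; rw [← H1 x hx]; exact HU x hx 1 one_mem_uI)
    (fun x hx s hs r hr => hhU x hx _ (hsr hs hr)) HU
  refine ⟨G, Ψ, cG, cΨ, Gg, ?_, Ψ1, ?_, ΨU⟩
  · intro x hx
    rw [Ψ0 x hx, K0 x hx]
  · intro x hx s hs
    simp [ΨS x hx s hs]

/-- The lifting property is invariant under homotopy of maps. -/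
lemma Lifts.of_homotopy {f f' : A → B} {η : ℝ × A → B} (hη : Continuous η)
    (h0 : ∀ a, η (0, a) = f' a) (h1 : ∀ a, η (1, a) = f a) (hL : Lifts E f) : Lifts E f' := by
  intro F g cF cg hfg _
  have cg' : ContinuousOn (fun p : E × ℝ => η (p.2, g p.1)) (uSph E ×ˢ uI) :=
    hη.comp_continuousOn (continuousOn_snd.prodMk (cg.comp (by fun_prop) (fun p hp => hp.1)))
  obtain ⟨K, cK, K0, KS, -⟩ := hep (U := univ) cF cg' (by intro x hx; simp [h0, hfg x hx])
    (by simp) (by simp)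
  obtain ⟨G, H, cG, cH, Gg, H0, H1, HS, -⟩ := hL (fun x => K (x, 1)) g
    (cK.comp (by fun_prop) (fun x hx => ⟨hx, one_mem_uI⟩)) cg
    (by intro x hx; rw [KS x hx 1 one_mem_uI, h1]) (by simp)
  obtain ⟨Ψ, cΨ, Ψ0, Ψ1, ΨS, -⟩ := box_hep (l := K) (ρ := fun p => η (p.2, G p.1))
    (σ := fun p => η (p.2, g p.1.1)) (Φ := H) (U := univ) cK
    (hη.comp_continuousOn (continuousOn_snd.prodMk (cG.comp (by fun_prop) (fun p hp => hp.1))))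
    (hη.comp_continuousOn (continuousOn_snd.prodMk (cg.comp (by fun_prop) (fun p hp => hp.1.1))))
    cH (by intro x hx r hr; simp [KS x hx r hr]) (by intro x hx r hr; simp [Gg x hx])
    H0 (by intro x hx; simp [H1 x hx, h1])
    (by intro x hx s hs; simp [HS x hx s hs, KS x hx 1 one_mem_uI])
    (by simp) (by simp) (by simp) (by simp)
  refine ⟨G, Ψ, cG, cΨ, Gg, ?_, ?_, ?_, by simp⟩
  · intro x hx
    rw [Ψ0 x hx, K0 x hx]
  · intro x hx
    simp [Ψ1 x hx, h0]
  · intro x hx s hs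
    simp [ΨS x hx s hs, h0, hfg x hx]

lemma Lifts.of_homotopic {f f' : C(A, B)} (h : f'.Homotopic f) (hL : Lifts E f) : Lifts E f' := by
  obtain ⟨η⟩ := h
  refine Lifts.of_homotopy (f := f) (η := fun p => η (projIcc 0 1 zero_le_one p.1, p.2))
    (by fun_prop) ?_ ?_ hL
  · intro a; simp
  · intro a; simp

/-- If `σ` has a left homotopy inverse, then `u` inherits the lifting property of `σ ∘ u`. -/
lemma Lifts.of_comp_left {B' : Type} [TopologicalSpace B'] {u : C(A, B)} {σ : C(B, B')}
    {τ : C(B', B)} (h : (ContinuousMap.id B).Homotopic (τ.comp σ)) (hL : Lifts E (σ ∘ u)) :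
    Lifts E u := by
  obtain ⟨η⟩ := h
  obtain ⟨θ, hθ, θ0, θ1⟩ : ∃ θ : ℝ × B → B, Continuous θ ∧ (∀ b, θ (0, b) = b) ∧
      ∀ b, θ (1, b) = τ (σ b) :=
    ⟨fun p => η (projIcc 0 1 zero_le_one p.1, p.2), by fun_prop, by simp, by simp⟩
  intro F g cF cg hfg _
  obtain ⟨G, H, cG, cH, Gg, H0, H1, HS, -⟩ := hL (fun x => σ (F x)) g
    (σ.continuous.comp_continuousOn cF) cg
    (by intro x hx; simp [hfg x hx]) (by simp)
  have aux : ∀ {f : E → B} {s : Set E}, ContinuousOn f s →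
      ContinuousOn (fun p : E × ℝ => θ (p.2, f p.1)) (s ×ˢ uI) := fun h =>
    hθ.comp_continuousOn (continuousOn_snd.prodMk (h.comp (by fun_prop) (fun p hp => hp.1)))
  obtain ⟨Ψ, cΨ, Ψ0, Ψ1, ΨS, -⟩ := box_hep (l := fun p => θ (p.2, F p.1))
    (ρ := fun p => θ (p.2, u (G p.1)))
    (σ := fun p => θ (p.2, u (g p.1.1))) (Φ := fun p => τ (H p)) (U := univ) (aux cF)
    (aux (u.continuous.comp_continuousOn cG))
    (hθ.comp_continuousOn (continuousOn_snd.prodMk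
      (u.continuous.comp_continuousOn (cg.comp (by fun_prop) (fun p hp => hp.1.1)))))
    (τ.continuous.comp_continuousOn cH) (by intro x hx r hr; simp [hfg x hx])
    (by intro x hx r hr; simp [Gg x hx])
    (by intro x hx; simp [H0 x hx, θ1]) (by intro x hx; simp [H1 x hx, θ1])
    (by intro x hx s hs; simp [HS x hx s hs, θ1, hfg x hx])
    (by simp) (by simp) (by simp) (by simp)
  refine ⟨G, Ψ, cG, cΨ, Gg, ?_, ?_, ?_, by simp⟩
  · intro x hx
    simp [Ψ0 x hx, θ0]
  · intro x hx
    simp [Ψ1 x hx, θ0]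
  · intro x hx s hs
    simp [ΨS x hx s hs, θ0, hfg x hx]

lemma Lifts.comp {f : A → B} {g : B → C} (hf : Continuous f) (hg : Continuous g)
    (h1 : Lifts E f) (h2 : Lifts E g) : Lifts E (g ∘ f) := by
  intro F k cF ck hfk _
  obtain ⟨G, H, cG, cH, Gg, H0, H1, HS, -⟩ := h2 F (f ∘ k) cF (hf.comp_continuousOn ck) hfk
    (by simp)
  have h3 : Solvable (g ∘ f) univ (fun x => H (x, 0)) (fun x => k x) := by
    refine Solvable.of_homotopy (g := fun p => k p.1) (hg.comp hf) cH
      (ck.comp (by fun_prop) (fun p hp => hp.1)) ?_ (by simp) ?_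
    · intro x hx r hr; rw [HS x hx r hr, hfk x hx]
    · obtain ⟨G', H', cG', cH', Gg', H0', H1', HS', -⟩ := h1 G k cG ck
        (by intro x hx; rw [Gg x hx]; rfl) (by simp)
      refine ⟨G', g ∘ H', cG', hg.comp_continuousOn cH', Gg', ?_, ?_, ?_, by simp⟩
      · intro x hx; simp [H0' x hx, H1 x hx]
      · intro x hx; simp [H1' x hx]
      · intro x hx s hs; simp [HS' x hx s hs, H1 x (uSph_subset hx)]
  obtain ⟨G', H', cG', cH', Gg', H0', H1', HS', -⟩ := h3
  refine ⟨G', H', cG', cH', Gg', ?_, H1', ?_, by simp⟩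
  · intro x hx; exact (H0' x hx).trans (H0 x hx)
  · intro x hx s hs; exact (HS' x hx s hs).trans (H0 x (uSph_subset hx))

lemma Lifts.id : Lifts E (id : A → A) := fun F g cF _ hg _ =>
  ⟨F, fun p => F p.1, cF, cF.comp (by fun_prop) (fun _ hp => hp.1), fun x hx => (hg x hx).symm,
    by simp, by simp, by simp, by simp⟩

lemma Lifts.of_leftRightInverse {f : C(A, B)} {f' : C(B, A)}
    (h1 : (ContinuousMap.id B).Homotopic (f.comp f'))
    (h2 : (f'.comp f).Homotopic (ContinuousMap.id A)) : Lifts E f :=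
  Lifts.of_comp_left (σ := f') (τ := f) h1 (Lifts.of_homotopic h2 Lifts.id)

lemma LiftsOn.congr_space {E' : Type} [NormedAddCommGroup E'] [NormedSpace ℝ E']
    (e : E ≃ₜ E') (he : ∀ x, ‖e x‖ = ‖x‖) {f : A → B} {U : Set B} (h : LiftsOn E f U) :
    LiftsOn E' f U := by
  have he' : ∀ x, ‖e.symm x‖ = ‖x‖ := fun x => by rw [← he, e.apply_symm_apply]
  have mB : ∀ x ∈ uBall E, e x ∈ uBall E' := fun x hx => (he x).trans_le hx
  have mS : ∀ x ∈ uSph E, e x ∈ uSph E' := fun x hx => (he x).trans hx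
  have mB' : ∀ x ∈ uBall E', e.symm x ∈ uBall E := fun x hx => (he' x).trans_le hx
  have mS' : ∀ x ∈ uSph E', e.symm x ∈ uSph E := fun x hx => (he' x).trans hx
  intro F g cF cg hfg hU
  obtain ⟨G, H, cG, cH, Gg, H0, H1, HS, HU⟩ := h (F ∘ e) (g ∘ e)
    (cF.comp e.continuous.continuousOn mB) (cg.comp e.continuous.continuousOn mS)
    (fun x hx => hfg _ (mS x hx)) (fun x hx => hU _ (mB x hx))
  refine ⟨G ∘ e.symm, fun p => H (e.symm p.1, p.2),
    cG.comp e.symm.continuous.continuousOn mB',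
    cH.comp (by fun_prop) (fun p hp => ⟨mB' _ hp.1, hp.2⟩), ?_, ?_, ?_, ?_, ?_⟩
  · intro x hx; simp [Gg _ (mS' x hx)]
  · intro x hx; simp [H0 _ (mB' x hx)]
  · intro x hx; simp [H1 _ (mB' x hx)]
  · intro x hx s hs; simp [HS _ (mS' x hx) s hs]
  · intro x hx s hs; exact HU _ (mB' x hx) s hs

lemma LiftsOn.reindex {ι κ : Type} [Fintype ι] [Fintype κ] (e : ι ≃ κ) {f : A → B} {U : Set B}
    (h : LiftsOn (ι → ℝ) f U) : LiftsOn (κ → ℝ) f U :=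
  h.congr_space (E' := κ → ℝ)
    { toFun := fun x k => x (e.symm k)
      invFun := fun x i => x (e i)
      left_inv := fun x => by simp
      right_inv := fun x => by simp
      continuous_toFun := by fun_prop
      continuous_invFun := by fun_prop }
    (fun x => by
      refine le_antisymm ?_ ?_
      · exact (pi_norm_le_iff_of_nonneg (norm_nonneg _)).2 fun k => norm_le_pi_norm x (e.symm k)
      · refine (pi_norm_le_iff_of_nonneg (norm_nonneg _)).2 fun i => ?_
        have := norm_le_pi_norm (fun k => x (e.symm k)) (e i)
        simpa using this)

end Lifting

end

section

open Set

section Lifting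
variable {E : Type} [NormedAddCommGroup E] [NormedSpace ℝ E] {A B C : Type}
  [TopologicalSpace A] [TopologicalSpace B] [TopologicalSpace C]

variable (E) in
/-- The box over the unit ball. -/
abbrev bBox : Set (E × ℝ) := uBall E ×ˢ uI

variable (E) in
/-- The boundary of the box over the unit ball. -/
def bdBox : Set (E × ℝ) := {p | p ∈ bBox E ∧ (p.1 ∈ uSph E ∨ p.2 = 0 ∨ p.2 = 1)}

variable (E) in
/-- The bottom and the sides of the box over the unit ball. -/
def cupBox : Set (E × ℝ) := {p | p ∈ bBox E ∧ (p.1 ∈ uSph E ∨ p.2 = 0)}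

variable (E) in
/-- The affine identification of the unit ball of `E × ℝ` with the box. -/
def affBox : E × ℝ ≃ₜ E × ℝ where
  toFun p := (p.1, (p.2 + 1) / 2)
  invFun p := (p.1, 2 * p.2 - 1)
  left_inv p := Prod.ext rfl (by ring)
  right_inv p := Prod.ext rfl (by ring)
  continuous_toFun := by fun_prop
  continuous_invFun := by fun_prop

lemma affBox_apply (x : E) (u : ℝ) : affBox E (x, u) = (x, (u + 1) / 2) := rfl

lemma affBox_mem_bBox {p : E × ℝ} : affBox E p ∈ bBox E ↔ p ∈ uBall (E × ℝ) := by
  obtain ⟨x, u⟩ := p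
  simp only [affBox_apply, mem_prod, mem_ofPred_eq, Prod.norm_def,
    sup_le_iff, Real.norm_eq_abs, abs_le, uI, mem_Icc]
  refine and_congr_right fun _ => ⟨fun h => ⟨by linarith [h.1], by linarith [h.2]⟩,
      fun h => ⟨by linarith [h.1], by linarith [h.2]⟩⟩

lemma affBox_mem_bdBox {p : E × ℝ} : affBox E p ∈ bdBox E ↔ p ∈ uSph (E × ℝ) := by
  rw [bdBox, mem_ofPred_eq, affBox_mem_bBox]
  obtain ⟨x, u⟩ := p
  simp only [affBox_apply, mem_ofPred_eq, Prod.norm_def,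
    Real.norm_eq_abs]
  constructor
  · rintro ⟨h, h1⟩
    refine le_antisymm h ?_
    rcases h1 with h1 | h1 | h1
    · exact le_max_of_le_left (ge_of_eq h1)
    · have : u = -1 := by linarith
      exact le_max_of_le_right (by rw [this]; norm_num)
    · have : u = 1 := by linarith
      exact le_max_of_le_right (by rw [this]; norm_num)
  · intro h
    refine ⟨h.le, ?_⟩
    rcases max_choice ‖x‖ |u| with h3 | h3
    · left; rw [h3] at h; exact h
    · right
      rw [h3] at h
      rcases abs_eq zero_le_one |>.1 h with h | h
      · right; rw [h]; norm_num
      · left; rw [h]; norm_num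

lemma symm_mem_uBall {p : E × ℝ} (hp : p ∈ bBox E) : (affBox E).symm p ∈ uBall (E × ℝ) := by
  rw [← affBox_mem_bBox, Homeomorph.apply_symm_apply]; exact hp

lemma symm_mem_uSph {p : E × ℝ} (hp : p ∈ bdBox E) : (affBox E).symm p ∈ uSph (E × ℝ) := by
  rw [← affBox_mem_bdBox, Homeomorph.apply_symm_apply]; exact hp

lemma isClosed_bBox : IsClosed (bBox E) := (isClosed_uBall E).prod isClosed_Icc

lemma isClosed_cupBox : IsClosed (cupBox E) :=
  isClosed_bBox.inter (((isClosed_uSph E).preimage continuous_fst).union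
    (isClosed_singleton.preimage continuous_snd))

lemma cupBox_subset {p : E × ℝ} (hp : p ∈ cupBox E) : p ∈ bdBox E :=
  ⟨hp.1, hp.2.imp_right Or.inl⟩

lemma top_mem_bdBox {x : E} (hx : x ∈ uBall E) : (x, (1 : ℝ)) ∈ bdBox E :=
  ⟨⟨hx, one_mem_uI⟩, .inr (.inr rfl)⟩

/-- Solvability of a lifting problem on the box. -/
def SolvableBox (f : A → B) (F : E × ℝ → B) (g : E × ℝ → A) : Prop :=
  Solvable f univ (F ∘ affBox E) (g ∘ affBox E)

lemma SolvableBox.of_homotopy {f : A → B} (hf : Continuous f) {F : (E × ℝ) × ℝ → B}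
    {g : (E × ℝ) × ℝ → A} (hF : ContinuousOn F (bBox E ×ˢ uI))
    (hg : ContinuousOn g (bdBox E ×ˢ uI))
    (hfg : ∀ x ∈ bdBox E, ∀ r ∈ uI, f (g (x, r)) = F (x, r))
    (h : SolvableBox f (fun x => F (x, 1)) (fun x => g (x, 1))) :
    SolvableBox f (fun x => F (x, 0)) (fun x => g (x, 0)) := by
  refine Solvable.of_homotopy (F := fun p => F (affBox E p.1, p.2))
    (g := fun p => g (affBox E p.1, p.2)) hf ?_ ?_ ?_ (by simp) h
  · exact hF.comp (by fun_prop) (fun p hp => ⟨affBox_mem_bBox.2 hp.1, hp.2⟩)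
  · exact hg.comp (by fun_prop) (fun p hp => ⟨affBox_mem_bdBox.2 hp.1, hp.2⟩)
  · exact fun x hx r hr => hfg _ (affBox_mem_bdBox.2 hx) r hr

lemma Lifts.of_box {f : A → B} (h : ∀ (F : E × ℝ → B) (g : E × ℝ → A), ContinuousOn F (bBox E) →
    ContinuousOn g (bdBox E) → (∀ x ∈ bdBox E, f (g x) = F x) → SolvableBox f F g) :
    Lifts (E × ℝ) f := by
  intro F g cF cg hfg _
  have := h (F ∘ (affBox E).symm) (g ∘ (affBox E).symm)
    (cF.comp (affBox E).symm.continuous.continuousOn (fun p hp => symm_mem_uBall hp))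
    (cg.comp (affBox E).symm.continuous.continuousOn (fun p hp => symm_mem_uSph hp))
    (fun p hp => hfg _ (symm_mem_uSph hp))
  rw [SolvableBox] at this
  simpa only [Function.comp_assoc, Homeomorph.symm_comp_self, Function.comp_id] using this

lemma SolvableBox.of_cup_homotopy {f : A → B} (hf : Continuous f) {F : E × ℝ → B}
    {g : E × ℝ → A} {j : (E × ℝ) × ℝ → A} (hF : ContinuousOn F (bBox E))
    (hg : ContinuousOn g (bdBox E)) (hfg : ∀ x ∈ bdBox E, f (g x) = F x)
    (hj : ContinuousOn j (cupBox E ×ˢ uI)) (hj0 : ∀ p ∈ cupBox E, j (p, 0) = g p) :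
    ∃ (F' : E × ℝ → B) (g' : E × ℝ → A), ContinuousOn F' (bBox E) ∧ ContinuousOn g' (bdBox E) ∧
      (∀ x ∈ bdBox E, f (g' x) = F' x) ∧ (∀ p ∈ cupBox E, g' p = j (p, 1)) ∧
      (SolvableBox f F' g' → SolvableBox f F g) := by
  have hcup : ∀ x ∈ uSph E, (x, (1 : ℝ)) ∈ cupBox E := fun x hx =>
    ⟨⟨uSph_subset hx, one_mem_uI⟩, .inl hx⟩
  obtain ⟨K, cK, K0, KS, -⟩ := hep (F := fun x => g (x, 1)) (h := fun p => j ((p.1, 1), p.2))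
    (U := univ) (hg.comp (by fun_prop) (fun x hx => top_mem_bdBox hx))
    (hj.comp (by fun_prop) (fun p hp => ⟨hcup _ hp.1, hp.2⟩)) (fun x hx => hj0 _ (hcup x hx))
    (by simp) (by simp)
  classical
  let γ : (E × ℝ) × ℝ → A := fun p => if p.1.2 = 1 then K (p.1.1, p.2) else j p
  have γj : ∀ p ∈ cupBox E, ∀ r ∈ uI, γ (p, r) = j (p, r) := by
    rintro ⟨x, s⟩ ⟨hp, h⟩ r hr
    simp only [γ]
    split_ifs with h1
    · subst h1
      exact KS x (h.resolve_right one_ne_zero) r hr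
    · rfl
  have cγ : ContinuousOn γ (bdBox E ×ˢ uI) := by
    have hsub : bdBox E ×ˢ uI ⊆ ((uBall E ×ˢ {1}) ×ˢ uI) ∪ (cupBox E ×ˢ uI) := by
      rintro ⟨⟨x, s⟩, r⟩ ⟨⟨h, h1⟩, hr⟩
      rcases h1 with h1 | h1 | h1
      · exact .inr ⟨⟨h, .inl h1⟩, hr⟩
      · exact .inr ⟨⟨h, .inr h1⟩, hr⟩
      · exact .inl ⟨⟨h.1, h1⟩, hr⟩
    refine ContinuousOn.mono (ContinuousOn.union_of_isClosed ?_ (hj.congr ?_)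
      (((isClosed_uBall E).prod isClosed_singleton).prod isClosed_Icc)
      (isClosed_cupBox.prod isClosed_Icc)) hsub
    · refine (cK.comp (f := fun p : (E × ℝ) × ℝ => (p.1.1, p.2)) (by fun_prop)
        (fun p hp => ⟨hp.1.1, hp.2⟩)).congr ?_
      rintro ⟨⟨x, s⟩, r⟩ ⟨⟨_, h⟩, _⟩
      obtain rfl : s = 1 := h
      simp [γ]
    · rintro ⟨p, r⟩ ⟨hp, hr⟩
      exact γj p hp r hr
  have γ0 : ∀ p ∈ bdBox E, γ (p, 0) = g p := by
    rintro ⟨x, s⟩ hp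
    by_cases h : s = 1
    · subst h; simp [γ, K0 x hp.1.1]
    · have : (x, s) ∈ cupBox E := ⟨hp.1, hp.2.imp_right (fun h' => h'.resolve_right h)⟩
      rw [γj _ this 0 zero_mem_uI, hj0 _ this]
  obtain ⟨H, cH, H0, HS, -⟩ := hep (E := E × ℝ) (F := F ∘ affBox E)
    (h := fun p => f (γ (affBox E p.1, p.2))) (U := univ)
    (hF.comp (affBox E).continuous.continuousOn (fun p hp => affBox_mem_bBox.2 hp))
    (hf.comp_continuousOn (cγ.comp (by fun_prop)
      (fun p hp => ⟨affBox_mem_bdBox.2 hp.1, hp.2⟩)))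
    (fun x hx => by
      have := affBox_mem_bdBox.2 hx
      simp only [γ0 _ this, hfg _ this, Function.comp])
    (by simp) (by simp)
  have cH' : ContinuousOn (fun p : (E × ℝ) × ℝ => H ((affBox E).symm p.1, p.2)) (bBox E ×ˢ uI) :=
    cH.comp (by fun_prop) (fun p hp => ⟨symm_mem_uBall hp.1, hp.2⟩)
  have comp' : ∀ x ∈ bdBox E, ∀ r ∈ uI, f (γ (x, r)) = H ((affBox E).symm x, r) := by
    intro x hx r hr
    rw [HS _ (symm_mem_uSph hx) r hr, Homeomorph.apply_symm_apply]
  refine ⟨fun p => H ((affBox E).symm p, 1), fun p => γ (p, 1),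
    cH'.comp (f := fun p => (p, (1 : ℝ))) (by fun_prop) (fun p hp => ⟨hp, one_mem_uI⟩),
    cγ.comp (f := fun p => (p, (1 : ℝ))) (by fun_prop) (fun p hp => ⟨hp, one_mem_uI⟩),
    fun x hx => comp' x hx 1 one_mem_uI, fun p hp => γj p hp 1 one_mem_uI, fun hs => ?_⟩
  obtain ⟨G, K, cG, cK, Gg, KK0, KK1, KKS, -⟩ := SolvableBox.of_homotopy (g := γ) hf cH' cγ comp' hs
  refine ⟨G, K, cG, cK, ?_, ?_, KK1, ?_, by simp⟩
  · intro x hx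
    rw [Gg x hx]; exact γ0 _ (affBox_mem_bdBox.2 hx)
  · intro x hx
    rw [KK0 x hx]
    simp [H0 x hx]
  · intro x hx s hs
    rw [KKS x hx s hs]
    simp [H0 x (uSph_subset hx)]

variable (E) in
/-- Surjectivity on relative homotopy classes of maps from the ball of `E`, based at `z`. -/
def SurjAt (f : A → B) (z : A) : Prop :=
  ∀ D : E → B, ContinuousOn D (uBall E) → (∀ x ∈ uSph E, D x = f z) →
    Solvable f univ D (fun _ => z)

variable (E) in
/-- Triviality of the kernel on relative homotopy classes of maps from the ball of `E`. -/
def KerAt (f : A → B) (z : A) : Prop :=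
  ∀ (g : E → A) (H : E × ℝ → B), ContinuousOn g (uBall E) → (∀ x ∈ uSph E, g x = z) →
    ContinuousOn H (bBox E) → (∀ x ∈ uBall E, H (x, 0) = f (g x)) →
    (∀ x ∈ uBall E, H (x, 1) = f z) → (∀ x ∈ uSph E, ∀ s ∈ uI, H (x, s) = f z) →
    ∃ k : E × ℝ → A, ContinuousOn k (bBox E) ∧ (∀ x ∈ uBall E, k (x, 0) = g x) ∧
      (∀ x ∈ uBall E, k (x, 1) = z) ∧ ∀ x ∈ uSph E, ∀ s ∈ uI, k (x, s) = z

lemma solvableBox_of_cup {f : A → B} (hf : Continuous f) {z : A} (hS : SurjAt (E × ℝ) f z)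
    (hK : KerAt E f z) {F : E × ℝ → B} {g : E × ℝ → A} (hF : ContinuousOn F (bBox E))
    (hg : ContinuousOn g (bdBox E)) (hfg : ∀ x ∈ bdBox E, f (g x) = F x)
    (hgz : ∀ p ∈ cupBox E, g p = z) : SolvableBox f F g := by
  have hbot : ∀ x ∈ uBall E, (x, (0 : ℝ)) ∈ cupBox E := fun x hx => ⟨⟨hx, zero_mem_uI⟩, .inr rfl⟩
  have hside : ∀ x ∈ uSph E, ∀ s ∈ uI, (x, s) ∈ cupBox E := fun x hx s hs =>
    ⟨⟨uSph_subset hx, hs⟩, .inl hx⟩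
  have F0 : ∀ x ∈ uBall E, F (x, 0) = f z := fun x hx => by
    rw [← hfg _ (cupBox_subset (hbot x hx)), hgz _ (hbot x hx)]
  have FS : ∀ x ∈ uSph E, ∀ s ∈ uI, F (x, s) = f z := fun x hx s hs => by
    rw [← hfg _ (cupBox_subset (hside x hx s hs)), hgz _ (hside x hx s hs)]
  have F1 : ∀ x ∈ uBall E, F (x, 1) = f (g (x, 1)) := fun x hx => (hfg _ (top_mem_bdBox hx)).symm
  obtain ⟨k, ck, k0, k1, kS⟩ := hK (fun x => g (x, 1)) (fun p => F (p.1, 1 - p.2))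
    (hg.comp (by fun_prop) (fun x hx => top_mem_bdBox hx))
    (fun x hx => hgz _ (hside x hx 1 one_mem_uI)) hF.rev (by intro x hx; simp [F1 x hx])
    (by intro x hx; simp [F0 x hx]) (fun x hx s hs => FS x hx _ (rev_mem_uI hs))
  let D : E × ℝ → B := fun p => if p.2 ≤ 1 / 2 then F (p.1, 2 * p.2) else f (k (p.1, 2 * p.2 - 1))
  have cD : ContinuousOn D (bBox E) := by
    refine continuousOn_ite_le (φ := fun p : E × ℝ => p.2) (χ := fun _ => 1 / 2) (by fun_prop)
      (by fun_prop) isClosed_bBox ?_ ?_ ?_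
    · exact hF.comp (by fun_prop) (fun p hp => ⟨hp.1.1, by
        have := hp.2; have := hp.1.2.1; simp only [mem_ofPred_eq] at *
        constructor <;> linarith⟩)
    · exact hf.comp_continuousOn (ck.comp (by fun_prop) (fun p hp => ⟨hp.1.1, by
        have := hp.2; have := hp.1.2.2; simp only [mem_ofPred_eq] at *
        constructor <;> linarith⟩))
    · rintro ⟨x, s⟩ ⟨hx, hs⟩ h
      obtain rfl : s = 1 / 2 := h
      norm_num [F1 x hx, k0 x hx]
  have Dbd : ∀ p ∈ bdBox E, D p = f z := by
    rintro ⟨x, s⟩ ⟨⟨hx, hs⟩, h⟩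
    simp only [D]
    split_ifs with h1
    · rcases h with h | h | h
      · exact FS x h _ ⟨by linarith [hs.1], by linarith⟩
      · simp only at h; subst h; simp [F0 x hx]
      · simp only at h; subst h; norm_num at h1
    · rcases h with h | h | h
      · rw [kS x h _ ⟨by linarith, by linarith [hs.2]⟩]
      · simp only at h; subst h; norm_num at h1
      · simp only at h; subst h; norm_num [k1 x hx]
  obtain ⟨G, H, cG, cH, Gz, H0, H1, HS, -⟩ := hS (D ∘ affBox E)
    (cD.comp (affBox E).continuous.continuousOn (fun p hp => affBox_mem_bBox.2 hp))
    (fun p hp => Dbd _ (affBox_mem_bdBox.2 hp))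
  let T : ℝ → ℝ := fun s => min (4 * s - 1) (2 - 2 * s)
  have cT : Continuous T := by fun_prop
  have step : SolvableBox f
      (fun p => if p.2 ≤ 1 / 4 then F (p.1, 4 * p.2) else f (k (p.1, min 1 (T p.2)))) g := by
    let a : E × ℝ → E × ℝ := fun p => (affBox E).symm (p.1, 2 * (affBox E p).2)
    have ca : Continuous a := by fun_prop
    have ha : ∀ p ∈ uBall (E × ℝ), (affBox E p).2 ≤ 1 / 2 → a p ∈ uBall (E × ℝ) := by
      intro p hp h
      have := affBox_mem_bBox.2 hp
      exact symm_mem_uBall ⟨this.1, by linarith [this.2.1], by linarith⟩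
    have haS : ∀ p ∈ uBall (E × ℝ), ((affBox E p).2 = 1 / 2 ∨ (affBox E p).2 = 0 ∨
        ((affBox E p).2 ≤ 1 / 2 ∧ p.1 ∈ uSph E)) → a p ∈ uSph (E × ℝ) := by
      intro p hp h
      have := affBox_mem_bBox.2 hp
      refine symm_mem_uSph ⟨⟨this.1, by rcases h with h | h | h <;> linarith [this.2.1],
        by rcases h with h | h | h <;> linarith⟩, ?_⟩
      rcases h with h | h | h
      · right; right; simp [h]
      · right; left; simp [h]
      · left; exact h.2
    have hk : ∀ p : E × ℝ, p ∈ uBall (E × ℝ) → 1 / 2 ≤ (affBox E p).2 →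
        (p.1, 2 - 2 * (affBox E p).2) ∈ bBox E := by
      intro p hp h
      have := affBox_mem_bBox.2 hp
      exact ⟨this.1, by linarith [this.2.2], by linarith⟩
    have haf : ∀ p : E × ℝ, (affBox E p).1 = p.1 := fun p => rfl
    refine ⟨fun p => if (affBox E p).2 ≤ 1 / 2 then G (a p) else k (p.1, 2 - 2 * (affBox E p).2),
      fun p => if (affBox E p.1).2 ≤ 1 / 2 then H (a p.1, p.2)
        else f (k (p.1.1, 2 - 2 * (affBox E p.1).2)), ?_, ?_, ?_, ?_, ?_, ?_, by simp⟩
    · refine continuousOn_ite_le (φ := fun p : E × ℝ => (affBox E p).2) (χ := fun _ => 1 / 2)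
        (by fun_prop) (by fun_prop) (isClosed_uBall _) ?_ ?_ ?_
      · exact cG.comp ca.continuousOn (fun p hp => ha p hp.1 hp.2)
      · exact ck.comp (by fun_prop) (fun p hp => hk p hp.1 hp.2)
      · intro p hp h
        rw [Gz _ (haS p hp (.inl h)), h]
        norm_num
        exact (k1 _ (affBox_mem_bBox.2 hp).1).symm
    · refine continuousOn_ite_le (φ := fun p : (E × ℝ) × ℝ => (affBox E p.1).2)
        (χ := fun _ => 1 / 2)
        (by fun_prop) (by fun_prop) ((isClosed_uBall _).prod isClosed_Icc) ?_ ?_ ?_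
      · exact cH.comp (by fun_prop) (fun p hp => ⟨ha p.1 hp.1.1 hp.2, hp.1.2⟩)
      · exact hf.comp_continuousOn (ck.comp (by fun_prop) (fun p hp => hk p.1 hp.1.1 hp.2))
      · rintro ⟨p, s⟩ ⟨hp, hs⟩ h
        have h : (affBox E p).2 = 1 / 2 := h
        simp only [HS _ (haS p hp (.inl h)) s hs, h]
        norm_num
        rw [Dbd _ (affBox_mem_bdBox.2 (haS p hp (.inl h)))]
        exact congrArg f (k1 _ (affBox_mem_bBox.2 hp).1).symm
    · intro p hp
      obtain ⟨⟨hx, hs⟩, h⟩ := affBox_mem_bdBox.2 hp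
      have hp' : p ∈ uBall (E × ℝ) := uSph_subset hp
      simp only [Function.comp]
      split_ifs with h1
      · have hc : affBox E p ∈ cupBox E := ⟨⟨hx, hs⟩, by
          rcases h with h | h | h
          · exact .inl h
          · exact .inr h
          · rw [h] at h1; norm_num at h1⟩
        rw [hgz _ hc]
        refine Gz _ (haS p hp' ?_)
        rcases hc.2 with h | h
        · exact .inr (.inr ⟨h1, h⟩)
        · exact .inr (.inl h)
      · rcases h with h | h | h
        · have hc : affBox E p ∈ cupBox E := ⟨⟨hx, hs⟩, .inl h⟩
          rw [hgz _ hc]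
          exact kS _ h _ (hk p hp' (not_le.1 h1).le).2
        · rw [h] at h1; norm_num at h1
        · rw [h]; norm_num
          refine (k0 _ hx).trans (congrArg g ?_)
          exact Prod.ext rfl h.symm
    · intro p hp
      obtain ⟨hx, hs⟩ := affBox_mem_bBox.2 hp
      simp only [Function.comp]
      set s := (affBox E p).2 with hsdef
      by_cases h1 : s ≤ 1 / 2
      · rw [if_pos h1, H0 _ (ha p hp h1)]
        simp only [Function.comp, a, Homeomorph.apply_symm_apply, D, haf, ← hsdef]
        by_cases h2 : s ≤ 1 / 4
        · rw [if_pos h2, if_pos (by linarith)]; ring_nf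
        · rw [if_neg h2, if_neg (by linarith)]
          have : min 1 (T s) = 2 * (2 * s) - 1 := by
            simp only [T]
            rw [min_eq_left (a := 4 * s - 1) (by linarith), min_eq_right (by linarith)]; ring
          rw [this]
      · rw [if_neg h1, if_neg (by linarith)]
        have : min 1 (T s) = 2 - 2 * s := by
          simp only [T]
          rw [min_eq_right (a := 4 * s - 1) (by linarith), min_eq_right (by linarith)]
        rw [this, haf]
    · intro p hp
      simp only
      split_ifs with h1
      · exact H1 _ (ha p hp h1)
      · rfl
    · intro p hp r hr
      obtain ⟨⟨hx, hs⟩, h⟩ := affBox_mem_bdBox.2 hp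
      have hp' : p ∈ uBall (E × ℝ) := uSph_subset hp
      simp only [Function.comp]
      set s := (affBox E p).2 with hsdef
      by_cases h1 : s ≤ 1 / 2
      · have hc : a p ∈ uSph (E × ℝ) := by
          refine haS p hp' ?_
          rcases h with h | h | h
          · exact .inr (.inr ⟨h1, h⟩)
          · exact .inr (.inl h)
          · rw [h] at h1; norm_num at h1
        rw [if_pos h1, HS _ hc r hr]
        simp only [Function.comp, a, Homeomorph.apply_symm_apply, D, haf, ← hsdef]
        by_cases h2 : s ≤ 1 / 4
        · rw [if_pos h2, if_pos (by linarith)]; ring_nf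
        · rw [if_neg h2, if_neg (by linarith)]
          have : min 1 (T s) = 2 * (2 * s) - 1 := by
            simp only [T]
            rw [min_eq_left (a := 4 * s - 1) (by linarith), min_eq_right (by linarith)]; ring
          rw [this]
      · rw [if_neg h1, if_neg (by linarith)]
        have : min 1 (T s) = 2 - 2 * s := by
          simp only [T]
          rw [min_eq_right (a := 4 * s - 1) (by linarith), min_eq_right (by linarith)]
        rw [this, haf]
  have hT : ∀ s ∈ uI, 1 / 4 ≤ s → 0 ≤ T s ∧ T 1 = 0 := by
    intro s hs h
    refine ⟨le_min (by linarith) (by linarith [hs.2]), by norm_num [T]⟩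
  have step2 : SolvableBox f
      (fun p => if p.2 ≤ 1 / 4 then F (p.1, 4 * p.2) else f (k (p.1, min 0 (T p.2)))) g := by
    refine SolvableBox.of_homotopy (F := fun p => if p.1.2 ≤ 1 / 4 then F (p.1.1, 4 * p.1.2)
      else f (k (p.1.1, min p.2 (T p.1.2)))) (g := fun p => g p.1) hf ?_
      (hg.comp (by fun_prop) (fun p hp => hp.1)) ?_ step
    · refine continuousOn_ite_le (φ := fun p : (E × ℝ) × ℝ => p.1.2) (χ := fun _ => 1 / 4)
        (by fun_prop) (by fun_prop) (isClosed_bBox.prod isClosed_Icc) ?_ ?_ ?_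
      · exact hF.comp (by fun_prop) (fun p hp => ⟨hp.1.1.1, by
          have := hp.2; have := hp.1.1.2.1; simp only [mem_ofPred_eq] at *
          constructor <;> linarith⟩)
      · refine hf.comp_continuousOn (ck.comp (by fun_prop) (fun p hp => ⟨hp.1.1.1, ?_, ?_⟩))
        · exact le_min hp.1.2.1 (hT _ hp.1.1.2 hp.2).1
        · exact (min_le_left _ _).trans hp.1.2.2
      · rintro ⟨⟨x, s⟩, r⟩ ⟨⟨hx, hs⟩, hr⟩ h
        obtain rfl : s = 1 / 4 := h
        have : min r (T (1 / 4)) = 0 := by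
          have : T (1 / 4) = 0 := by norm_num [T]
          rw [this]; exact min_eq_right hr.1
        simp only [this]
        norm_num [F1 x hx, k0 x hx]
    · rintro ⟨x, s⟩ ⟨⟨hx, hs⟩, h⟩ r hr
      simp only
      rcases h with h | h | h
      · rw [hgz _ (hside x h s hs)]
        split_ifs with h1
        · rw [FS x h _ ⟨by linarith [hs.1], by linarith⟩]
        · rw [kS x h _ ⟨le_min hr.1 (hT s hs (not_le.1 h1).le).1, (min_le_left _ _).trans hr.2⟩]
      · simp only at h; subst h
        norm_num
        rw [hfg _ (cupBox_subset (hbot x hx))]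
      · simp only at h; subst h
        have : T 1 = 0 := by norm_num [T]
        norm_num [this, hr.1]
        rw [k0 x hx]
  have step3 := SolvableBox.of_homotopy (F := fun p => F (p.1.1, min 1 (p.1.2 + 3 * p.2 * p.1.2)))
    (g := fun p => g p.1) hf
    (hF.comp (by fun_prop) (fun p hp => ⟨hp.1.1, le_min zero_le_one (by
      have := hp.1.2.1; have := hp.2.1; positivity), min_le_left _ _⟩))
    (hg.comp (by fun_prop) (fun p hp => hp.1)) (by
      rintro ⟨x, s⟩ ⟨⟨hx, hs⟩, h⟩ r hr
      simp only
      rcases h with h | h | h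
      · rw [hgz _ (hside x h s hs), FS x h _ ⟨le_min zero_le_one (by
          have := hs.1; have := hr.1; positivity), min_le_left _ _⟩]
      · simp only at h; subst h
        norm_num
        rw [hfg _ (cupBox_subset (hbot x hx))]
      · simp only at h; subst h
        rw [min_eq_left (by linarith [hr.1]), F1 x hx])
    (by
      obtain ⟨G', K, cG', cK, Gg, KK0, KK1, KKS, -⟩ := step2
      have eq : ∀ p ∈ bBox E, (if p.2 ≤ 1 / 4 then F (p.1, 4 * p.2)
          else f (k (p.1, min 0 (T p.2)))) = F (p.1, min 1 (p.2 + 3 * 1 * p.2)) := by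
        rintro ⟨x, s⟩ ⟨hx, hs⟩
        simp only
        split_ifs with h1
        · rw [min_eq_right (by linarith)]; ring_nf
        · rw [min_eq_left (b := T s) (hT s hs (not_le.1 h1).le).1,
            min_eq_left (by linarith), k0 x hx, F1 x hx]
      refine ⟨G', K, cG', cK, Gg, ?_, KK1, ?_, by simp⟩
      · intro p hp
        rw [KK0 p hp]
        exact eq _ (affBox_mem_bBox.2 hp)
      · intro p hp s hs
        rw [KKS p hp s hs]
        exact eq _ (affBox_mem_bBox.2 (uSph_subset hp)))
  obtain ⟨G', K, cG', cK, Gg, KK0, KK1, KKS, -⟩ := step3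
  have eq : ∀ p ∈ bBox E, F (p.1, min 1 (p.2 + 3 * 0 * p.2)) = F p := by
    rintro ⟨x, s⟩ ⟨hx, hs⟩
    simp only [mul_zero, zero_mul, add_zero]
    rw [min_eq_right hs.2]
  refine ⟨G', K, cG', cK, Gg, ?_, KK1, ?_, by simp⟩
  · intro p hp
    rw [KK0 p hp]
    exact eq _ (affBox_mem_bBox.2 hp)
  · intro p hp s hs
    rw [KKS p hp s hs]
    exact eq _ (affBox_mem_bBox.2 (uSph_subset hp))

/-- The lifting property follows from surjectivity and triviality of kernels at sufficiently many
base points. -/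
theorem Lifts.of_surjAt_kerAt {f : A → B} (hf : Continuous f)
    (h : ∀ a : A, ∃ z, Joined a z ∧ SurjAt (E × ℝ) f z ∧ KerAt E f z) : Lifts (E × ℝ) f := by
  refine Lifts.of_box fun F g cF cg hfg => ?_
  obtain ⟨z, ⟨γ⟩, hS, hK⟩ := h (g (0, 0))
  obtain ⟨F₁, g₁, cF₁, cg₁, hfg₁, e₁, i₁⟩ := SolvableBox.of_cup_homotopy
    (j := fun p => g (min 1 (2 - 2 * p.2) • p.1.1, max 0 (1 - 2 * p.2) * p.1.2)) hf cF cg hfg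
    (by
      refine cg.comp (by fun_prop) ?_
      rintro ⟨⟨x, s⟩, r⟩ ⟨⟨⟨hx, hs⟩, h⟩, hr⟩
      have m1 : 0 ≤ min 1 (2 - 2 * r) := le_min zero_le_one (by linarith [hr.2])
      have m2 : 0 ≤ max 0 (1 - 2 * r) := le_max_left _ _
      have m3 : max 0 (1 - 2 * r) ≤ 1 := max_le zero_le_one (by linarith [hr.1])
      refine ⟨⟨?_, mul_nonneg m2 hs.1, mul_le_one₀ m3 hs.1 hs.2⟩, ?_⟩
      · simp only [mem_ofPred_eq, norm_smul]
        rw [Real.norm_of_nonneg m1]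
        exact mul_le_one₀ (min_le_left _ _) (norm_nonneg _) hx
      · rcases h with h | h
        · rcases le_total r (1 / 2) with h2 | h2
          · left
            have : ‖x‖ = 1 := h
            simp only [mem_ofPred_eq, norm_smul]
            rw [min_eq_left (by linarith), this]; simp
          · right; left
            simp only
            rw [max_eq_left (by linarith), zero_mul]
        · right; left
          simp only at h ⊢
          rw [h, mul_zero])
    (by rintro ⟨x, s⟩ _; norm_num)
  refine i₁ ?_
  have e₁' : ∀ p ∈ cupBox E, g₁ p = g (0, 0) := by
    intro p hp; rw [e₁ p hp]; norm_num
  obtain ⟨F₂, g₂, cF₂, cg₂, hfg₂, e₂, i₂⟩ := SolvableBox.of_cup_homotopy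
    (j := fun p => γ.extend p.2) hf cF₁ cg₁ hfg₁ (by fun_prop)
    (by intro p hp; simp [e₁' p hp])
  refine i₂ (solvableBox_of_cup hf hS hK cF₂ cg₂ hfg₂ ?_)
  intro p hp; rw [e₂ p hp]; simp

end Lifting

end

section

open Set

section Lifting
variable {E : Type} [NormedAddCommGroup E] [NormedSpace ℝ E] {A B C : Type}
  [TopologicalSpace A] [TopologicalSpace B] [TopologicalSpace C]

/-- The isometric identification of `ℝ^q × ℝ` with `ℝ^(q+1)`. -/
def consHomeo (q : ℕ) : (Fin q → ℝ) × ℝ ≃ₜ (Fin (q + 1) → ℝ) where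
  toFun := fun x => Fin.cons x.2 x.1
  invFun := fun x => (fun i => x i.succ, x 0)
  left_inv := fun x => by simp
  right_inv := fun x => by ext i; refine Fin.cases ?_ (fun j => ?_) i <;> simp
  continuous_toFun := continuous_pi fun i => by
    refine Fin.cases ?_ (fun j => ?_) i
    · simpa using continuous_snd
    · simp only [Fin.cons_succ]; fun_prop
  continuous_invFun := by fun_prop

lemma norm_consHomeo {q : ℕ} (x : (Fin q → ℝ) × ℝ) : ‖consHomeo q x‖ = ‖x‖ := by
  have h2 := pi_norm_le_iff_of_nonneg (x := (Fin.cons x.2 x.1 : Fin (q + 1) → ℝ))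
    (norm_nonneg x)
  refine le_antisymm ?_ ?_
  · refine h2.2 (fun i => ?_)
    refine Fin.cases ?_ (fun j => ?_) i
    · exact norm_snd_le x
    · exact (norm_le_pi_norm x.1 j).trans (norm_fst_le x)
  · refine max_le ?_ (norm_le_pi_norm (Fin.cons x.2 x.1 : Fin (q + 1) → ℝ) 0)
    refine (pi_norm_le_iff_of_nonneg (norm_nonneg _)).2 fun j => ?_
    exact norm_le_pi_norm (Fin.cons x.2 x.1 : Fin (q + 1) → ℝ) j.succ

lemma LiftsOn.of_prod {q : ℕ} {f : A → B} {U : Set B} (h : LiftsOn ((Fin q → ℝ) × ℝ) f U) :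
    LiftsOn (Fin (q + 1) → ℝ) f U :=
  h.congr_space (consHomeo q) norm_consHomeo

lemma LiftsOn.to_prod {q : ℕ} {f : A → B} {U : Set B} (h : LiftsOn (Fin (q + 1) → ℝ) f U) :
    LiftsOn ((Fin q → ℝ) × ℝ) f U :=
  h.congr_space (consHomeo q).symm fun x => by
    rw [← norm_consHomeo, Homeomorph.apply_symm_apply]

lemma SurjAt.to_prod {q : ℕ} {f : A → B} {z : A} (h : SurjAt (Fin (q + 1) → ℝ) f z) :
    SurjAt ((Fin q → ℝ) × ℝ) f z := by
  have n' : ∀ x, ‖(consHomeo q).symm x‖ = ‖x‖ := fun x => by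
    rw [← norm_consHomeo, Homeomorph.apply_symm_apply]
  have mB : ∀ x ∈ uBall _, consHomeo q x ∈ uBall _ := fun x hx => (norm_consHomeo x).trans_le hx
  have mS : ∀ x ∈ uSph _, consHomeo q x ∈ uSph _ := fun x hx => (norm_consHomeo x).trans hx
  have mB' : ∀ x ∈ uBall _, (consHomeo q).symm x ∈ uBall _ := fun x hx => (n' x).trans_le hx
  have mS' : ∀ x ∈ uSph _, (consHomeo q).symm x ∈ uSph _ := fun x hx => (n' x).trans hx
  intro D cD hD
  obtain ⟨G, H, cG, cH, Gg, H0, H1, HS, HU⟩ := h (D ∘ (consHomeo q).symm)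
    (cD.comp (consHomeo q).symm.continuous.continuousOn mB') (fun x hx => hD _ (mS' x hx))
  refine ⟨G ∘ consHomeo q, fun p => H (consHomeo q p.1, p.2),
    cG.comp (consHomeo q).continuous.continuousOn mB,
    cH.comp (by fun_prop) (fun p hp => ⟨mB _ hp.1, hp.2⟩), ?_, ?_, ?_, ?_, by simp⟩
  · intro x hx; simp [Gg _ (mS x hx)]
  · intro x hx; simp [H0 _ (mB x hx)]
  · intro x hx; simp [H1 _ (mB x hx)]
  · intro x hx s hs; simp [HS _ (mS x hx) s hs]

/-- Lifting problems on the box over the ball are solvable. -/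
lemma Lifts.box {f : A → B} (h : Lifts (E × ℝ) f) {F : E × ℝ → B} {g : E × ℝ → A}
    (cF : ContinuousOn F (bBox E)) (cg : ContinuousOn g (bdBox E))
    (hfg : ∀ x ∈ bdBox E, f (g x) = F x) :
    ∃ (G : E × ℝ → A) (H : (E × ℝ) × ℝ → B), ContinuousOn G (bBox E) ∧
      ContinuousOn H (bBox E ×ˢ uI) ∧ (∀ x ∈ bdBox E, G x = g x) ∧
      (∀ x ∈ bBox E, H (x, 0) = F x) ∧ (∀ x ∈ bBox E, H (x, 1) = f (G x)) ∧
      ∀ x ∈ bdBox E, ∀ s ∈ uI, H (x, s) = F x := by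
  obtain ⟨G, H, cG, cH, Gg, H0, H1, HS, -⟩ := h (F ∘ affBox E) (g ∘ affBox E)
    (cF.comp (affBox E).continuous.continuousOn (fun p hp => affBox_mem_bBox.2 hp))
    (cg.comp (affBox E).continuous.continuousOn (fun p hp => affBox_mem_bdBox.2 hp))
    (fun p hp => hfg _ (affBox_mem_bdBox.2 hp)) (by simp)
  refine ⟨G ∘ (affBox E).symm, fun p => H ((affBox E).symm p.1, p.2),
    cG.comp (affBox E).symm.continuous.continuousOn (fun p hp => symm_mem_uBall hp),
    cH.comp (by fun_prop) (fun p hp => ⟨symm_mem_uBall hp.1, hp.2⟩), ?_, ?_, ?_, ?_⟩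
  · intro x hx; simp [Gg _ (symm_mem_uSph hx)]
  · intro x hx; simp [H0 _ (symm_mem_uBall hx)]
  · intro x hx; simp [H1 _ (symm_mem_uBall hx)]
  · intro x hx s hs; simp [HS _ (symm_mem_uSph hx) s hs]

lemma uSph_fin_zero (x : Fin 0 → ℝ) : x ∉ uSph (Fin 0 → ℝ) := by
  intro h
  have h : ‖x‖ = 1 := h
  rw [Subsingleton.elim x 0, norm_zero] at h
  exact zero_ne_one h

lemma lifts_zero {f : A → B} (h : ∀ b, ∃ a, Joined b (f a)) : Lifts (Fin 0 → ℝ) f := by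
  intro F g _ _ _ _
  obtain ⟨a, ⟨γ⟩⟩ := h (F 0)
  refine ⟨fun _ => a, fun p => γ.extend p.2, by fun_prop, by fun_prop, ?_, ?_, ?_, ?_, by simp⟩
  · exact fun x hx => (uSph_fin_zero x hx).elim
  · intro x _; simp [Subsingleton.elim x 0]
  · simp
  · exact fun x hx => (uSph_fin_zero x hx).elim

lemma zero_mem_uBall : (0 : E) ∈ uBall E := by simp

lemma joined_of_continuousOn {h : ℝ → B} (ch : ContinuousOn h uI) : Joined (h 0) (h 1) :=
  ⟨{  toFun := fun s => h s
      continuous_toFun := ch.comp_continuous continuous_subtype_val (fun s => s.2)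
      source' := by simp
      target' := by simp }⟩

lemma Lifts.joined [Nonempty A] {f : A → B} (h : Lifts (Fin 0 → ℝ) f) (b : B) :
    ∃ a, Joined b (f a) := by
  obtain ⟨G, H, cG, cH, Gg, H0, H1, HS, -⟩ := h (fun _ => b) (fun _ => Classical.arbitrary A)
    (by fun_prop) (by fun_prop) (fun x hx => (uSph_fin_zero x hx).elim) (by simp)
  refine ⟨G 0, ?_⟩
  have := joined_of_continuousOn (h := fun s => H (0, s))
    (cH.comp (by fun_prop) (fun s hs => ⟨zero_mem_uBall, hs⟩))
  rwa [H0 _ zero_mem_uBall, H1 _ zero_mem_uBall] at this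

/-- The inductive step of cancellation of lifting properties on the right. -/
lemma KerAt.of_comp {A₀ : Type} [TopologicalSpace A₀] {i : A₀ → A} {f : A → B}
    (hi : Continuous i) (hf : Continuous f) (a₀ : A₀)
    (h1 : Lifts E i) (h2 : Lifts (E × ℝ) (f ∘ i)) : KerAt E f (i a₀) := by
  intro g H cg gS cH H0 H1 HS
  obtain ⟨G, K, cG, cK, GS, K0, K1, KS, -⟩ := h1 g (fun _ => a₀) cg (by fun_prop)
    (fun x hx => (gS x hx).symm) (by simp)
  have m1 : ∀ {s : ℝ}, s ∈ uI → s ≤ 1 / 2 → 2 * s ∈ uI := fun hs h =>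
    ⟨by linarith [hs.1], by linarith⟩
  have m2 : ∀ {s : ℝ}, s ∈ uI → 1 / 2 ≤ s → 2 * s - 1 ∈ uI := fun hs h =>
    ⟨by linarith, by linarith [hs.2]⟩
  obtain ⟨k, -, ck, -, kS, -⟩ := h2.box
    (F := fun p => if p.2 ≤ 1 / 2 then f (K (p.1, 1 - 2 * p.2)) else H (p.1, 2 * p.2 - 1))
    (g := fun p => if p.2 ≤ 1 / 2 then G p.1 else a₀)
    (by
      refine continuousOn_ite_le (by fun_prop) (by fun_prop) isClosed_bBox ?_ ?_ ?_
      · exact hf.comp_continuousOn (cK.comp (by fun_prop)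
          (fun p hp => ⟨hp.1.1, rev_mem_uI (m1 hp.1.2 hp.2)⟩))
      · exact cH.comp (by fun_prop) (fun p hp => ⟨hp.1.1, m2 hp.1.2 hp.2⟩)
      · rintro ⟨x, s⟩ hx (rfl : s = 1 / 2)
        norm_num
        rw [H0 x hx.1, K0 x hx.1])
    (by
      refine continuousOn_ite_le (by fun_prop) (by fun_prop) ?_ ?_ ?_ ?_
      · exact isClosed_bBox.inter (((isClosed_uSph E).preimage continuous_fst).union
          ((isClosed_singleton.preimage continuous_snd).union
            (isClosed_singleton.preimage continuous_snd)))
      · exact cG.comp (by fun_prop) (fun p hp => hp.1.1.1)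
      · fun_prop
      · rintro ⟨x, s⟩ hx (rfl : s = 1 / 2)
        rcases hx.2 with h | h | h
        · exact GS x h
        · norm_num at h
        · norm_num at h)
    (by
      rintro ⟨x, s⟩ ⟨⟨hx, hs⟩, h⟩
      rcases h with h | h | h
      · have h : x ∈ uSph E := h
        by_cases h3 : s ≤ 1 / 2
        · simp only [h3, if_true, Function.comp_apply]
          rw [GS x h, KS x h _ (rev_mem_uI (m1 hs h3)), gS x h]
        · simp only [h3, if_false, Function.comp_apply]
          rw [HS x h _ (m2 hs (not_le.1 h3).le)]
      · have h : s = 0 := h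
        simp [h, K1 x hx]
      · have h : s = 1 := h
        norm_num [h, H1 x hx])
  refine ⟨fun p => if p.2 ≤ 1 / 2 then K (p.1, 2 * p.2) else i (k (p.1, 2 * p.2 - 1)), ?_, ?_, ?_,
    ?_⟩
  · refine continuousOn_ite_le (by fun_prop) (by fun_prop) isClosed_bBox ?_ ?_ ?_
    · exact cK.comp (by fun_prop) (fun p hp => ⟨hp.1.1, m1 hp.1.2 hp.2⟩)
    · exact hi.comp_continuousOn (ck.comp (by fun_prop) (fun p hp => ⟨hp.1.1, m2 hp.1.2 hp.2⟩))
    · rintro ⟨x, s⟩ hx (rfl : s = 1 / 2)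
      norm_num
      have : (x, (0 : ℝ)) ∈ bdBox E := ⟨⟨hx.1, zero_mem_uI⟩, .inr (.inl rfl)⟩
      rw [K1 x hx.1, kS _ this]
      norm_num
  · intro x hx; norm_num; exact K0 x hx
  · intro x hx
    norm_num
    rw [kS _ (top_mem_bdBox hx)]
    norm_num
  · intro x hx s hs
    by_cases h3 : s ≤ 1 / 2
    · simp only [h3, if_true]
      rw [KS x hx _ (m1 hs h3), gS x hx]
    · simp only [h3, if_false]
      rw [kS _ ⟨⟨uSph_subset hx, m2 hs (not_le.1 h3).le⟩, .inl hx⟩]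
      simp [GS x hx]

/-- Cancellation of lifting properties on the right. -/
theorem Lifts.of_comp_right {A₀ : Type} [TopologicalSpace A₀] [Nonempty A₀] {i : A₀ → A}
    {f : A → B} (hi : Continuous i) (hf : Continuous f) {q : ℕ}
    (h1 : ∀ j ≤ q, Lifts (Fin j → ℝ) i) (h2 : ∀ j ≤ q, Lifts (Fin j → ℝ) (f ∘ i)) :
    ∀ j ≤ q, Lifts (Fin j → ℝ) f := by
  intro j hj
  cases j with
  | zero =>
    exact lifts_zero fun b => (Lifts.joined (h2 0 hj) b).imp' i fun _ h => h
  | succ j =>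
    refine LiftsOn.of_prod (Lifts.of_surjAt_kerAt hf fun a => ?_)
    obtain ⟨a₀, h⟩ := Lifts.joined (h1 0 (Nat.zero_le _)) a
    refine ⟨i a₀, h, SurjAt.to_prod ?_, KerAt.of_comp hi hf a₀ (h1 j (by lia))
      (LiftsOn.to_prod (h2 (j + 1) hj))⟩
    intro D cD hD
    obtain ⟨G, H, cG, cH, Gg, H0, H1, HS, HU⟩ := h2 (j + 1) hj D (fun _ => a₀) cD (by fun_prop)
      (fun x hx => (hD x hx).symm) (by simp)
    exact ⟨i ∘ G, H, hi.comp_continuousOn cG, cH, fun x hx => by simp [Gg x hx], H0, H1, HS, HU⟩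

end Lifting

end

section

open Set

section Groups
variable {A B : Type} [TopologicalSpace A] [TopologicalSpace B]

/-- The affine map from the ball of `ℝ^q` (sup norm) to the unit cube. -/
def toCube {q : ℕ} (x : Fin q → ℝ) : Fin q → unitInterval :=
  fun i => projIcc 0 1 zero_le_one ((x i + 1) / 2)

/-- The affine map from the unit cube to the ball of `ℝ^q` (sup norm). -/
def fromCube {q : ℕ} (y : Fin q → unitInterval) : Fin q → ℝ := fun i => 2 * (y i : ℝ) - 1

lemma continuous_toCube {q : ℕ} : Continuous (toCube (q := q)) := by
  unfold toCube; fun_prop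

lemma continuous_fromCube {q : ℕ} : Continuous (fromCube (q := q)) := by
  unfold fromCube; fun_prop

lemma toCube_fromCube {q : ℕ} (y : Fin q → unitInterval) : toCube (fromCube y) = y := by
  ext i
  simp only [toCube, fromCube]
  rw [show (2 * (y i : ℝ) - 1 + 1) / 2 = y i by ring, projIcc_val]

lemma fromCube_toCube {q : ℕ} {x : Fin q → ℝ} (hx : x ∈ uBall (Fin q → ℝ)) :
    fromCube (toCube x) = x := by
  ext i
  have h : |x i| ≤ 1 := (norm_le_pi_norm x i).trans hx
  rw [abs_le] at h
  simp only [toCube, fromCube]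
  rw [projIcc_of_mem zero_le_one ⟨by linarith [h.1], by linarith [h.2]⟩]
  ring

lemma fromCube_mem_uBall {q : ℕ} (y : Fin q → unitInterval) : fromCube y ∈ uBall (Fin q → ℝ) := by
  refine (pi_norm_le_iff_of_nonneg zero_le_one).2 fun i => ?_
  simp only [fromCube, Real.norm_eq_abs, abs_le]
  exact ⟨by linarith [(y i).2.1], by linarith [(y i).2.2]⟩

lemma fromCube_mem_uSph {q : ℕ} {y : Fin q → unitInterval} (h : y ∈ Cube.boundary (Fin q)) :
    fromCube y ∈ uSph (Fin q → ℝ) := by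
  obtain ⟨i, hi⟩ := h
  refine le_antisymm (fromCube_mem_uBall y) (le_trans (le_of_eq ?_) (norm_le_pi_norm _ i))
  rcases hi with hi | hi <;> norm_num [fromCube, hi]

lemma toCube_mem_boundary {q : ℕ} {x : Fin q → ℝ} (hx : x ∈ uSph (Fin q → ℝ)) :
    toCube x ∈ Cube.boundary (Fin q) := by
  have h1 : ‖x‖ = 1 := hx
  by_contra h
  have h2 : ∀ i, ‖x i‖ < 1 := by
    intro i
    refine lt_of_le_of_ne ((norm_le_pi_norm x i).trans hx.le) fun h3 => h ⟨i, ?_⟩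
    rw [Real.norm_eq_abs] at h3
    rcases (abs_eq zero_le_one).1 h3 with h3 | h3
    · right; simp [toCube, h3]
    · left; simp [toCube, h3]
  exact (((pi_norm_lt_iff zero_lt_one).2 h2).ne h1).elim

/-- The generalized loop given by a map of pairs on the ball. -/
def loopOf {q : ℕ} {D : (Fin q → ℝ) → B} {b : B} (cD : ContinuousOn D (uBall (Fin q → ℝ)))
    (hD : ∀ x ∈ uSph (Fin q → ℝ), D x = b) : GenLoop (Fin q) B b :=
  ⟨⟨fun y => D (fromCube y), cD.comp_continuous continuous_fromCube fromCube_mem_uBall⟩,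
    fun y hy => hD _ (fromCube_mem_uSph hy)⟩

lemma homotopicRel_of_box {q : ℕ} {p p' : C(Fin q → unitInterval, B)}
    {k : (Fin q → ℝ) × ℝ → B}
    (ck : ContinuousOn k (bBox (Fin q → ℝ))) (h0 : ∀ x ∈ uBall (Fin q → ℝ), k (x, 0) = p (toCube x))
    (h1 : ∀ x ∈ uBall (Fin q → ℝ), k (x, 1) = p' (toCube x))
    (hS : ∀ x ∈ uSph (Fin q → ℝ), ∀ s ∈ uI, k (x, s) = p (toCube x)) :
    p.HomotopicRel p' (Cube.boundary (Fin q)) :=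
  ⟨{  toFun := fun x => k (fromCube x.2, x.1)
      continuous_toFun := ck.comp_continuous
        ((continuous_fromCube.comp continuous_snd).prodMk (by fun_prop))
        (fun x => ⟨fromCube_mem_uBall _, x.1.2⟩)
      map_zero_left := fun y => by
        simpa [toCube_fromCube] using h0 _ (fromCube_mem_uBall y)
      map_one_left := fun y => by
        simpa [toCube_fromCube] using h1 _ (fromCube_mem_uBall y)
      prop' := fun s y hy => by
        simpa [toCube_fromCube] using hS _ (fromCube_mem_uSph hy) s s.2 }⟩

lemma box_of_homotopicRel {q : ℕ} {p p' : C(Fin q → unitInterval, B)}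
    (h : p.HomotopicRel p' (Cube.boundary (Fin q))) :
    ∃ k : (Fin q → ℝ) × ℝ → B, Continuous k ∧ (∀ x, k (x, 0) = p (toCube x)) ∧
      (∀ x, k (x, 1) = p' (toCube x)) ∧
      ∀ x ∈ uSph (Fin q → ℝ), ∀ s, k (x, s) = p (toCube x) := by
  obtain ⟨K⟩ := h
  have := continuous_toCube (q := q)
  refine ⟨fun x => K (projIcc 0 1 zero_le_one x.2, toCube x.1), by fun_prop, ?_, ?_, ?_⟩
  · intro x; simp
  · intro x; simp
  · intro x hx s
    exact K.eq_fst _ (toCube_mem_boundary hx)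

lemma SurjAt.of_piMap {q : ℕ} {f : A → B} (hf : Continuous f) {z : A}
    (h : Function.Surjective (piMap q hf z)) : SurjAt (Fin q → ℝ) f z := by
  intro D cD hD
  obtain ⟨a, ha⟩ := h (Quotient.mk _ (loopOf cD hD))
  induction a using Quotient.inductionOn with
  | h p =>
    obtain ⟨k, ck, k0, k1, kS⟩ := box_of_homotopicRel (Quotient.exact ha.symm)
    refine ⟨fun x => p (toCube x), k, (p.1.continuous.comp continuous_toCube).continuousOn,
      ck.continuousOn, ?_, ?_, ?_, ?_, by simp⟩
    · exact fun x hx => p.2 _ (toCube_mem_boundary hx)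
    · intro x hx
      rw [k0]
      exact congrArg D (fromCube_toCube hx)
    · intro x _; rw [k1]; rfl
    · intro x hx s _
      rw [kS x hx]
      exact congrArg D (fromCube_toCube (uSph_subset hx))

lemma KerAt.of_piMap {q : ℕ} {f : A → B} (hf : Continuous f) {z : A}
    (h : Function.Injective (piMap q hf z)) : KerAt (Fin q → ℝ) f z := by
  intro g H cg gS cH H0 H1 HS
  let p : GenLoop (Fin q) A z := loopOf cg gS
  let p' : GenLoop (Fin q) A z := ⟨ContinuousMap.const _ z, fun _ _ => rfl⟩
  have e : ∀ x ∈ uBall (Fin q → ℝ), p (toCube x) = g x := fun x hx =>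
    congrArg g (fromCube_toCube hx)
  have : (Quotient.mk _ p : HomotopyGroup (Fin q) A z) = Quotient.mk _ p' := by
    refine h (Quotient.sound ?_)
    refine homotopicRel_of_box cH ?_ ?_ ?_
    · intro x hx; rw [H0 x hx, ← e x hx]; rfl
    · intro x hx; rw [H1 x hx]; rfl
    · intro x hx s hs
      exact (HS x hx s hs).trans (congrArg f ((gS x hx).symm.trans (e x (uSph_subset hx)).symm))
  obtain ⟨k, ck, k0, k1, kS⟩ := box_of_homotopicRel (Quotient.exact this)
  refine ⟨k, ck.continuousOn, ?_, ?_, ?_⟩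
  · intro x hx; rw [k0]; exact e x hx
  · intro x _; rw [k1]; rfl
  · intro x hx s _
    exact (kS x hx s).trans ((e x (uSph_subset hx)).trans (gS x hx))

/-- A `k`-connected map has the lifting property for balls of dimension at most `k`. -/
theorem IsConnMap.lifts {k : ℕ} {f : A → B} {hf : Continuous f} (h : IsConnMap k hf) :
    ∀ j ≤ k, Lifts (Fin j → ℝ) f := by
  intro j hj
  cases j with
  | zero =>
    refine lifts_zero fun b => ?_
    obtain ⟨a, ha⟩ := h.1.2 (Quotient.mk _ b)
    induction a using Quotient.inductionOn with
    | h a => exact ⟨a, Quotient.exact ha.symm⟩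
  | succ j =>
    refine LiftsOn.of_prod (Lifts.of_surjAt_kerAt hf fun a => ⟨a, Joined.refl a, ?_, ?_⟩)
    · refine SurjAt.to_prod (SurjAt.of_piMap hf ?_)
      rcases hj.lt_or_eq with hj | rfl
      · exact (h.2.1 _ hj a).2
      · exact h.2.2 a
    · exact KerAt.of_piMap hf (h.2.1 j hj a).1

lemma Lifts.piMap_surjective {q : ℕ} {f : A → B} (hf : Continuous f)
    (h : Lifts (Fin q → ℝ) f) (z : A) : Function.Surjective (piMap q hf z) := by
  intro b
  induction b using Quotient.inductionOn with
  | h p =>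
    have cp := (p.1.continuous.comp (continuous_toCube (q := q)))
    obtain ⟨G, H, cG, cH, Gg, H0, H1, HS, -⟩ := h (fun x => p (toCube x)) (fun _ => z)
      cp.continuousOn (by fun_prop) (fun x hx => (p.2 _ (toCube_mem_boundary hx)).symm) (by simp)
    refine ⟨Quotient.mk _ (loopOf cG Gg), (Quotient.sound ?_).symm⟩
    refine homotopicRel_of_box cH ?_ ?_ ?_
    · intro x hx; rw [H0 x hx]; rfl
    · intro x hx; rw [H1 x hx]
      exact congrArg (f ∘ G) (fromCube_toCube hx).symm
    · intro x hx s hs; rw [HS x hx s hs]; rfl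

lemma isClosed_bdBox {E : Type} [NormedAddCommGroup E] [NormedSpace ℝ E] : IsClosed (bdBox E) :=
  isClosed_bBox.inter (((isClosed_uSph E).preimage continuous_fst).union
    ((isClosed_singleton.preimage continuous_snd).union
      (isClosed_singleton.preimage continuous_snd)))

lemma Lifts.fill {E : Type} [NormedAddCommGroup E] [NormedSpace ℝ E] {f : A → B}
    (h : Lifts (E × ℝ) f) {K : E × ℝ → B} {p p' : E → A} (cK : ContinuousOn K (bBox E))
    (cp : ContinuousOn p (uBall E)) (cp' : ContinuousOn p' (uBall E))
    (hp : ∀ x ∈ uSph E, p x = p' x)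
    (h0 : ∀ x ∈ uBall E, K (x, 0) = f (p x)) (h1 : ∀ x ∈ uBall E, K (x, 1) = f (p' x))
    (hS : ∀ x ∈ uSph E, ∀ s ∈ uI, K (x, s) = f (p x)) :
    ∃ k : E × ℝ → A, ContinuousOn k (bBox E) ∧ (∀ x ∈ uBall E, k (x, 0) = p x) ∧
      (∀ x ∈ uBall E, k (x, 1) = p' x) ∧ ∀ x ∈ uSph E, ∀ s ∈ uI, k (x, s) = p x := by
  obtain ⟨k, -, ck, -, kS, -⟩ := h.box (g := fun x => if x.2 ≤ 1 / 2 then p x.1 else p' x.1) cK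
    (by
      refine continuousOn_ite_le (by fun_prop) (by fun_prop) isClosed_bdBox ?_ ?_ ?_
      · exact cp.comp (by fun_prop) (fun x hx => hx.1.1.1)
      · exact cp'.comp (by fun_prop) (fun x hx => hx.1.1.1)
      · rintro ⟨x, s⟩ hx (rfl : s = 1 / 2)
        rcases hx.2 with h | h | h
        · exact hp x h
        · norm_num at h
        · norm_num at h)
    (by
      rintro ⟨x, s⟩ ⟨⟨hx, hs⟩, h⟩
      rcases h with h | h | h
      · rw [hS x h s hs]
        dsimp only
        rw [← hp x h, ite_self]
      · obtain rfl : s = 0 := h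
        norm_num [h0 x hx]
      · obtain rfl : s = 1 := h
        norm_num [h1 x hx])
  refine ⟨k, ck, ?_, ?_, ?_⟩
  · intro x hx; rw [kS _ ⟨⟨hx, zero_mem_uI⟩, .inr (.inl rfl)⟩]; norm_num
  · intro x hx; rw [kS _ (top_mem_bdBox hx)]; norm_num
  · intro x hx s hs
    rw [kS _ ⟨⟨uSph_subset hx, hs⟩, .inl hx⟩]
    dsimp only
    rw [← hp x hx, ite_self]

lemma Lifts.piMap_injective {q : ℕ} {f : A → B} (hf : Continuous f)
    (h : Lifts (Fin (q + 1) → ℝ) f) (z : A) : Function.Injective (piMap q hf z) := by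
  intro a b hab
  induction a using Quotient.inductionOn with
  | h p =>
  induction b using Quotient.inductionOn with
  | h p' =>
    obtain ⟨K, cK, K0, K1, KS⟩ := box_of_homotopicRel (Quotient.exact hab)
    obtain ⟨k, ck, k0, k1, kS⟩ := Lifts.fill (p := fun x => p (toCube x))
      (p' := fun x => p' (toCube x)) (LiftsOn.to_prod h) cK.continuousOn
      (p.1.continuous.comp continuous_toCube).continuousOn
      (p'.1.continuous.comp continuous_toCube).continuousOn
      (fun x hx => (p.2 _ (toCube_mem_boundary hx)).trans (p'.2 _ (toCube_mem_boundary hx)).symm)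
      (fun x _ => K0 x) (fun x _ => K1 x) (fun x hx s _ => KS x hx s)
    exact Quotient.sound (homotopicRel_of_box ck k0 k1 kS)

lemma Lifts.pi0Map_bijective [Nonempty A] {f : A → B} (hf : Continuous f)
    (h0 : Lifts (Fin 0 → ℝ) f) (h1 : Lifts (Fin 1 → ℝ) f) : Function.Bijective (pi0Map hf) := by
  constructor
  · intro a b hab
    induction a using Quotient.inductionOn with
    | h a =>
    induction b using Quotient.inductionOn with
    | h b =>
      obtain ⟨γ⟩ : Joined (f a) (f b) := Quotient.exact hab
      obtain ⟨k, ck, k0, k1, -⟩ := Lifts.fill (E := Fin 0 → ℝ) (K := fun x => γ.extend x.2)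
        (p := fun _ => a) (p' := fun _ => b) (LiftsOn.to_prod h1) (by fun_prop) (by fun_prop)
        (by fun_prop) (fun x hx => (uSph_fin_zero x hx).elim) (by simp) (by simp)
        (fun x hx => (uSph_fin_zero x hx).elim)
      refine Quotient.sound ?_
      have := joined_of_continuousOn (h := fun s => k (0, s))
        (ck.comp (by fun_prop) (fun s hs => ⟨zero_mem_uBall, hs⟩))
      rwa [k0 _ zero_mem_uBall, k1 _ zero_mem_uBall] at this
  · intro b
    induction b using Quotient.inductionOn with
    | h b =>
      obtain ⟨a, ha⟩ := h0.joined b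
      exact ⟨Quotient.mk _ a, Quotient.sound ha.symm⟩

/-- A map with the lifting property for balls of dimension at most `k + 1` is `k`-connected. -/
theorem isConnMap_of_lifts [Nonempty A] {k : ℕ} {f : A → B} (hf : Continuous f)
    (h : ∀ j ≤ k + 1, Lifts (Fin j → ℝ) f) : IsConnMap k hf :=
  ⟨Lifts.pi0Map_bijective hf (h 0 (by lia)) (h 1 (by lia)),
    fun i hi z => ⟨Lifts.piMap_injective hf (h (i + 1) (by lia)) z,
      Lifts.piMap_surjective hf (h i (by lia)) z⟩,
    fun z => Lifts.piMap_surjective hf (h k (by lia)) z⟩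

/-- A map with all lifting properties is a weak homotopy equivalence. -/
theorem isWeakHomotopyEquiv_of_lifts [Nonempty A] {f : A → B} (hf : Continuous f)
    (h : ∀ j, Lifts (Fin j → ℝ) f) : IsWeakHomotopyEquiv hf :=
  ⟨Lifts.pi0Map_bijective hf (h 0) (h 1),
    fun i z => ⟨Lifts.piMap_injective hf (h (i + 1)) z, Lifts.piMap_surjective hf (h i) z⟩⟩

end Groups

end

section

open Set

section Loops
variable {A B : Type} [TopologicalSpace A] [TopologicalSpace B]

/-- A family of loops, continuous on a set, as a map into the loop space. -/
lemma exists_loopMap {T : Type} [TopologicalSpace T] {T' : Set T} {φ : T × ℝ → A} {a : A}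
    (cφ : ContinuousOn φ (T' ×ˢ uI)) (h0 : ∀ x ∈ T', φ (x, 0) = a) (h1 : ∀ x ∈ T', φ (x, 1) = a) :
    ∃ G : T → OmegaSpace A a, ContinuousOn G T' ∧ ∀ x ∈ T', ∀ s : unitInterval,
      (G x).1 s = φ (x, s) := by
  classical
  have c1 : Continuous (fun p : T' × unitInterval => φ (p.1, p.2)) :=
    cφ.comp_continuous (by fun_prop) (fun p => ⟨p.1.2, p.2.2⟩)
  let c : C(T', C(unitInterval, A)) := ContinuousMap.curry ⟨_, c1⟩
  have hc : ∀ x s, c x s = φ (x, s) := fun _ _ => rfl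
  let G : T → OmegaSpace A a := fun x => if hx : x ∈ T' then
    ⟨c ⟨x, hx⟩, by simp [hc, h0 x hx], by simp [hc, h1 x hx]⟩ else
    ⟨ContinuousMap.const _ a, rfl, rfl⟩
  have hG : ∀ x : T', (G x).1 = c x := fun x => by simp [G]
  refine ⟨G, ?_, ?_⟩
  · rw [continuousOn_iff_continuous_domRestrict]
    refine Topology.IsInducing.subtypeVal.continuous_iff.2 ?_
    refine c.continuous.congr fun x => (hG x).symm
  · intro x hx s
    rw [hG ⟨x, hx⟩, hc]

/-- The map of loop spaces induced by a based map. -/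
def loopMap {f : A → B} (hf : Continuous f) {a : A} {b : B} (hab : f a = b) (γ : OmegaSpace A a) :
    OmegaSpace B b :=
  ⟨(⟨f, hf⟩ : C(A, B)).comp γ.1, by simp [γ.2.1, hab], by simp [γ.2.2, hab]⟩

lemma continuous_loopMap {f : A → B} (hf : Continuous f) {a : A} {b : B} (hab : f a = b) :
    Continuous (loopMap hf hab) :=
  Continuous.subtype_mk ((ContinuousMap.continuous_postcomp _).comp continuous_subtype_val) _

lemma continuousOn_eval_loop {T : Type} [TopologicalSpace T] {T' : Set T} {a : A}
    {g : T → OmegaSpace A a} (cg : ContinuousOn g T') :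
    ContinuousOn (fun p : T × ℝ => (g p.1).1 (projIcc 0 1 zero_le_one p.2)) (T' ×ˢ uI) := by
  have c1 : ContinuousOn (fun p : T × ℝ => (g p.1).1) (T' ×ˢ uI) :=
    continuous_subtype_val.comp_continuousOn (cg.comp (by fun_prop) (fun p hp => hp.1))
  exact ContinuousEval.continuous_eval.comp_continuousOn
    (c1.prodMk ((continuous_projIcc (h := zero_le_one' ℝ)).comp continuous_snd).continuousOn)

/-- Looping shifts the lifting property by one dimension. -/
theorem Lifts.loopMap {E : Type} [NormedAddCommGroup E] [NormedSpace ℝ E] {f : A → B}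
    (hf : Continuous f) {a : A} {b : B} (hab : f a = b) (h : Lifts (E × ℝ) f) :
    Lifts E (loopMap hf hab) := by
  classical
  intro F g cF cg hfg _
  have pI : ∀ {s : ℝ} (hs : s ∈ uI), projIcc 0 1 zero_le_one s = ⟨s, hs⟩ :=
    fun hs => projIcc_of_mem zero_le_one hs
  obtain ⟨G, H, cG, cH, Gg, H0, H1, HS⟩ := h.box
    (F := fun p => (F p.1).1 (projIcc 0 1 zero_le_one p.2))
    (g := fun p => if p.2 = 0 ∨ p.2 = 1 then a else (g p.1).1 (projIcc 0 1 zero_le_one p.2))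
    (continuousOn_eval_loop cF)
    (by
      have e : bdBox E = (uSph E ×ˢ uI) ∪ (uBall E ×ˢ {0, 1}) := by
        ext ⟨x, s⟩
        constructor
        · rintro ⟨⟨hx, hs⟩, h | h | h⟩
          · exact .inl ⟨h, hs⟩
          · exact .inr ⟨hx, .inl h⟩
          · exact .inr ⟨hx, .inr h⟩
        · rintro (⟨h, hs⟩ | ⟨hx, rfl | rfl⟩)
          · exact ⟨⟨uSph_subset h, hs⟩, .inl h⟩
          · exact ⟨⟨hx, zero_mem_uI⟩, .inr (.inl rfl)⟩
          · exact ⟨⟨hx, one_mem_uI⟩, .inr (.inr rfl)⟩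
      rw [e]
      refine ContinuousOn.union_of_isClosed ?_ ?_ ((isClosed_uSph E).prod isClosed_Icc)
        ((isClosed_uBall E).prod (Set.toFinite _).isClosed)
      · refine (continuousOn_eval_loop cg).congr ?_
        rintro ⟨x, s⟩ ⟨hx, hs⟩
        dsimp only
        split_ifs with h
        · rcases h with rfl | rfl
          · simp [(g x).2.1]
          · simp [(g x).2.2]
        · rfl
      · refine (continuousOn_const (c := a)).congr ?_
        rintro ⟨x, s⟩ ⟨hx, hs⟩
        exact if_pos hs)
    (by
      rintro ⟨x, s⟩ ⟨⟨hx, hs⟩, h⟩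
      dsimp only
      split_ifs with h2
      · rcases h2 with rfl | rfl
        · simp [(F x).2.1, hab]
        · simp [(F x).2.2, hab]
      · have hx : x ∈ uSph E := by
          rcases h with h | h | h
          · exact h
          · exact (h2 (.inl h)).elim
          · exact (h2 (.inr h)).elim
        rw [← hfg x hx]
        rfl)
  have b0 : ∀ x ∈ uBall E, (x, (0 : ℝ)) ∈ bdBox E := fun x hx => ⟨⟨hx, zero_mem_uI⟩, .inr (.inl rfl)⟩
  have b1 : ∀ x ∈ uBall E, (x, (1 : ℝ)) ∈ bdBox E := fun x hx => top_mem_bdBox hx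
  obtain ⟨G', cG', hG'⟩ := exists_loopMap (a := a) cG
    (fun x hx => by rw [Gg _ (b0 x hx)]; simp) (fun x hx => by rw [Gg _ (b1 x hx)]; simp)
  obtain ⟨H', cH', hH'⟩ := exists_loopMap (T' := uBall E ×ˢ uI) (a := b)
    (φ := fun p : (E × ℝ) × ℝ => H ((p.1.1, p.2), p.1.2))
    (cH.comp (by fun_prop) (fun p hp => ⟨⟨hp.1.1, hp.2⟩, hp.1.2⟩))
    (fun x hx => by
      rw [HS _ (b0 _ hx.1) _ hx.2]
      simp [(F x.1).2.1])
    (fun x hx => by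
      rw [HS _ (b1 _ hx.1) _ hx.2]
      simp [(F x.1).2.2])
  refine ⟨G', H', cG', cH', ?_, ?_, ?_, ?_, by simp⟩
  · intro x hx
    refine Subtype.ext (ContinuousMap.ext fun s => ?_)
    rw [hG' x (uSph_subset hx), Gg _ ⟨⟨uSph_subset hx, s.2⟩, .inl hx⟩]
    dsimp only
    split_ifs with h
    · rcases h with h | h
      · rw [show s = 0 from Subtype.ext h, (g x).2.1]
      · rw [show s = 1 from Subtype.ext h, (g x).2.2]
    · simp
  · intro x hx
    refine Subtype.ext (ContinuousMap.ext fun s => ?_)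
    rw [hH' _ ⟨hx, zero_mem_uI⟩]
    simp [H0 (x, (s : ℝ)) ⟨hx, s.2⟩]
  · intro x hx
    refine Subtype.ext (ContinuousMap.ext fun s => ?_)
    rw [hH' _ ⟨hx, one_mem_uI⟩]
    dsimp only
    rw [H1 (x, (s : ℝ)) ⟨hx, s.2⟩, ← hG' x hx]
    rfl
  · intro x hx r hr
    refine Subtype.ext (ContinuousMap.ext fun s => ?_)
    rw [hH' _ ⟨uSph_subset hx, hr⟩]
    dsimp only
    rw [HS (x, (s : ℝ)) ⟨⟨uSph_subset hx, s.2⟩, .inl hx⟩ r hr]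
    simp

/-- The levelwise loop space of a convergent `𝓘`-space is convergent. -/
theorem ISpace.Convergent.loopISpace {X : ISpace} (hX : X.Convergent) :
    (loopISpace X).Convergent := by
  intro k
  obtain ⟨N, hN⟩ := hX (k + 2)
  refine ⟨N, fun n m hn f => ?_⟩
  have : Nonempty ((_root_.loopISpace X).obj n) := ⟨(_root_.loopISpace X).pt n⟩
  refine isConnMap_of_lifts _ fun j hj => ?_
  exact Lifts.loopMap (X.map_cont f) (X.map_pt f)
    (LiftsOn.to_prod ((hN n m hn f).lifts (j + 1) (by lia)))

end Loops

end

section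

open Set

section Bisection
variable {ι : Type} [Fintype ι] {Z : Type} [TopologicalSpace Z]

/-- The relative boundary of a box, some of whose edges may be degenerate. -/
def relBd (a b : ι → ℝ) : Set (ι → ℝ) :=
  {x | x ∈ Icc a b ∧ ∃ i, a i < b i ∧ (x i = a i ∨ x i = b i)}

lemma isClosed_relBd (a b : ι → ℝ) : IsClosed (relBd a b) := by
  have : relBd a b = Icc a b ∩ ⋃ i ∈ {i | a i < b i}, ({x | x i = a i} ∪ {x | x i = b i}) := by
    ext x; simp [relBd]
  rw [this]
  refine isClosed_Icc.inter (Set.Finite.isClosed_biUnion (Set.toFinite _) fun i _ => ?_)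
  exact (isClosed_eq (by fun_prop) (by fun_prop)).union (isClosed_eq (by fun_prop) (by fun_prop))

/-- Sections over the relative boundary of a box, subject to a pointwise condition, extend over
the box. -/
def BoxExt (R : (ι → ℝ) → Z → Prop) (a b : ι → ℝ) : Prop :=
  ∀ d : (ι → ℝ) → Z, ContinuousOn d (relBd a b) → (∀ x ∈ relBd a b, R x (d x)) →
    ∃ d' : (ι → ℝ) → Z, ContinuousOn d' (Icc a b) ∧ (∀ x ∈ Icc a b, R x (d' x)) ∧
      ∀ x ∈ relBd a b, d' x = d x

open Function in
/-- Extension over a box from the extension over the pieces of a bisection. -/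
lemma BoxExt.bisect [DecidableEq ι] {R : (ι → ℝ) → Z → Prop} {a b : ι → ℝ} {i : ι} {c : ℝ} (hac : a i < c)
    (hcb : c < b i) (hM : BoxExt R (update a i c) (update b i c))
    (hL : BoxExt R a (update b i c)) (hR : BoxExt R (update a i c) b) : BoxExt R a b := by
  intro d cd hd
  have eL : ∀ x, x ∈ Icc a (update b i c) ↔ x ∈ Icc a b ∧ x i ≤ c := by
    intro x
    simp only [mem_Icc, Pi.le_def]
    refine ⟨fun h => ⟨⟨h.1, fun j => ?_⟩, by simpa using h.2 i⟩, fun h => ⟨h.1.1, fun j => ?_⟩⟩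
    · by_cases hj : j = i
      · subst hj; have := h.2 j; rw [update_self] at this; linarith
      · have := h.2 j; rwa [update_of_ne hj] at this
    · by_cases hj : j = i
      · subst hj; rw [update_self]; exact h.2
      · rw [update_of_ne hj]; exact h.1.2 j
  have eR : ∀ x, x ∈ Icc (update a i c) b ↔ x ∈ Icc a b ∧ c ≤ x i := by
    intro x
    simp only [mem_Icc, Pi.le_def]
    refine ⟨fun h => ⟨⟨fun j => ?_, h.2⟩, by simpa using h.1 i⟩, fun h => ⟨fun j => ?_, h.1.2⟩⟩
    · by_cases hj : j = i
      · subst hj; have := h.1 j; rw [update_self] at this; linarith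
      · have := h.1 j; rwa [update_of_ne hj] at this
    · by_cases hj : j = i
      · subst hj; rw [update_self]; exact h.2
      · rw [update_of_ne hj]; exact h.1.1 j
  have eM : ∀ x, x ∈ Icc (update a i c) (update b i c) ↔ x ∈ Icc a b ∧ x i = c := by
    intro x
    have h1 : x ∈ Icc (update a i c) (update b i c) ↔
        x ∈ Icc a (update b i c) ∧ x ∈ Icc (update a i c) b :=
      ⟨fun h => ⟨⟨(le_update_self_iff.2 hac.le).trans h.1, h.2⟩,
        h.1, h.2.trans (update_le_self_iff.2 hcb.le)⟩, fun h => ⟨h.2.1, h.1.2⟩⟩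
    rw [h1, eL, eR]
    constructor
    · exact fun h => ⟨h.1.1, le_antisymm h.1.2 h.2.2⟩
    · exact fun h => ⟨⟨h.1, h.2.le⟩, h.1, h.2.ge⟩
  have bM : ∀ x, x ∈ relBd (update a i c) (update b i c) ↔ x ∈ relBd a b ∧ x i = c := by
    intro x
    simp only [relBd, mem_ofPred_eq, eM]
    constructor
    · rintro ⟨⟨h1, h2⟩, j, hj, h3⟩
      have hji : j ≠ i := by rintro rfl; simp at hj
      rw [update_of_ne hji, update_of_ne hji] at *
      exact ⟨⟨h1, j, hj, h3⟩, h2⟩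
    · rintro ⟨⟨h1, j, hj, h3⟩, h2⟩
      have hji : j ≠ i := by
        rintro rfl
        rcases h3 with h3 | h3 <;> linarith
      exact ⟨⟨h1, h2⟩, j, by rwa [update_of_ne hji, update_of_ne hji],
        by rwa [update_of_ne hji, update_of_ne hji]⟩
  have bL : ∀ x ∈ relBd a (update b i c), x ∈ relBd a b ∨
      x ∈ Icc (update a i c) (update b i c) := by
    rintro x ⟨h1, j, hj, h3⟩
    rw [eL] at h1
    rw [eM]
    by_cases hji : j = i
    · subst hji
      rw [update_self] at h3
      rcases h3 with h3 | h3
      · exact .inl ⟨h1.1, j, hac.trans hcb, .inl h3⟩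
      · exact .inr ⟨h1.1, h3⟩
    · rw [update_of_ne hji] at *
      exact .inl ⟨h1.1, j, hj, h3⟩
  have bR : ∀ x ∈ relBd (update a i c) b, x ∈ relBd a b ∨
      x ∈ Icc (update a i c) (update b i c) := by
    rintro x ⟨h1, j, hj, h3⟩
    rw [eR] at h1
    rw [eM]
    by_cases hji : j = i
    · subst hji
      rw [update_self] at h3
      rcases h3 with h3 | h3
      · exact .inr ⟨h1.1, h3⟩
      · exact .inl ⟨h1.1, j, hac.trans hcb, .inr h3⟩
    · rw [update_of_ne hji] at *
      exact .inl ⟨h1.1, j, hj, h3⟩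
  have bL' : ∀ x ∈ Icc a b, x i ≤ c → x ∈ relBd a b ∨ x i = c → x ∈ relBd a (update b i c) := by
    intro x hx hc h
    refine ⟨(eL x).2 ⟨hx, hc⟩, ?_⟩
    rcases h with ⟨-, j, hj, h3⟩ | h
    · by_cases hji : j = i
      · subst hji
        refine ⟨j, by simpa using hac, .inl ?_⟩
        rcases h3 with h3 | h3
        · exact h3
        · linarith
      · exact ⟨j, by rwa [update_of_ne hji], by rwa [update_of_ne hji]⟩
    · exact ⟨i, by simpa using hac, .inr (by simpa using h)⟩
  have bR' : ∀ x ∈ Icc a b, c ≤ x i → x ∈ relBd a b ∨ x i = c → x ∈ relBd (update a i c) b := by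
    intro x hx hc h
    refine ⟨(eR x).2 ⟨hx, hc⟩, ?_⟩
    rcases h with ⟨-, j, hj, h3⟩ | h
    · by_cases hji : j = i
      · subst hji
        refine ⟨j, by simpa using hcb, .inr ?_⟩
        rcases h3 with h3 | h3
        · linarith
        · exact h3
      · exact ⟨j, by rwa [update_of_ne hji], by rwa [update_of_ne hji]⟩
    · exact ⟨i, by simpa using hcb, .inl (by simpa using h)⟩
  obtain ⟨d₁, cd₁, R₁, h₁⟩ := hM d (cd.mono fun x hx => ((bM x).1 hx).1)
    (fun x hx => hd x ((bM x).1 hx).1)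
  let e : (ι → ℝ) → Z := fun x => if x i = c then d₁ x else d x
  have ed : ∀ x ∈ relBd a b, e x = d x := by
    intro x hx
    by_cases h : x i = c
    · simp only [e, if_pos h]; exact h₁ x ((bM x).2 ⟨hx, h⟩)
    · simp only [e, if_neg h]
  have ed₁ : ∀ x ∈ Icc (update a i c) (update b i c), e x = d₁ x := by
    intro x hx
    simp only [e, if_pos ((eM x).1 hx).2]
  have ce : ContinuousOn e (relBd a b ∪ Icc (update a i c) (update b i c)) :=
    ContinuousOn.union_of_isClosed (cd.congr ed) (cd₁.congr ed₁) (isClosed_relBd a b) isClosed_Icc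
  have Re : ∀ x ∈ relBd a b ∪ Icc (update a i c) (update b i c), R x (e x) := by
    rintro x (hx | hx)
    · rw [ed x hx]; exact hd x hx
    · rw [ed₁ x hx]; exact R₁ x hx
  obtain ⟨d₂, cd₂, R₂, h₂⟩ := hL e (ce.mono bL) (fun x hx => Re x (bL x hx))
  obtain ⟨d₃, cd₃, R₃, h₃⟩ := hR e (ce.mono bR) (fun x hx => Re x (bR x hx))
  refine ⟨fun x => if x i ≤ c then d₂ x else d₃ x, ?_, ?_, ?_⟩
  · refine continuousOn_ite_le (by fun_prop) (by fun_prop) isClosed_Icc ?_ ?_ ?_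
    · exact cd₂.mono fun x hx => (eL x).2 hx
    · exact cd₃.mono fun x hx => (eR x).2 hx
    · intro x hx h
      rw [h₂ x (bL' x hx h.le (.inr h)), h₃ x (bR' x hx h.ge (.inr h))]
  · intro x hx
    by_cases h : x i ≤ c
    · simp only [h, if_true]; exact R₂ x ((eL x).2 ⟨hx, h⟩)
    · simp only [h, if_false]; exact R₃ x ((eR x).2 ⟨hx, (not_le.1 h).le⟩)
  · intro x hx
    by_cases h : x i ≤ c
    · simp only [h, if_true]
      rw [h₂ x (bL' x hx.1 h (.inl hx)), ed x hx]
    · simp only [h, if_false]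
      rw [h₃ x (bR' x hx.1 (not_le.1 h).le (.inl hx)), ed x hx]

/-- The cuts of a box by the grid of spacing `δ`. -/
def cuts (δ : ℝ) (a b : ι → ℝ) : Set (ι × ℤ) := {p | a p.1 < δ * p.2 ∧ δ * p.2 < b p.1}

lemma finite_cuts {δ : ℝ} (hδ : 0 < δ) (a b : ι → ℝ) : (cuts δ a b).Finite := by
  have : cuts δ a b ⊆ ⋃ i ∈ (univ : Set ι), (Prod.mk i) '' (Icc ⌊a i / δ⌋ ⌈b i / δ⌉) := by
    rintro ⟨i, c⟩ ⟨h1, h2⟩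
    simp only at h1 h2
    simp only [mem_univ, iUnion_true, mem_iUnion]
    refine ⟨i, c, ⟨?_, ?_⟩, rfl⟩
    · have : a i / δ < c := by rw [div_lt_iff₀ hδ]; linarith
      exact Int.floor_le_iff.2 (by linarith)
    · have : (c : ℝ) < b i / δ := by rw [lt_div_iff₀ hδ]; linarith
      exact Int.le_ceil_iff.2 (by linarith)
  exact (Set.Finite.biUnion finite_univ fun i _ => (finite_Icc _ _).image _).subset this

open Function in
/-- Extension over all boxes from the extension over the boxes that the grid does not cut. -/
theorem BoxExt.of_free [DecidableEq ι] {R : (ι → ℝ) → Z → Prop} {δ : ℝ} (hδ : 0 < δ) {A B : ι → ℝ}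
    (h : ∀ a b, a ≤ b → A ≤ a → b ≤ B → cuts δ a b = ∅ → BoxExt R a b) :
    ∀ a b, a ≤ b → A ≤ a → b ≤ B → BoxExt R a b := by
  suffices ∀ n a b, a ≤ b → A ≤ a → b ≤ B → (cuts δ a b).ncard = n → BoxExt R a b from
    fun a b h1 h2 h3 => this _ a b h1 h2 h3 rfl
  intro n
  induction n using Nat.strong_induction_on with
  | _ n ih =>
    intro a b hab hA hB hn
    rcases (cuts δ a b).eq_empty_or_nonempty with he | ⟨⟨i, c⟩, hc1, hc2⟩
    · exact h a b hab hA hB he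
    · simp only at hc1 hc2
      set t := δ * (c : ℝ) with ht
      have u1 : a ≤ update a i t := fun j => by
        by_cases hj : j = i
        · subst hj; rw [update_self]; exact hc1.le
        · rw [update_of_ne hj]
      have u2 : update b i t ≤ b := fun j => by
        by_cases hj : j = i
        · subst hj; rw [update_self]; exact hc2.le
        · rw [update_of_ne hj]
      have u3 : a ≤ update b i t := fun j => by
        by_cases hj : j = i
        · subst hj; rw [update_self]; exact hc1.le
        · rw [update_of_ne hj]; exact hab j
      have u4 : update a i t ≤ b := fun j => by
        by_cases hj : j = i
        · subst hj; rw [update_self]; exact hc2.le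
        · rw [update_of_ne hj]; exact hab j
      have u5 : update a i t ≤ update b i t := fun j => by
        by_cases hj : j = i
        · subst hj; simp
        · rw [update_of_ne hj, update_of_ne hj]; exact hab j
      have key : ∀ a' b', a ≤ a' → b' ≤ b → (i, c) ∉ cuts δ a' b' →
          (cuts δ a' b').ncard < n := by
        intro a' b' h1 h2 h3
        rw [← hn]
        refine ncard_lt_ncard ⟨fun p hp => ⟨(h1 _).trans_lt hp.1, hp.2.trans_le (h2 _)⟩, ?_⟩
          (finite_cuts hδ a b)
        exact fun hh => h3 (hh ⟨hc1, hc2⟩)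
      refine BoxExt.bisect hc1 hc2 ?_ ?_ ?_
      · exact ih _ (key _ _ u1 u2 (by simp [cuts, ← ht])) _ _ u5 (hA.trans u1) (u2.trans hB) rfl
      · exact ih _ (key _ _ le_rfl u2 (by simp [cuts, ← ht])) _ _ u3 hA (u2.trans hB) rfl
      · exact ih _ (key _ _ u1 le_rfl (by simp [cuts, ← ht])) _ _ u4 (hA.trans u1) hB rfl

end Bisection

end

section

open Set

section Local
variable {ι : Type} [Fintype ι] {A B : Type} [TopologicalSpace A]
  [TopologicalSpace B]

/-- A family of paths, continuous on a set, as a map into the path space. -/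
lemma exists_pathMap {T : Type} [TopologicalSpace T] [Nonempty B] {T' : Set T} {φ : T × ℝ → B}
    (cφ : ContinuousOn φ (T' ×ˢ uI)) :
    ∃ G : T → C(unitInterval, B), ContinuousOn G T' ∧ ∀ x ∈ T', ∀ s : unitInterval,
      G x s = φ (x, s) := by
  classical
  have c1 : Continuous (fun p : T' × unitInterval => φ (p.1, p.2)) :=
    cφ.comp_continuous (by fun_prop) (fun p => ⟨p.1.2, p.2.2⟩)
  let c : C(T', C(unitInterval, B)) := ContinuousMap.curry ⟨_, c1⟩
  have hc : ∀ x s, c x s = φ (x, s) := fun _ _ => rfl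
  let G : T → C(unitInterval, B) := fun x => if hx : x ∈ T' then c ⟨x, hx⟩ else
    ContinuousMap.const _ (Classical.arbitrary B)
  have hG : ∀ x : T', G x = c x := fun x => by simp [G]
  refine ⟨G, ?_, ?_⟩
  · rw [continuousOn_iff_continuous_domRestrict]
    exact c.continuous.congr fun x => (hG x).symm
  · intro x hx s
    rw [hG ⟨x, hx⟩, hc]

/-- The pointwise condition on a partial solution of a lifting problem: a lift together with a
path that stays in a prescribed set. -/
def LiftCond (f : A → B) {T : Type} (F : T → B) (U : T → Set B) (x : T)
    (z : A × C(unitInterval, B)) : Prop :=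
  z.2 0 = F x ∧ z.2 1 = f z.1 ∧ ∀ s, z.2 s ∈ U x

/-- Solutions of a lifting problem extend over a box on which the constraint is constant. -/
lemma boxExt_of_liftsOn [Nonempty B] {f : A → B} (hf : Continuous f) {F : (ι → ℝ) → B}
    {U : (ι → ℝ) → Set B} {V : Set B} {a b : ι → ℝ} (hab : a ≤ b)
    (hL : LiftsOn ({i // a i < b i} → ℝ) f V) (cF : ContinuousOn F (Icc a b))
    (hFU : ∀ x ∈ Icc a b, F x ∈ U x) (hUV : ∀ x ∈ Icc a b, U x ⊆ V)
    (hVU : ∀ x ∈ Icc a b, x ∉ relBd a b → V ⊆ U x) : BoxExt (LiftCond f F U) a b := by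
  intro d cd hd
  let e : ({i // a i < b i} → ℝ) → (ι → ℝ) := fun y i =>
    if h : a i < b i then ((1 - y ⟨i, h⟩) * a i + (1 + y ⟨i, h⟩) * b i) / 2 else a i
  let r : (ι → ℝ) → ({i // a i < b i} → ℝ) := fun x i => (2 * x i - a i - b i) / (b i - a i)
  have ce : Continuous e := by
    refine continuous_pi fun i => ?_
    by_cases h : a i < b i
    · simp only [e, h, dite_true]; fun_prop
    · simp only [e, h, dite_false]; fun_prop
  have cr : Continuous r := by
    refine continuous_pi fun i => ?_
    simp only [r]; fun_prop
  have er : ∀ x ∈ Icc a b, e (r x) = x := by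
    intro x hx
    ext i
    by_cases h : a i < b i
    · simp only [e, r, h, dite_true]
      have : b i - a i ≠ 0 := by linarith
      field_simp; ring
    · simp only [e, h, dite_false]
      have h1 := hx.1 i
      have h2 := hx.2 i
      linarith
  have re : ∀ y, r (e y) = y := by
    intro y
    ext ⟨i, h⟩
    simp only [e, r, h, dite_true]
    have : b i - a i ≠ 0 := by linarith
    field_simp; ring
  have eB : ∀ y ∈ uBall ({i // a i < b i} → ℝ), e y ∈ Icc a b := by
    intro y hy
    have hy' : ∀ j, -1 ≤ y j ∧ y j ≤ 1 := fun j => abs_le.1 ((norm_le_pi_norm y j).trans hy)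
    constructor
    · intro i
      by_cases h : a i < b i
      · simp only [e, h, dite_true]
        nlinarith [(hy' ⟨i, h⟩).1]
      · simp only [e, h, dite_false]; exact le_rfl
    · intro i
      by_cases h : a i < b i
      · simp only [e, h, dite_true]
        nlinarith [(hy' ⟨i, h⟩).2]
      · simp only [e, h, dite_false]; exact hab i
  have rB : ∀ x ∈ Icc a b, r x ∈ uBall ({i // a i < b i} → ℝ) := by
    intro x hx
    refine (pi_norm_le_iff_of_nonneg zero_le_one).2 fun i => ?_
    have h : 0 < b i - a i := sub_pos.2 i.2
    have h1 := hx.1 i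
    have h2 := hx.2 i
    rw [Real.norm_eq_abs, abs_le, le_div_iff₀ h, div_le_iff₀ h]
    constructor <;> linarith
  have rS : ∀ x ∈ relBd a b, r x ∈ uSph ({i // a i < b i} → ℝ) := by
    rintro x ⟨hx, i, h, hi⟩
    refine le_antisymm (rB x hx) (le_trans (le_of_eq ?_) (norm_le_pi_norm _ ⟨i, h⟩))
    have h' : b i - a i ≠ 0 := by linarith
    rcases hi with hi | hi
    · have : r x ⟨i, h⟩ = -1 := by
        simp only [r, hi]; field_simp; ring
      simp [this]
    · have : r x ⟨i, h⟩ = 1 := by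
        simp only [r, hi]; field_simp; ring
      simp [this]
  have eS : ∀ y ∈ uSph ({i // a i < b i} → ℝ), e y ∈ relBd a b := by
    intro y hy
    refine ⟨eB y (uSph_subset hy), ?_⟩
    by_contra hcon
    push Not at hcon
    have : ∀ j, ‖y j‖ < 1 := by
      rintro ⟨i, h⟩
      refine lt_of_le_of_ne ((norm_le_pi_norm y _).trans (uSph_subset hy)) fun h3 => ?_
      rw [Real.norm_eq_abs] at h3
      have := hcon i h
      simp only [e, h, dite_true] at this
      rcases (abs_eq zero_le_one).1 h3 with h3 | h3
      · exact this.2 (by rw [h3]; ring)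
      · exact this.1 (by rw [h3]; ring)
    exact (((pi_norm_lt_iff zero_lt_one).2 this).ne hy).elim
  have cg : ContinuousOn (fun y => d (e y)) (uSph ({i // a i < b i} → ℝ)) :=
    cd.comp ce.continuousOn eS
  obtain ⟨G, H, cG, cH, Gg, H0, H1, HS, HV⟩ := hL.extend hf (F := fun y => F (e y))
    (g := fun y => (d (e y)).1)
    (h := fun p => (d (e p.1)).2 (projIcc 0 1 zero_le_one p.2))
    (cF.comp ce.continuousOn eB) (continuous_fst.comp_continuousOn cg)
    (by
      have h1 : ContinuousOn (fun p : ({i // a i < b i} → ℝ) × ℝ => (d (e p.1)).2)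
          (uSph ({i // a i < b i} → ℝ) ×ˢ uI) :=
        continuous_snd.comp_continuousOn (cg.comp (by fun_prop) (fun p hp => hp.1))
      exact ContinuousEval.continuous_eval.comp_continuousOn
        (h1.prodMk ((continuous_projIcc (h := zero_le_one' ℝ)).comp continuous_snd).continuousOn))
    (by
      intro y hy
      simpa using (hd _ (eS y hy)).1)
    (by
      intro y hy
      simpa using (hd _ (eS y hy)).2.1)
    (fun y hy => hUV _ (eB y hy) (hFU _ (eB y hy)))
    (fun y hy s hs => hUV _ (eS y hy).1 ((hd _ (eS y hy)).2.2 _))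
  obtain ⟨P, cP, hP⟩ := exists_pathMap cH
  have dS : ∀ x ∈ relBd a b, (G (r x), P (r x)) = d x := by
    intro x hx
    refine Prod.ext ?_ (ContinuousMap.ext fun s => ?_)
    · simp only
      rw [Gg _ (rS x hx), er x hx.1]
    · simp only
      rw [hP _ (rB x hx.1), HS _ (rS x hx) s s.2]
      simp [er x hx.1]
  refine ⟨fun x => (G (r x), P (r x)), (cG.comp cr.continuousOn rB).prodMk
    (cP.comp cr.continuousOn rB), ?_, dS⟩
  intro x hx
  by_cases hx' : x ∈ relBd a b
  · simp only [dS x hx']; exact hd x hx'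
  · refine ⟨?_, ?_, fun s => hVU x hx hx' ?_⟩
    · simp only
      rw [hP _ (rB x hx)]
      simp [H0 _ (rB x hx), er x hx]
    · simp only
      rw [hP _ (rB x hx)]
      simp [H1 _ (rB x hx)]
    · simp only
      rw [hP _ (rB x hx)]
      exact HV _ (rB x hx) s s.2

lemma uBall_pi : uBall (ι → ℝ) = Icc (-1) 1 := by
  ext x
  simp only [mem_ofPred_eq, mem_Icc, Pi.le_def, pi_norm_le_iff_of_nonneg zero_le_one,
    Real.norm_eq_abs, abs_le, Pi.neg_apply, Pi.one_apply]
  exact forall_and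

lemma uSph_pi : uSph (ι → ℝ) = relBd (-1) 1 := by
  ext x
  constructor
  · intro hx
    have h1 := uSph_subset hx
    refine ⟨(uBall_pi (ι := ι)) ▸ h1, ?_⟩
    by_contra hcon
    push Not at hcon
    have : ∀ j, ‖x j‖ < 1 := by
      intro i
      refine lt_of_le_of_ne ((norm_le_pi_norm x i).trans h1) fun h3 => ?_
      rw [Real.norm_eq_abs] at h3
      have h4 := hcon i (by norm_num)
      rcases (abs_eq zero_le_one).1 h3 with h3 | h3
      · exact h4.2 (by simp [h3])
      · exact h4.1 (by simp [h3])
    exact (((pi_norm_lt_iff zero_lt_one).2 this).ne hx).elim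
  · rintro ⟨hx, i, -, h⟩
    rw [← uBall_pi] at hx
    refine le_antisymm hx (le_trans (le_of_eq ?_) (norm_le_pi_norm _ i))
    rcases h with h | h <;> simp [h]

/-- The lifting property is local on the target, provided that it holds over all intersections
of the members of an open cover. -/
theorem Lifts.of_cover {κ : Type} [Nonempty κ] {f : A → B} (hf : Continuous f) {W : κ → Set B}
    (oW : ∀ n, IsOpen (W n)) (hW : ⋃ n, W n = univ) {q : ℕ}
    (h : ∀ S : Set κ, S.Nonempty → ∀ j ≤ q, LiftsOn (Fin j → ℝ) f (⋂ n ∈ S, W n)) :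
    Lifts (Fin q → ℝ) f := by
  intro F g cF cg hfg _
  have : Nonempty B := ⟨F 0⟩
  choose V oV hV using fun n => (continuousOn_iff'.1 cF) (W n) (oW n)
  have hK : IsCompact (uBall (Fin q → ℝ)) := (uBall_pi (ι := Fin q)).symm ▸ isCompact_Icc
  obtain ⟨ε, hε, hb⟩ := lebesgue_number_lemma_of_metric hK oV (fun x hx => by
    obtain ⟨n, hn⟩ := mem_iUnion.1 (hW.ge (mem_univ (F x)))
    exact mem_iUnion.2 ⟨n, ((hV n).le ⟨hn, hx⟩).1⟩)
  obtain ⟨δ, hδ, hδε⟩ : ∃ δ, 0 < δ ∧ δ < ε := ⟨ε / 2, by linarith, by linarith⟩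
  let cell : (Fin q → ℤ) → Set (Fin q → ℝ) := fun w =>
    Icc (fun i => δ * w i) (fun i => δ * (w i + 1))
  have hn : ∀ w, ∃ n, ∀ x ∈ cell w, x ∈ uBall (Fin q → ℝ) → F x ∈ W n := by
    intro w
    by_cases hw : (cell w ∩ uBall (Fin q → ℝ)).Nonempty
    · obtain ⟨y, hy, hyB⟩ := hw
      obtain ⟨n, hn⟩ := hb y hyB
      refine ⟨n, fun x hx hxB => ?_⟩
      refine ((hV n).ge ⟨hn ?_, hxB⟩).1
      rw [Metric.mem_ball, dist_pi_lt_iff hε]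
      intro i
      rw [Real.dist_eq, abs_lt]
      have a1 := hx.1 i
      have a2 := hx.2 i
      have a3 := hy.1 i
      have a4 := hy.2 i
      simp only [mul_add, mul_one] at a1 a2 a3 a4
      constructor <;> linarith
    · exact ⟨Classical.arbitrary κ, fun x hx hxB => (hw ⟨x, hx, hxB⟩).elim⟩
  choose nn hnn using hn
  let U : (Fin q → ℝ) → Set B := fun x => {y | ∀ w, x ∈ cell w → y ∈ W (nn w)}
  have hFU : ∀ x ∈ uBall (Fin q → ℝ), F x ∈ U x := fun x hx w hw => hnn w x hw hx
  have key : ∀ a b : Fin q → ℝ, a ≤ b → -1 ≤ a → b ≤ 1 → BoxExt (LiftCond f F U) a b := by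
    refine BoxExt.of_free hδ fun a b hab ha hb hcut => ?_
    have hcut' : ∀ i (c : ℤ), a i < δ * c → δ * c < b i → False := fun i c h1 h2 => by
      have : (i, c) ∈ cuts δ a b := ⟨h1, h2⟩
      rw [hcut] at this
      exact this
    have hsub : Icc a b ⊆ uBall (Fin q → ℝ) := fun x hx => (uBall_pi (ι := Fin q)).symm ▸ ⟨ha.trans hx.1, hx.2.trans hb⟩
    let S : Set κ := nn '' {w | Icc a b ⊆ cell w}
    have hS : S.Nonempty := by
      refine ⟨_, fun i => ⌊a i / δ⌋, ?_, rfl⟩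
      intro x hx
      have e : ∀ i, δ * (⌊a i / δ⌋ : ℝ) ≤ a i := fun i => by
        have := Int.floor_le (a i / δ)
        rw [le_div_iff₀ hδ] at this
        linarith
      have e' : ∀ i, a i < δ * ((⌊a i / δ⌋ : ℝ) + 1) := fun i => by
        have := Int.lt_floor_add_one (a i / δ)
        rw [div_lt_iff₀ hδ] at this
        linarith
      refine ⟨fun i => (e i).trans (hx.1 i), fun i => ?_⟩
      by_contra hcon
      exact hcut' i (⌊a i / δ⌋ + 1) (by push_cast; exact e' i)
        (by push_cast; exact (not_le.1 hcon).trans_le (hx.2 i))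
    have hcard : Fintype.card {i // a i < b i} ≤ q := by
      simpa using Fintype.card_subtype_le (fun i => a i < b i)
    refine boxExt_of_liftsOn hf (V := ⋂ n ∈ S, W n) hab
      ((h S hS _ hcard).reindex (Fintype.equivFin _).symm) (cF.mono hsub)
      (fun x hx => hFU x (hsub hx)) ?_ ?_
    · intro x hx y hy
      simp only [mem_iInter]
      rintro _ ⟨w, hw, rfl⟩
      exact hy w (hw hx)
    · intro x hx hx' y hy w hw
      simp only [mem_iInter] at hy
      refine hy _ ⟨w, ?_, rfl⟩
      intro z hz
      have hlt : ∀ i, (a i < x i ∧ x i < b i) ∨ (a i = x i ∧ b i = x i) := by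
        intro i
        rcases (hab i).lt_or_eq with h1 | h1
        · left
          constructor
          · exact lt_of_le_of_ne (hx.1 i) fun h2 => hx' ⟨hx, i, h1, .inl h2.symm⟩
          · exact lt_of_le_of_ne (hx.2 i) fun h2 => hx' ⟨hx, i, h1, .inr h2⟩
        · right
          have h2 := hx.1 i
          have h3 := hx.2 i
          constructor <;> linarith
      constructor
      · intro i
        have w1 : δ * (w i : ℝ) ≤ x i := hw.1 i
        refine le_trans ?_ (hz.1 i)
        show δ * (w i : ℝ) ≤ a i
        rcases hlt i with h1 | h1
        · by_contra hcon
          exact hcut' i (w i) (not_le.1 hcon) (w1.trans_lt h1.2)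
        · rw [h1.1]; exact w1
      · intro i
        have w1 : x i ≤ δ * ((w i : ℝ) + 1) := hw.2 i
        refine le_trans (hz.2 i) ?_
        show b i ≤ δ * ((w i : ℝ) + 1)
        rcases hlt i with h1 | h1
        · by_contra hcon
          exact hcut' i (w i + 1) (by push_cast; exact h1.1.trans_le w1)
            (by push_cast; exact not_le.1 hcon)
        · rw [h1.2]; exact w1
  rw [uSph_pi] at cg hfg
  obtain ⟨d, cd, Rd, hd⟩ := key (-1) 1 (fun i => by norm_num) le_rfl le_rfl
    (fun x => (g x, ContinuousMap.const _ (F x)))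
    (cg.prodMk (ContinuousMap.continuous_const'.comp_continuousOn
      (cF.mono fun x hx => uSph_subset (by rw [uSph_pi]; exact hx))))
    (fun x hx => ⟨rfl, (hfg x hx).symm, fun s =>
      hFU x (uSph_subset (by rw [uSph_pi]; exact hx))⟩)
  rw [← uBall_pi] at cd Rd
  rw [← uSph_pi] at hd
  refine ⟨fun x => (d x).1, fun p => (d p.1).2 (projIcc 0 1 zero_le_one p.2),
    continuous_fst.comp_continuousOn cd, ?_, ?_, ?_, ?_, ?_, by simp⟩
  · have h1 : ContinuousOn (fun p : (Fin q → ℝ) × ℝ => (d p.1).2)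
        (uBall (Fin q → ℝ) ×ˢ uI) :=
      continuous_snd.comp_continuousOn (cd.comp (by fun_prop) (fun p hp => hp.1))
    exact ContinuousEval.continuous_eval.comp_continuousOn
      (h1.prodMk ((continuous_projIcc (h := zero_le_one' ℝ)).comp continuous_snd).continuousOn)
  · intro x hx; simp [hd x hx]
  · intro x hx; simpa using (Rd x hx).1
  · intro x hx; simpa using (Rd x hx).2.1
  · intro x hx s hs; simp [hd x hx]

end Local

end

section

open Set

/-- A functor from a preorder to the category `𝓘`. -/
structure IFun (R : Type) [Preorder R] where
  o : R → ℕ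
  hom : ∀ i j : R, i ≤ j → (Fin (o i) ↪ Fin (o j))
  hom_refl : ∀ i, hom i i le_rfl = Function.Embedding.refl _
  hom_trans : ∀ (i j l : R) (hij : i ≤ j) (hjl : j ≤ l),
      hom i l (hij.trans hjl) = (hom i j hij).trans (hom j l hjl)

namespace IFun

variable {R R' : Type} [PartialOrder R] [PartialOrder R'] {k l : ℕ}

/-- The chain obtained by evaluating a functor on a monotone sequence. -/
abbrev chain (Γ : IFun R) (m : Fin (k + 1) →o R) : IChain k where
  o := fun i => Γ.o (m i)
  hom := fun i j h => Γ.hom (m i) (m j) (m.monotone h)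
  hom_refl := fun i => Γ.hom_refl (m i)
  hom_trans := fun i j l hij hjl => Γ.hom_trans (m i) (m j) (m l) (m.monotone hij) (m.monotone hjl)

/-- Restriction of a functor along a monotone map. -/
abbrev pull (Γ : IFun R) (φ : R' →o R) : IFun R' where
  o := fun i => Γ.o (φ i)
  hom := fun i j h => Γ.hom (φ i) (φ j) (φ.monotone h)
  hom_refl := fun i => Γ.hom_refl (φ i)
  hom_trans := fun i j l hij hjl => Γ.hom_trans (φ i) (φ j) (φ l) (φ.monotone hij) (φ.monotone hjl)

/-- The functor underlying a chain. -/
abbrev ofChain (c : IChain k) : IFun (Fin (k + 1)) := ⟨c.o, c.hom, c.hom_refl, c.hom_trans⟩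

/-- The point of the homotopy colimit determined by a monotone sequence, an element at the bottom
and barycentric coordinates. -/
def ipt (Γ : IFun R) (A : ISpace) {r : R} (h : ∀ r', r ≤ r') (y : A.obj (Γ.o r))
    (m : Fin (k + 1) →o R) (t : Simplex k) : Hocolim A :=
  incl A (Γ.chain m) (A.map (Γ.hom r (m 0) (h _)) y) t

lemma _root_.incl_glue (A : ISpace) (α : Fin (k + 1) →o Fin (l + 1)) (c : IChain l)
    (p : A.obj (c.o 0)) (t : Simplex k) : incl A c p (simplexMap α t) =
      incl A (c.restrict α) (A.map (c.hom 0 (α 0) (Fin.zero_le _)) p) t :=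
  Quot.sound (HocolimRel.glue α c p t)

lemma ipt_comp (Γ : IFun R) (A : ISpace) {r : R} (h : ∀ r', r ≤ r') (y : A.obj (Γ.o r))
    (m : Fin (l + 1) →o R) (α : Fin (k + 1) →o Fin (l + 1)) (t : Simplex k) :
    Γ.ipt A h y (m.comp α) t = Γ.ipt A h y m (simplexMap α t) := by
  refine Eq.trans ?_ (incl_glue A α (Γ.chain m) _ t).symm
  have : A.map (Γ.hom r (m (α 0)) (h _)) y = A.map ((Γ.chain m).hom 0 (α 0) (Fin.zero_le _))
      (A.map (Γ.hom r (m 0) (h _)) y) := by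
    rw [Γ.hom_trans r (m 0) (m (α 0)) (h _) (m.monotone (Fin.zero_le _))]
    exact A.map_comp _ _ _
  exact congrArg (fun z => incl A ((Γ.chain m).restrict α) z t) this

open Classical in
/-- Push-forward of a finite weight. -/
def push {P Q : Type} [Fintype P] (f : P → Q) (u : P → ℝ) (q : Q) : ℝ :=
  ∑ p, if f p = q then u p else 0

lemma push_simplexMap (α : Fin (k + 1) →o Fin (l + 1)) (t : Simplex k) :
    (simplexMap α t).1 = push α t.1 := by
  ext j
  simp only [simplexMap, push, Finset.sum_filter]
  congr! 

lemma push_push {P Q S : Type} [Fintype P] [Fintype Q] (f : P → Q) (g : Q → S) (u : P → ℝ) :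
    push g (push f u) = push (g ∘ f) u := by
  classical
  ext s
  simp only [push, Function.comp]
  rw [show (∑ q, if g q = s then ∑ p, if f p = q then u p else 0 else 0) =
    ∑ q, ∑ p, if g q = s then if f p = q then u p else 0 else 0 from
      Finset.sum_congr rfl fun q _ => by split_ifs <;> simp]
  rw [Finset.sum_comm]
  refine Finset.sum_congr rfl fun p _ => ?_
  rw [Finset.sum_eq_single (f p)]
  · simp
  · intro b _ hb; simp [hb.symm]
  · simp

lemma push_injective_apply {P Q : Type} [Fintype P] {f : P → Q} (hf : Function.Injective f)
    (u : P → ℝ) (p : P) : push f u (f p) = u p := by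
  classical
  simp only [push, hf.eq_iff]
  simp

lemma exists_pos (t : Simplex k) : ∃ i, 0 < t.1 i := by
  by_contra! h
  have := t.2.2
  rw [Finset.sum_eq_zero fun i _ => le_antisymm (h i) (t.2.1 i)] at this
  exact zero_ne_one this

lemma sum_push {P Q : Type} [Fintype P] [Fintype Q] (f : P → Q) (u : P → ℝ) :
    ∑ q, push f u q = ∑ p, u p := by
  classical
  simp only [push]
  rw [Finset.sum_comm]
  simp

lemma push_pos {f : Fin (k + 1) → R} {t : Simplex k} {i : Fin (k + 1)} (h : 0 < t.1 i) :
    0 < push f t.1 (f i) := by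
  refine Finset.sum_pos' (fun p _ => ?_) ⟨i, Finset.mem_univ _, by simpa using h⟩
  split_ifs
  exacts [t.2.1 p, le_rfl]

/-- Enumerating the support of barycentric coordinates. -/
lemma exists_support (t : Simplex k) : ∃ (j : ℕ) (α : Fin (j + 1) →o Fin (k + 1)) (u : Simplex j),
    simplexMap α u = t ∧ ∀ i, 0 < u.1 i := by
  classical
  set S : Finset (Fin (k + 1)) := Finset.univ.filter fun i => 0 < t.1 i with hS
  obtain ⟨i₀, hi₀⟩ := exists_pos t
  have hSc : S.card = (S.card - 1) + 1 := (Nat.sub_add_cancel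
    (Finset.card_pos.2 ⟨i₀, by simpa [hS] using hi₀⟩)).symm
  let e := S.orderEmbOfFin hSc
  have he : ∀ i, 0 < t.1 (e i) := fun i => by
    exact (Finset.mem_filter.1 (S.orderEmbOfFin_mem hSc i)).2
  have hr : ∀ p, p ∈ S ↔ ∃ i, e i = p := fun p => by
    have := S.range_orderEmbOfFin hSc
    rw [← Finset.mem_coe, ← this]; rfl
  have hsum : ∀ f : Fin (k + 1) → ℝ, ∑ i, f (e i) = ∑ p ∈ S, f p := fun f => by
    symm
    refine Finset.sum_nbij' (i := fun p => if h : ∃ i, e i = p then h.choose else 0) (j := e) ?_ ?_ ?_ ?_ ?_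
    · simp
    · intro i _; exact (hr _).2 ⟨i, rfl⟩
    · intro p hp
      have h := (hr p).1 hp
      simp only [h, dif_pos]
      exact h.choose_spec
    · intro i _
      have h : ∃ i', e i' = e i := ⟨i, rfl⟩
      simp only [h, dif_pos]
      exact e.injective h.choose_spec
    · intro p hp
      have h := (hr p).1 hp
      simp only [h, dif_pos]
      rw [h.choose_spec]
  have h0 : ∀ p, p ∉ S → t.1 p = 0 := fun p hp => by
    refine le_antisymm ?_ (t.2.1 p)
    simpa [hS] using hp
  refine ⟨S.card - 1, ⟨e, e.monotone⟩, ⟨fun i => t.1 (e i), fun i => t.2.1 _, ?_⟩, ?_, he⟩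
  · exact (hsum t.1).trans
      ((Finset.sum_subset (Finset.subset_univ _) fun p _ => h0 p).trans t.2.2)
  · refine Subtype.ext ?_
    refine (push_simplexMap _ _).trans ?_
    ext p
    by_cases hp : p ∈ S
    · obtain ⟨i, rfl⟩ := (hr p).1 hp
      exact push_injective_apply e.injective _ _
    · rw [h0 p hp]
      refine Finset.sum_eq_zero fun i _ => if_neg ?_
      rintro rfl
      exact hp ((hr _).2 ⟨i, rfl⟩)

/-- Collapsing repeated vertices. -/
lemma exists_inj (m : Fin (k + 1) →o R) : ∃ (j : ℕ) (α : Fin (k + 1) →o Fin (j + 1))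
    (e : Fin (j + 1) →o R), m = e.comp α ∧ Function.Injective e ∧ Function.Surjective α := by
  classical
  set S : Finset R := Finset.univ.image m with hS
  have hm : ∀ i, m i ∈ S := fun i => Finset.mem_image_of_mem _ (Finset.mem_univ i)
  have hlin : ∀ a ∈ S, ∀ b ∈ S, a ≤ b ∨ b ≤ a := by
    intro a ha b hb
    obtain ⟨i, -, rfl⟩ := Finset.mem_image.1 ha
    obtain ⟨j, -, rfl⟩ := Finset.mem_image.1 hb
    exact (le_total i j).imp (fun h => m.monotone h) (fun h => m.monotone h)
  let _ : LinearOrder S :=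
    { (inferInstance : PartialOrder S) with
      le_total := fun a b => hlin a a.2 b b.2
      toDecidableLE := Classical.decRel _ }
  have hc : Fintype.card S = (S.card - 1) + 1 := by
    rw [Fintype.card_coe]
    exact (Nat.sub_add_cancel (Finset.card_pos.2 ⟨_, hm 0⟩)).symm
  let E : Fin (S.card - 1 + 1) ≃o S := Fintype.orderIsoFinOfCardEq S hc
  refine ⟨S.card - 1, ⟨fun i => E.symm ⟨m i, hm i⟩, fun i j h => E.symm.monotone (m.monotone h)⟩,
    ⟨fun i => (E i : R), fun i j h => E.monotone h⟩, ?_, ?_, ?_⟩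
  · ext i
    exact (congrArg Subtype.val (E.apply_symm_apply ⟨m i, hm i⟩)).symm
  · intro i j h; exact E.injective (Subtype.ext h)
  · intro i
    obtain ⟨i', -, h⟩ := Finset.mem_image.1 (E i).2
    refine ⟨i', ?_⟩
    change E.symm ⟨m i', _⟩ = i
    rw [E.symm_apply_eq]
    exact Subtype.ext h

lemma simplexMap_pos {α : Fin (k + 1) →o Fin (l + 1)} (hα : Function.Surjective α) {t : Simplex k}
    (ht : ∀ i, 0 < t.1 i) (j) : 0 < (simplexMap α t).1 j := by
  obtain ⟨i, rfl⟩ := hα j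
  rw [push_simplexMap]
  exact push_pos (ht i)

/-- The point only depends on the weight pushed forward to the index poset. -/
lemma ipt_eq_of_push_eq (Γ : IFun R) (A : ISpace) {r : R} (h : ∀ r', r ≤ r') (y : A.obj (Γ.o r))
    (m : Fin (k + 1) →o R) (t : Simplex k) (m' : Fin (l + 1) →o R) (t' : Simplex l)
    (hp : push m t.1 = push m' t'.1) : Γ.ipt A h y m t = Γ.ipt A h y m' t' := by
  have red : ∀ {k : ℕ} (m : Fin (k + 1) →o R) (t : Simplex k), ∃ (j : ℕ) (e : Fin (j + 1) →o R)
      (u : Simplex j), Γ.ipt A h y m t = Γ.ipt A h y e u ∧ push m t.1 = push e u.1 ∧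
        Function.Injective e ∧ ∀ i, 0 < u.1 i := by
    intro k m t
    obtain ⟨j, α, u, rfl, hu⟩ := exists_support t
    obtain ⟨j', β, e, he, ie, sβ⟩ := exists_inj (m.comp α)
    refine ⟨j', e, simplexMap β u, ?_, ?_, ie, simplexMap_pos sβ hu⟩
    · rw [← ipt_comp, ← ipt_comp, he]
    · rw [push_simplexMap, push_simplexMap, push_push, push_push]
      congr 1
      exact congrArg DFunLike.coe he
  obtain ⟨j, e, u, h1, h2, ie, hu⟩ := red m t
  obtain ⟨j', e', u', h1', h2', ie', hu'⟩ := red m' t'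
  rw [h1, h1']
  rw [h2, h2'] at hp
  clear h1 h1' h2 h2'
  have hr : ∀ {a b : ℕ} (e : Fin (a + 1) →o R) (e' : Fin (b + 1) →o R) (u : Simplex a)
      (u' : Simplex b), push e u.1 = push e' u'.1 → (∀ i, 0 < u.1 i) → ∀ i, ∃ i', e' i' = e i := by
    intro a b e e' u u' hp hu i
    have h3 := push_pos (f := e) (hu i)
    rw [hp] at h3
    by_contra! hcon
    exact h3.ne' (Finset.sum_eq_zero fun p _ => if_neg (hcon p))
  have smono : ∀ {a : ℕ} (e : Fin (a + 1) →o R), Function.Injective e → StrictMono e :=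
    fun e ie => e.monotone.strictMono_of_injective ie
  choose p hpp using hr e e' u u' hp hu
  choose q hq using hr e' e u' u hp.symm hu'
  have lemono : ∀ {a : ℕ} (e : Fin (a + 1) →o R), Function.Injective e → ∀ i j, e i ≤ e j ↔ i ≤ j :=
    fun e ie i j => (smono e ie).le_iff_le
  let E : Fin (j + 1) ≃o Fin (j' + 1) :=
    { toFun := p
      invFun := q
      left_inv := fun i => ie ((hq _).trans (hpp _))
      right_inv := fun i => ie' ((hpp _).trans (hq _))
      map_rel_iff' := fun {a b} => by
        change p a ≤ p b ↔ a ≤ b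
        rw [← lemono e' ie', hpp, hpp, lemono e ie] }
  have hjj : j + 1 = j' + 1 := Fin.equiv_iff_eq.1 ⟨E.toEquiv⟩
  obtain rfl : j = j' := by omega
  have hE : E = OrderIso.refl _ := Subsingleton.elim _ _
  have hpid : ∀ i, p i = i := fun i => DFunLike.congr_fun hE i
  have hee : e = e' := by
    ext i
    rw [← hpp i, hpid]
  subst hee
  congr 1
  refine Subtype.ext (funext fun i => ?_)
  rw [← push_injective_apply ie u.1, hp, push_injective_apply ie]

variable [Fintype R'] [Fintype R]

/-- Weights on a finite poset: points of the geometric realization of its order complex. -/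
structure IsWeight (w : R → ℝ) : Prop where
  nonneg : ∀ r, 0 ≤ w r
  sum_eq : ∑ r, w r = 1
  total : ∀ r r', w r ≠ 0 → w r' ≠ 0 → r ≤ r' ∨ r' ≤ r

lemma exists_chain (S : Finset R) (hS : S.Nonempty) (hlin : ∀ a ∈ S, ∀ b ∈ S, a ≤ b ∨ b ≤ a) :
    ∃ (k : ℕ) (m : Fin (k + 1) →o R), Function.Injective m ∧ ∀ r, r ∈ S ↔ ∃ i, m i = r := by
  classical
  let _ : LinearOrder S :=
    { (inferInstance : PartialOrder S) with
      le_total := fun a b => hlin a a.2 b b.2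
      toDecidableLE := Classical.decRel _ }
  have hc : Fintype.card S = (S.card - 1) + 1 := by
    rw [Fintype.card_coe]
    exact (Nat.sub_add_cancel (Finset.card_pos.2 hS)).symm
  let E : Fin (S.card - 1 + 1) ≃o S := Fintype.orderIsoFinOfCardEq S hc
  refine ⟨S.card - 1, ⟨fun i => (E i : R), fun i j h => E.monotone h⟩,
    fun i j h => E.injective (Subtype.ext h), fun r => ⟨fun hr => ⟨E.symm ⟨r, hr⟩,
      congrArg Subtype.val (E.apply_symm_apply ⟨r, hr⟩)⟩, ?_⟩⟩
  rintro ⟨i, rfl⟩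
  exact (E i).2

lemma sum_comp_of_injective {m : Fin (k + 1) → R} (hm : Function.Injective m) {w : R → ℝ}
    (h : ∀ r, w r ≠ 0 → ∃ i, m i = r) : ∑ i, w (m i) = ∑ r, w r := by
  refine Fintype.sum_of_injective m hm _ _ (fun r hr => ?_) fun _ => rfl
  by_contra hcon
  exact hr (h r hcon)

/-- A weight supported in a chain, as barycentric coordinates. -/
def restrictWeight (m : Fin (k + 1) →o R) (hm : Function.Injective m) (w : R → ℝ)
    (hw : IsWeight w) (h : ∀ r, w r ≠ 0 → ∃ i, m i = r) : Simplex k :=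
  ⟨fun i => w (m i), fun i => hw.nonneg _, (sum_comp_of_injective hm h).trans hw.sum_eq⟩

lemma push_restrictWeight (m : Fin (k + 1) →o R) (hm : Function.Injective m) (w : R → ℝ)
    (hw : IsWeight w) (h : ∀ r, w r ≠ 0 → ∃ i, m i = r) :
    push m (restrictWeight m hm w hw h).1 = w := by
  ext r
  by_cases hr : ∃ i, m i = r
  · obtain ⟨i, rfl⟩ := hr
    exact push_injective_apply hm _ _
  · rw [show w r = 0 by by_contra hcon; exact hr (h r hcon)]
    refine Finset.sum_eq_zero fun i _ => if_neg fun h => hr ⟨i, h⟩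

open Classical in
/-- The point of the homotopy colimit determined by an element at the bottom of a finite diagram
and a weight. -/
def gpt (Γ : IFun R) (A : ISpace) {r : R} (h : ∀ r', r ≤ r') (y : A.obj (Γ.o r)) (w : R → ℝ) :
    Hocolim A :=
  if hw : ∃ (k : ℕ) (m : Fin (k + 1) →o R) (t : Simplex k), push m t.1 = w then
    Γ.ipt A h y hw.choose_spec.choose hw.choose_spec.choose_spec.choose else basept A

lemma gpt_push (Γ : IFun R) (A : ISpace) {r : R} (h : ∀ r', r ≤ r') (y : A.obj (Γ.o r))
    (m : Fin (k + 1) →o R) (t : Simplex k) : Γ.gpt A h y (push m t.1) = Γ.ipt A h y m t := by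
  have hw : ∃ (k' : ℕ) (m' : Fin (k' + 1) →o R) (t' : Simplex k'), push m' t'.1 = push m t.1 :=
    ⟨k, m, t, rfl⟩
  rw [gpt, dif_pos hw]
  exact ipt_eq_of_push_eq Γ A h y _ _ _ _ hw.choose_spec.choose_spec.choose_spec

lemma exists_push {w : R → ℝ} (hw : IsWeight w) :
    ∃ (k : ℕ) (m : Fin (k + 1) →o R) (t : Simplex k), push m t.1 = w := by
  classical
  obtain ⟨k, m, im, hm⟩ := exists_chain (Finset.univ.filter fun r => w r ≠ 0) (by
    by_contra! hcon
    have := hw.sum_eq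
    rw [Finset.sum_eq_zero] at this
    · exact zero_ne_one this
    · intro r _
      by_contra h
      have : r ∈ (Finset.univ.filter fun r => w r ≠ 0) := by simpa using h
      simp [hcon] at this) (by
    intro a ha b hb
    exact hw.total a b (by simpa using ha) (by simpa using hb))
  exact ⟨k, m, _, push_restrictWeight m im w hw fun r hr => (hm r).1 (by simpa using hr)⟩

lemma gpt_pull (Γ : IFun R) (A : ISpace) {r : R} (h : ∀ r', r ≤ r') (y : A.obj (Γ.o r))
    (φ : R' →o R) {s : R'} (hs : ∀ s', s ≤ s') {w : R' → ℝ} (hw : IsWeight w) :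
    (Γ.pull φ).gpt A hs (A.map (Γ.hom r (φ s) (h _)) y) w = Γ.gpt A h y (push φ w) := by
  obtain ⟨k, m, t, rfl⟩ := exists_push hw
  have : push φ (push m t.1) = push (φ.comp m) t.1 := push_push _ _ _
  rw [this, gpt_push, gpt_push]
  have : A.map ((Γ.pull φ).hom s (m 0) (hs _)) (A.map (Γ.hom r (φ s) (h _)) y) =
      A.map (Γ.hom r (φ (m 0)) (h _)) y := by
    rw [Γ.hom_trans r (φ s) (φ (m 0)) (h _) (φ.monotone (hs _))]
    exact (A.map_comp _ _ _).symm
  exact congrArg (fun z => incl A ((Γ.pull φ).chain m) z t) this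

lemma gpt_ofChain (A : ISpace) (c : IChain k) (y : A.obj (c.o 0)) (t : Simplex k) :
    (ofChain c).gpt A (fun r => Fin.zero_le r) y t.1 = incl A c y t := by
  have h1 : push (OrderHom.id : Fin (k + 1) →o Fin (k + 1)) t.1 = t.1 := by
    ext i; exact push_injective_apply (f := (OrderHom.id : Fin (k + 1) →o Fin (k + 1))) (fun _ _ h => h) _ i
  refine (congrArg ((ofChain c).gpt A (fun r => Fin.zero_le r) y) h1.symm).trans ?_
  refine (gpt_push _ _ _ _ _ _).trans ?_
  have : A.map ((ofChain c).hom 0 0 le_rfl) y = y := by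
    rw [(ofChain c).hom_refl]; exact A.map_id _ _
  exact congrArg (fun z => incl A c z t) this

lemma continuous_incl (A : ISpace) (c : IChain k) :
    Continuous fun p : A.obj (c.o 0) × Simplex k => incl A c p.1 p.2 := by
  refine continuous_quot_mk.comp ?_
  exact continuous_sigmaMk.comp (continuous_sigmaMk (σ := fun c : IChain k => A.obj (c.o 0) × Simplex k))

lemma gpt_continuousOn (Γ : IFun R) (A : ISpace) {r : R} (h : ∀ r', r ≤ r') {Z : Type}
    [TopologicalSpace Z] {S : Set Z} {y : Z → A.obj (Γ.o r)} {w : Z → R → ℝ}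
    (hy : ContinuousOn y S) (hw : ContinuousOn w S) (hW : ∀ z ∈ S, IsWeight (w z)) :
    ContinuousOn (fun z => Γ.gpt A h (y z) (w z)) S := by
  classical
  rw [continuousOn_iff_continuous_domRestrict] at *
  let T := {C : Finset R // C.Nonempty ∧ ∀ a ∈ C, ∀ b ∈ C, a ≤ b ∨ b ≤ a}
  let K : T → Set S := fun C => {z | ∀ r, r ∉ C.1 → w z r = 0}
  have hK : ∀ C, IsClosed (K C) := fun C => by
    have : K C = ⋂ r ∈ {r | r ∉ C.1}, {z : S | w z r = 0} := by ext; simp [K]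
    rw [this]
    exact isClosed_biInter fun r _ => isClosed_eq ((continuous_apply r).comp hw) continuous_const
  have hcov : ∀ z : S, ∃ C, z ∈ K C := fun z => by
    refine ⟨⟨Finset.univ.filter fun r => w z.1 r ≠ 0, ?_, ?_⟩, ?_⟩
    · by_contra! hcon
      have := (hW z z.2).sum_eq
      rw [Finset.sum_eq_zero] at this
      · exact zero_ne_one this
      · intro r _
        by_contra h
        have : r ∈ (Finset.univ.filter fun r => w z r ≠ 0) := by simpa using h
        simp [hcon] at this
    · intro a ha b hb
      exact (hW z z.2).total a b (by simpa using ha) (by simpa using hb)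
    · intro r hr; simpa using hr
  refine (locallyFinite_of_finite K).continuous (iUnion_eq_univ_iff.2 hcov) hK fun C => ?_
  obtain ⟨k, m, im, hm⟩ := exists_chain C.1 C.2.1 C.2.2
  rw [continuousOn_iff_continuous_domRestrict]
  have hsup : ∀ z : K C, ∀ r, w z r ≠ 0 → ∃ i, m i = r := fun z r hr =>
    (hm r).1 (by by_contra hcon; exact hr (z.2 r hcon))
  have : (K C).domRestrict (S.domRestrict fun z : Z => Γ.gpt A h (y z) (w z)) = fun z : K C =>
      incl A (Γ.chain m) (A.map (Γ.hom r (m 0) (h _)) (y z))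
        (restrictWeight m im (w z) (hW z z.1.2) (hsup z)) := by
    ext z
    exact (congrArg (Γ.gpt A h (y z)) (push_restrictWeight m im _ (hW z z.1.2) (hsup z)).symm).trans
      (gpt_push _ _ _ _ _ _)
  rw [this]
  refine (continuous_incl A (Γ.chain m)).comp (Continuous.prodMk ?_ ?_)
  · exact (A.map_cont _).comp (hy.comp continuous_subtype_val)
  · refine Continuous.subtype_mk (continuous_pi fun i => ?_) _
    exact (continuous_apply (m i)).comp (hw.comp continuous_subtype_val)

end IFun

end

section

open Set
open IFun Topology

variable {A B : ISpace}

lemma hocolim_ind {P : Hocolim A → Prop} (h : ∀ (k : ℕ) (c : IChain k) p t, P (incl A c p t)) :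
    ∀ z, P z := by
  rintro ⟨⟨k, c, p, t⟩⟩
  exact h k c p t

/-- Maps out of the homotopy colimit. -/
def hlift {Z : Type} (f : ∀ (k : ℕ) (c : IChain k), A.obj (c.o 0) → Simplex k → Z)
    (hf : ∀ (k l : ℕ) (α : Fin (k + 1) →o Fin (l + 1)) (c : IChain l) (p : A.obj (c.o 0))
      (t : Simplex k), f l c p (simplexMap α t) =
        f k (c.restrict α) (A.map (c.hom 0 (α 0) (Fin.zero_le _)) p) t) : Hocolim A → Z :=
  Quot.lift (fun x => f x.1 x.2.1 x.2.2.1 x.2.2.2) (by rintro _ _ ⟨α, c, p, t⟩; exact hf _ _ α c p t)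

lemma isOpenEmbedding_inclPre {k : ℕ} (c : IChain k) :
    IsOpenEmbedding fun p : A.obj (c.o 0) × Simplex k => (⟨k, c, p⟩ : HocolimPre A) :=
  (IsOpenEmbedding.sigmaMk (σ := fun k : ℕ => Σ c : IChain k, A.obj (c.o 0) × Simplex k)).comp
    (IsOpenEmbedding.sigmaMk (σ := fun c : IChain k => A.obj (c.o 0) × Simplex k))

lemma continuousOn_hocolim {K Z : Type} [TopologicalSpace K] [LocallyCompactSpace K]
    [TopologicalSpace Z] {V : Set (Hocolim A)} (hV : IsOpen V) {f : Hocolim A × K → Z}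
    (h : ∀ (k : ℕ) (c : IChain k), ContinuousOn
      (fun p : (A.obj (c.o 0) × Simplex k) × K => f (incl A c p.1.1 p.1.2, p.2))
      {p | incl A c p.1.1 p.1.2 ∈ V}) : ContinuousOn f (V ×ˢ univ) := by
  let q : HocolimPre A → Hocolim A := Quot.mk _
  have hq : IsQuotientMap q := isQuotientMap_quot_mk
  have h1 : ContinuousOn (fun p : HocolimPre A × K => f (q p.1, p.2)) ((q ⁻¹' V) ×ˢ univ) := by
    rintro ⟨⟨k, c, p⟩, κ⟩ ⟨hp, -⟩
    have he := (isOpenEmbedding_inclPre (A := A) c).prodMap (IsOpenEmbedding.id (X := K))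
    refine ContinuousAt.continuousWithinAt ?_
    have h2 := (h k c).continuousAt (x := (p, κ)) (IsOpen.mem_nhds ?_ hp)
    · exact (he.continuousAt_iff (g := fun p : HocolimPre A × K => f (q p.1, p.2))).1 h2
    · exact hV.preimage ((continuous_incl A c).comp continuous_fst)
  have h2 := hq.restrictPreimage_isOpen hV
  have h3 : Continuous (fun p : V × K => f (p.1, p.2)) := by
    refine h2.continuous_lift_prod_left ?_
    exact h1.comp_continuous (f := fun p : (q ⁻¹' V) × K => ((p.1 : HocolimPre A), p.2))
      (by fun_prop) fun p => ⟨p.1.2, mem_univ _⟩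
  rw [continuousOn_iff_continuous_domRestrict]
  exact h3.comp (f := fun p : (V ×ˢ (univ : Set K) : Set _) => ((⟨p.1.1, p.2.1⟩ : V), p.1.2))
    (by fun_prop)

lemma continuous_hocolim_prod {K Z : Type} [TopologicalSpace K] [LocallyCompactSpace K]
    [TopologicalSpace Z] {f : Hocolim A × K → Z}
    (h : ∀ (k : ℕ) (c : IChain k), Continuous
      (fun p : (A.obj (c.o 0) × Simplex k) × K => f (incl A c p.1.1 p.1.2, p.2))) :
    Continuous f := by
  have := continuousOn_hocolim (V := univ) isOpen_univ fun k c => (h k c).continuousOn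
  rwa [univ_prod_univ, continuousOn_univ] at this

lemma continuous_hocolim {Z : Type} [TopologicalSpace Z] {f : Hocolim A → Z}
    (h : ∀ (k : ℕ) (c : IChain k), Continuous
      (fun p : A.obj (c.o 0) × Simplex k => f (incl A c p.1 p.2))) : Continuous f := by
  have : Continuous fun p : Hocolim A × Unit => f p.1 :=
    continuous_hocolim_prod fun k c => (h k c).comp continuous_fst
  exact this.comp (f := fun z => (z, ())) (by fun_prop)

lemma continuous_simplex_apply {k : ℕ} (i : Fin (k + 1)) : Continuous fun t : Simplex k => t.1 i :=
  (continuous_apply i).comp continuous_subtype_val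

lemma continuous_push {P Q Z : Type} [Fintype P] [TopologicalSpace Z] (f : P → Q) {u : Z → P → ℝ}
    (hu : ∀ p, Continuous fun z => u z p) (q : Q) : Continuous fun z => push f (u z) q := by
  classical
  refine continuous_finsetSum _ fun p _ => ?_
  split_ifs
  exacts [hu p, continuous_const]

/-- A natural continuous transformation of `𝓘`-spaces (not necessarily based). -/
structure IHom (A B : ISpace) where
  app : ∀ n, A.obj n → B.obj n
  cont : ∀ n, Continuous (app n)
  nat : ∀ {n m : ℕ} (f : Fin n ↪ Fin m) (x : A.obj n), app m (A.map f x) = B.map f (app n x)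

/-- The map of homotopy colimits induced by a natural transformation. -/
def IHom.hmap (f : IHom A B) : Hocolim A → Hocolim B :=
  hlift (fun _ c p t => incl B c (f.app _ p) t) fun k l α c p t =>
    (incl_glue _ _ _ _ _).trans
      (congrArg (fun z => incl B (c.restrict α) z t) (f.nat (c.hom 0 (α 0) (Fin.zero_le _)) p).symm)

lemma IHom.continuous_hmap (f : IHom A B) : Continuous f.hmap :=
  continuous_hocolim fun _ c => (continuous_incl B c).comp
    (f := fun p : A.obj (c.o 0) × _ => (f.app _ p.1, p.2))
    (((f.cont _).comp continuous_fst).prodMk continuous_snd)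

/-- The inclusion of the vertices at level `n`. -/
def uMap (A : ISpace) (n : ℕ) (x : A.obj n) : Hocolim A := incl A (constChain n) x vertex

lemma continuous_uMap (A : ISpace) (n : ℕ) : Continuous (uMap A n) :=
  (continuous_incl A (constChain n)).comp (by fun_prop : Continuous fun x : A.obj n => (x, vertex))

end

section

open Set
open IFun Topology

/-! ### Increments of a function along barycentric coordinates -/

section Inc
variable {k l : ℕ}

/-- The increment of `κ` over the interval of positions of the `i`-th vertex. -/
def inc (κ : ℝ → ℝ) (t : Fin (k + 1) → ℝ) (i : Fin (k + 1)) : ℝ :=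
  κ (∑ j ∈ Finset.Iic i, t j) - κ (∑ j ∈ Finset.Iio i, t j)

lemma sum_Iic_eq (t : Fin (k + 1) → ℝ) (i : Fin (k + 1)) :
    ∑ j ∈ Finset.Iic i, t j = ∑ j ∈ Finset.Iio i, t j + t i := by
  rw [← Finset.Iio_insert, Finset.sum_insert (by simp), add_comm]

lemma sum_inc_of_isLowerSet (κ : ℝ → ℝ) (t : Fin (k + 1) → ℝ) (D : Finset (Fin (k + 1)))
    (hD : ∀ i ∈ D, ∀ j ≤ i, j ∈ D) : ∑ i ∈ D, inc κ t i = κ (∑ i ∈ D, t i) - κ 0 := by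
  induction D using Finset.induction_on_max with
  | empty => simp
  | insert a D ha ih =>
    have hn : a ∉ D := fun h => lt_irrefl _ (ha a h)
    have hDe : D = Finset.Iio a := by
      ext j
      rw [Finset.mem_Iio]
      refine ⟨ha j, fun h => ?_⟩
      exact (Finset.mem_insert.1 (hD a (Finset.mem_insert_self _ _) j h.le)).resolve_left h.ne
    rw [Finset.sum_insert hn, Finset.sum_insert hn, ih, inc, sum_Iic_eq, ← hDe, add_comm (t a)]
    · ring
    · intro i hi j hj
      rw [hDe, Finset.mem_Iio] at hi ⊢
      exact hj.trans_lt hi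

lemma sum_inc (κ : ℝ → ℝ) (t : Fin (k + 1) → ℝ) : ∑ i, inc κ t i = κ (∑ i, t i) - κ 0 :=
  sum_inc_of_isLowerSet κ t _ (by simp)

lemma sum_push_finset {P Q : Type} [Fintype P] [DecidableEq Q] (f : P → Q) (u : P → ℝ)
    (D : Finset Q) : ∑ q ∈ D, push f u q = ∑ p ∈ Finset.univ.filter (fun p => f p ∈ D), u p := by
  classical
  rw [Finset.sum_filter]
  refine Finset.sum_comm.trans (Finset.sum_congr rfl fun p _ => ?_)
  convert Finset.sum_ite_eq D (f p) fun _ => u p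

lemma inc_push (κ : ℝ → ℝ) (α : Fin (k + 1) →o Fin (l + 1)) (t : Fin (k + 1) → ℝ) :
    inc κ (push α t) = push α (inc κ t) := by
  ext j
  have h1 := sum_Iic_eq (push α (inc κ t)) j
  rw [sum_push_finset, sum_push_finset, sum_inc_of_isLowerSet, sum_inc_of_isLowerSet,
    ← sum_push_finset, ← sum_push_finset] at h1
  · rw [inc]; linarith
  · intro i hi j' hj
    simp only [Finset.mem_filter, Finset.mem_univ, true_and, Finset.mem_Iio] at hi ⊢
    exact (α.monotone hj).trans_lt hi
  · intro i hi j' hj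
    simp only [Finset.mem_filter, Finset.mem_univ, true_and, Finset.mem_Iic] at hi ⊢
    exact (α.monotone hj).trans hi

lemma inc_nonneg {κ : ℝ → ℝ} (hκ : Monotone κ) {t : Fin (k + 1) → ℝ} (ht : ∀ i, 0 ≤ t i)
    (i : Fin (k + 1)) : 0 ≤ inc κ t i := by
  rw [inc, sum_Iic_eq, sub_nonneg]
  exact hκ (le_add_of_nonneg_right (ht i))

lemma sum_Iic_le_sum_Iio {t : Fin (k + 1) → ℝ} (ht : ∀ i, 0 ≤ t i) {i j : Fin (k + 1)}
    (h : i < j) : ∑ a ∈ Finset.Iic i, t a ≤ ∑ a ∈ Finset.Iio j, t a :=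
  Finset.sum_le_sum_of_subset_of_nonneg
    (fun a ha => Finset.mem_Iio.2 ((Finset.mem_Iic.1 ha).trans_lt h)) fun a _ _ => ht a

end Inc

/-! ### Endofunctors of the category `𝓘` -/

/-- An endofunctor of the category `𝓘`. -/
structure IEndo where
  o : ℕ → ℕ
  map : ∀ {n m : ℕ}, (Fin n ↪ Fin m) → (Fin (o n) ↪ Fin (o m))
  map_refl : ∀ n, map (Function.Embedding.refl (Fin n)) = Function.Embedding.refl _
  map_trans : ∀ {n m l : ℕ} (f : Fin n ↪ Fin m) (g : Fin m ↪ Fin l),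
    map (f.trans g) = (map f).trans (map g)

/-- A natural transformation of endofunctors. -/
structure INat (Φ Ψ : IEndo) where
  app : ∀ n, Fin (Φ.o n) ↪ Fin (Ψ.o n)
  nat : ∀ {n m : ℕ} (f : Fin n ↪ Fin m), (Φ.map f).trans (app m) = (app n).trans (Ψ.map f)

namespace IEndo

/-- The identity functor. -/
abbrev one : IEndo := ⟨fun n => n, fun f => f, fun _ => rfl, fun _ _ => rfl⟩

/-- The constant functor at the initial object. -/
abbrev zero : IEndo := ⟨fun _ => 0, fun _ => Function.Embedding.refl _, fun _ => rfl, fun _ _ => rfl⟩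

/-- Post-composition of a chain with an endofunctor. -/
abbrev chain (Φ : IEndo) {k : ℕ} (c : IChain k) : IChain k where
  o := fun i => Φ.o (c.o i)
  hom := fun i j h => Φ.map (c.hom i j h)
  hom_refl := fun i => by rw [c.hom_refl, Φ.map_refl]
  hom_trans := fun i j l hij hjl => by rw [c.hom_trans i j l hij hjl, Φ.map_trans]

/-- Precomposition of an `𝓘`-space with an endofunctor. -/
abbrev precomp (Φ : IEndo) (A : ISpace) : ISpace where
  obj := fun n => A.obj (Φ.o n)
  topo := fun n => A.topo (Φ.o n)
  pt := fun n => A.pt (Φ.o n)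
  map := fun f => A.map (Φ.map f)
  map_cont := fun f => A.map_cont (Φ.map f)
  map_id := fun n x => by rw [Φ.map_refl]; exact A.map_id _ x
  map_comp := fun f g x => by rw [Φ.map_trans]; exact A.map_comp _ _ x
  map_pt := fun f => A.map_pt (Φ.map f)

/-- The map of homotopy colimits induced by an endofunctor. -/
def pmap (Φ : IEndo) (A : ISpace) : Hocolim (Φ.precomp A) → Hocolim A :=
  hlift (fun _ c p t => incl A (Φ.chain c) p t) fun _ _ α c p t => incl_glue A α (Φ.chain c) p t

lemma continuous_pmap (Φ : IEndo) (A : ISpace) : Continuous (Φ.pmap A) :=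
  continuous_hocolim fun _ c => continuous_incl A (Φ.chain c)

end IEndo

namespace INat

variable {Φ Ψ : IEndo} (ν : INat Φ Ψ) (A : ISpace) {k l : ℕ}

/-- The transformation of `𝓘`-spaces induced by a natural transformation. -/
abbrev hom : IHom (Φ.precomp A) (Ψ.precomp A) where
  app := fun n => A.map (ν.app n)
  cont := fun n => A.map_cont _
  nat := fun f x => by
    change A.map _ (A.map _ x) = A.map _ (A.map _ x)
    rw [← A.map_comp, ← A.map_comp, ν.nat]

/-- The diagram on a prism given by a natural transformation. -/
abbrev prism (c : IChain k) : IFun (Fin (k + 1) × Bool) where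
  o := fun p => match p.2 with
    | false => Φ.o (c.o p.1)
    | true => Ψ.o (c.o p.1)
  hom := fun p q h => match p.2, q.2, h.2 with
    | false, false, _ => Φ.map (c.hom p.1 q.1 h.1)
    | false, true, _ => (Φ.map (c.hom p.1 q.1 h.1)).trans (ν.app _)
    | true, true, _ => Ψ.map (c.hom p.1 q.1 h.1)
  hom_refl := by
    rintro ⟨i, _ | _⟩
    · exact (congrArg Φ.map (c.hom_refl i)).trans (Φ.map_refl _)
    · exact (congrArg Ψ.map (c.hom_refl i)).trans (Ψ.map_refl _)
  hom_trans := by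
    rintro ⟨i, _ | _⟩ ⟨j, _ | _⟩ ⟨a, _ | _⟩ ⟨h1, h2⟩ ⟨h3, h4⟩
    · exact (congrArg Φ.map (c.hom_trans _ _ _ h1 h3)).trans (Φ.map_trans _ _)
    · exact congrArg (fun f => f.trans (ν.app _))
        ((congrArg Φ.map (c.hom_trans _ _ _ h1 h3)).trans (Φ.map_trans _ _))
    · exact absurd (h4 rfl) (by simp)
    · refine (congrArg (fun f => f.trans (ν.app _))
        ((congrArg Φ.map (c.hom_trans _ _ _ h1 h3)).trans (Φ.map_trans _ _))).trans ?_
      exact congrArg ((Φ.map (c.hom i j h1)).trans) (ν.nat (c.hom j a h3))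
    · exact absurd (h2 rfl) (by simp)
    · exact absurd (h2 rfl) (by simp)
    · exact absurd (h4 rfl) (by simp)
    · exact (congrArg Ψ.map (c.hom_trans _ _ _ h1 h3)).trans (Ψ.map_trans _ _)

/-- The weight on the prism that cuts the simplex at a position. -/
def cut (r : ℝ) (t : Fin (k + 1) → ℝ) (p : Fin (k + 1) × Bool) : ℝ :=
  match p.2 with
  | false => inc (fun x => min x r) t p.1
  | true => t p.1 - inc (fun x => min x r) t p.1

lemma isWeight_cut (r : ℝ) (t : Simplex k) : IsWeight (cut r t.1) where
  nonneg := by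
    rintro ⟨i, _ | _⟩
    · exact inc_nonneg (fun _ _ h => min_le_min_right _ h) t.2.1 i
    · change 0 ≤ t.1 i - inc _ _ _
      rw [inc, sum_Iic_eq]
      have := t.2.1 i
      rcases min_cases (∑ j ∈ Finset.Iio i, t.1 j + t.1 i) r with h | h <;>
      rcases min_cases (∑ j ∈ Finset.Iio i, t.1 j) r with h' | h' <;> linarith
  sum_eq := by
    rw [Fintype.sum_prod_type]
    refine Eq.trans (Finset.sum_congr rfl fun i _ => ?_) t.2.2
    rw [Fintype.sum_bool]
    exact sub_add_cancel _ _
  total := by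
    have key : ∀ i j, cut r t.1 (i, true) ≠ 0 → cut r t.1 (j, false) ≠ 0 → j ≤ i := by
      intro i j hi hj
      by_contra! hij
      have h1 := sum_Iic_le_sum_Iio t.2.1 hij
      have h2 := sum_Iic_eq t.1 i
      have h3 := sum_Iic_eq t.1 j
      have h4 := t.2.1 i
      have h5 := t.2.1 j
      simp only [cut, inc] at hi hj
      rcases le_total (∑ a ∈ Finset.Iio j, t.1 a) r with h | h
      · apply hi
        rw [min_eq_left (h1.trans h), min_eq_left (by linarith)]
        linarith
      · apply hj
        rw [min_eq_right h, min_eq_right (by linarith)]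
        ring
    rintro ⟨i, _ | _⟩ ⟨j, _ | _⟩ hi hj
    · exact (le_total i j).imp (fun h => ⟨h, le_rfl⟩) (fun h => ⟨h, le_rfl⟩)
    · exact Or.inl ⟨key _ _ hj hi, by simp⟩
    · exact Or.inr ⟨key _ _ hi hj, by simp⟩
    · exact (le_total i j).imp (fun h => ⟨h, le_rfl⟩) (fun h => ⟨h, le_rfl⟩)

/-- The map of prisms induced by a monotone map. -/
abbrev prismMap (α : Fin (k + 1) →o Fin (l + 1)) : Fin (k + 1) × Bool →o Fin (l + 1) × Bool :=
  ⟨fun p => (α p.1, p.2), fun _ _ h => ⟨α.monotone h.1, h.2⟩⟩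

lemma push_cut (α : Fin (k + 1) →o Fin (l + 1)) (r : ℝ) (t : Fin (k + 1) → ℝ) :
    push (prismMap α) (cut r t) = cut r (push α t) := by
  classical
  have h : ∀ j b, push (prismMap α) (cut r t) (j, b) = push α (fun i => cut r t (i, b)) j := by
    intro j b
    simp only [push, Fintype.sum_prod_type, Fintype.sum_bool]
    refine Finset.sum_congr rfl fun i _ => ?_
    have e : ∀ b, prismMap α (i, b) = (α i, b) := fun _ => rfl
    cases b <;> simp [e]
  ext ⟨j, _ | _⟩
  · rw [h]
    exact congrFun (inc_push (fun x => min x r) α t).symm j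
  · rw [h]
    simp only [cut]
    rw [inc_push]
    simp only [push, ← Finset.sum_sub_distrib]
    exact Finset.sum_congr rfl fun i _ => by split_ifs <;> simp

/-- The homotopy of maps of homotopy colimits given by a natural transformation. -/
def htpy (z : Hocolim (Φ.precomp A)) (r : ℝ) : Hocolim A :=
  hlift (fun _ c p t => (ν.prism c).gpt A (r := (0, false))
    (fun q => ⟨Fin.zero_le _, by simp⟩) p (cut r t.1)) (fun k l α c p t => by
      have h := gpt_pull (ν.prism c) A (r := (0, false)) (fun q => ⟨Fin.zero_le _, by simp⟩) p
        (prismMap α) (s := (0, false)) (fun q => ⟨Fin.zero_le _, by simp⟩) (isWeight_cut r t)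
      rw [push_cut] at h
      rw [push_simplexMap]
      exact h.symm) z

lemma htpy_incl (c : IChain k) (p : (Φ.precomp A).obj (c.o 0)) (t : Simplex k) (r : ℝ) :
    ν.htpy A (incl _ c p t) r = (ν.prism c).gpt A (r := (0, false))
      (fun q => ⟨Fin.zero_le _, by simp⟩) p (cut r t.1) := rfl

lemma continuous_cut (q : Fin (k + 1) × Bool) :
    Continuous fun p : Simplex k × ℝ => cut p.2 p.1.1 q := by
  have hc : ∀ i, Continuous fun p : Simplex k × ℝ => p.1.1 i :=
    fun i => (continuous_simplex_apply i).comp continuous_fst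
  have hi : ∀ i, Continuous fun p : Simplex k × ℝ => inc (fun x => min x p.2) p.1.1 i := fun i =>
    ((continuous_finsetSum _ fun j _ => hc j).min continuous_snd).sub
      ((continuous_finsetSum _ fun j _ => hc j).min continuous_snd)
  obtain ⟨i, _ | _⟩ := q
  · exact hi i
  · exact (hc i).sub (hi i)

lemma continuous_htpy : Continuous fun p : Hocolim (Φ.precomp A) × ℝ => ν.htpy A p.1 p.2 := by
  refine continuous_hocolim_prod fun k c => ?_
  have hle : ∀ q : Fin (k + 1) × Bool, ((0, false) : Fin (k + 1) × Bool) ≤ q :=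
    fun q => ⟨Fin.zero_le _, by simp⟩
  let y : ((Φ.precomp A).obj (c.o 0) × Simplex k) × ℝ → (Φ.precomp A).obj (c.o 0) := fun p => p.1.1
  let w : ((Φ.precomp A).obj (c.o 0) × Simplex k) × ℝ → Fin (k + 1) × Bool → ℝ :=
    fun p => cut p.2 p.1.2.1
  have hy : Continuous y := continuous_fst.comp continuous_fst
  have hw : Continuous w := continuous_pi fun q =>
    (continuous_cut q).comp (by fun_prop :
      Continuous fun p : ((Φ.precomp A).obj (c.o 0) × Simplex k) × ℝ => (p.1.2, p.2))
  have h := gpt_continuousOn (ν.prism c) A hle (y := y) (w := w) hy.continuousOn hw.continuousOn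
    (S := univ) fun p _ => isWeight_cut _ p.1.2
  exact continuousOn_univ.1 h

lemma push_inr (t : Fin (k + 1) → ℝ) (i : Fin (k + 1)) (b b' : Bool) :
    push (fun i => (i, b)) t (i, b') = if b = b' then t i else 0 := by
  classical
  split_ifs with h
  · subst h
    exact push_injective_apply (fun _ _ h => (Prod.ext_iff.1 h).1) t i
  · refine Finset.sum_eq_zero fun p _ => if_neg fun h' => h (Prod.ext_iff.1 h').2

lemma htpy_one (z : Hocolim (Φ.precomp A)) : ν.htpy A z 1 = Φ.pmap A z := by
  revert z
  refine hocolim_ind fun k c p t => ?_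
  let m : Fin (k + 1) →o Fin (k + 1) × Bool := ⟨fun i => (i, false), fun _ _ h => ⟨h, le_rfl⟩⟩
  have hle : ∀ D : Finset (Fin (k + 1)), ∑ i ∈ D, t.1 i ≤ 1 := fun D =>
    (Finset.sum_le_univ_sum_of_nonneg t.2.1).trans_eq t.2.2
  have h : cut 1 t.1 = push m t.1 := by
    ext ⟨i, _ | _⟩
    · refine Eq.trans ?_ (push_inr t.1 i false false).symm
      simp only [cut, inc, min_eq_left (hle _)]; simp [sum_Iic_eq]
    · refine Eq.trans ?_ (push_inr t.1 i false true).symm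
      simp only [cut, inc, min_eq_left (hle _)]; simp [sum_Iic_eq]
  rw [htpy_incl, h, gpt_push]
  have : A.map ((ν.prism c).hom (0, false) (0, false) le_rfl) p = p := by
    rw [(ν.prism c).hom_refl]; exact A.map_id _ _
  exact congrArg (fun z => incl A (Φ.chain c) z t) this

lemma htpy_zero (z : Hocolim (Φ.precomp A)) : ν.htpy A z 0 = Ψ.pmap A ((ν.hom A).hmap z) := by
  revert z
  refine hocolim_ind fun k c p t => ?_
  let m : Fin (k + 1) →o Fin (k + 1) × Bool := ⟨fun i => (i, true), fun _ _ h => ⟨h, le_rfl⟩⟩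
  have hle : ∀ D : Finset (Fin (k + 1)), 0 ≤ ∑ i ∈ D, t.1 i := fun D =>
    Finset.sum_nonneg fun i _ => t.2.1 i
  have h : cut 0 t.1 = push m t.1 := by
    ext ⟨i, _ | _⟩
    · refine Eq.trans ?_ (push_inr t.1 i true false).symm
      simp only [cut, inc, min_eq_right (hle _)]; simp
    · refine Eq.trans ?_ (push_inr t.1 i true true).symm
      simp only [cut, inc, min_eq_right (hle _)]; simp
  rw [htpy_incl, h, gpt_push]
  have : (Φ.map (c.hom 0 0 le_rfl)).trans (ν.app _) = ν.app (c.o 0) := by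
    rw [c.hom_refl, Φ.map_refl]; rfl
  exact congrArg (fun f => incl A (Ψ.chain c) (A.map f p) t) this

end INat

end

section

open Set
open IFun Topology

lemma push_mul {P Q : Type} [Fintype P] (f : P → Q) (u : P → ℝ) (g : Q → ℝ) :
    push f (fun p => u p * g (f p)) = fun q => push f u q * g q := by
  classical
  ext q
  simp only [push, Finset.sum_mul]
  refine Finset.sum_congr rfl fun p _ => ?_
  split_ifs with h
  · rw [h]
  · simp

lemma exists_ne_zero_of_push {P Q : Type} [Fintype P] {f : P → Q} {u : P → ℝ} {q : Q}
    (h : push f u q ≠ 0) : ∃ p, f p = q := by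
  classical
  obtain ⟨p, -, hp⟩ := Finset.exists_ne_zero_of_sum_ne_zero h
  exact ⟨p, by by_contra hcon; exact hp (if_neg hcon)⟩

lemma push_nonneg {P Q : Type} [Fintype P] (f : P → Q) {u : P → ℝ} (hu : ∀ p, 0 ≤ u p) (q : Q) :
    0 ≤ push f u q :=
  Finset.sum_nonneg fun p _ => by split_ifs; exacts [hu p, le_rfl]

namespace IChain

variable {k l : ℕ}

open Classical in
/-- The normalized part of the barycentric coordinates at level `n`. -/
def levelPart (n : ℕ) (c : IChain k) (t : Fin (k + 1) → ℝ) (i : Fin (k + 1)) : ℝ :=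
  t i * if c.o i = n then (push c.o t n)⁻¹ else 0

lemma push_levelPart (n : ℕ) (c : IChain l) (α : Fin (k + 1) →o Fin (l + 1))
    (t : Fin (k + 1) → ℝ) :
    push α ((c.restrict α).levelPart n t) = c.levelPart n (push α t) := by
  classical
  have h : push (c.restrict α).o t n = push c.o (push α t) n := by rw [push_push]; rfl
  refine (congrArg (push α) ?_).trans
    (push_mul α t fun j => if c.o j = n then (push c.o (push α t) n)⁻¹ else 0)
  ext i
  rw [levelPart, h]
  rfl

lemma levelPart_nonneg (n : ℕ) (c : IChain k) {t : Fin (k + 1) → ℝ} (ht : ∀ i, 0 ≤ t i)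
    (i : Fin (k + 1)) : 0 ≤ c.levelPart n t i := by
  refine mul_nonneg (ht i) ?_
  split_ifs
  exacts [inv_nonneg.2 (push_nonneg _ ht _), le_rfl]

lemma sum_levelPart (n : ℕ) (c : IChain k) {t : Fin (k + 1) → ℝ} (h : push c.o t n ≠ 0) :
    ∑ i, c.levelPart n t i = 1 := by
  classical
  refine Eq.trans ?_ ((Finset.sum_mul Finset.univ (fun i => if c.o i = n then t i else 0)
    (push c.o t n)⁻¹).symm.trans ?_)
  · refine Finset.sum_congr rfl fun i _ => ?_
    rw [levelPart]
    split_ifs <;> simp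
  · refine Eq.trans ?_ (mul_inv_cancel₀ h)
    congr 1
    rw [push]
    congr!

lemma levelPart_eq_zero (n : ℕ) (c : IChain k) {t : Fin (k + 1) → ℝ} (h : push c.o t n = 0) :
    c.levelPart n t = 0 := by
  ext i
  simp [levelPart, h]

/-- Two vertices have the same level and the connecting bijection is the identity. -/
def SameFrame (c : IChain k) (i j : Fin (k + 1)) : Prop :=
  c.o i = c.o j ∧ ∀ (x : Fin (c.o i)) (y : Fin (c.o j)), x.val = y.val →
    c.hom i (Fin.last k) (Fin.le_last _) x = c.hom j (Fin.last k) (Fin.le_last _) y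

lemma SameFrame.refl (c : IChain k) (i) : c.SameFrame i i :=
  ⟨rfl, fun _ _ h => congrArg _ (Fin.ext h)⟩

lemma SameFrame.symm {c : IChain k} {i j} (h : c.SameFrame i j) : c.SameFrame j i :=
  ⟨h.1.symm, fun x y hxy => (h.2 y x hxy.symm).symm⟩

lemma SameFrame.trans {c : IChain k} {i j a} (h : c.SameFrame i j) (h' : c.SameFrame j a) :
    c.SameFrame i a :=
  ⟨h.1.trans h'.1, fun x y hxy =>
    (h.2 x ⟨x, h.1 ▸ x.2⟩ rfl).trans (h'.2 _ y hxy)⟩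

lemma hom_hom (c : IChain k) {i j a : Fin (k + 1)} (hij : i ≤ j) (hja : j ≤ a) (x : Fin (c.o i)) :
    c.hom j a hja (c.hom i j hij x) = c.hom i a (hij.trans hja) x := by
  rw [c.hom_trans i j a hij hja]; rfl

lemma sameFrame_restrict (c : IChain l) (α : Fin (k + 1) →o Fin (l + 1)) (i j : Fin (k + 1)) :
    (c.restrict α).SameFrame i j ↔ c.SameFrame (α i) (α j) := by
  refine and_congr_right fun _ => forall_congr' fun x => forall_congr' fun y =>
    imp_congr_right fun _ => ?_
  rw [← c.hom_hom (α.monotone (Fin.le_last i)) (Fin.le_last (α (Fin.last k))) x,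
    ← c.hom_hom (α.monotone (Fin.le_last j)) (Fin.le_last (α (Fin.last k))) y,
    (c.hom _ _ _).injective.eq_iff]
  rfl

open Classical in
/-- The mass, in the window `θ`, of the vertices at level `n` with the same frame as `i`. -/
def mass (θ : ℝ → ℝ) (n : ℕ) (c : IChain k) (t : Fin (k + 1) → ℝ) (i : Fin (k + 1)) : ℝ :=
  ∑ j ∈ Finset.univ.filter (fun j => c.SameFrame i j), inc θ (c.levelPart n t) j

lemma mass_restrict (θ : ℝ → ℝ) (n : ℕ) (c : IChain l) (α : Fin (k + 1) →o Fin (l + 1))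
    (t : Fin (k + 1) → ℝ) (i : Fin (k + 1)) :
    (c.restrict α).mass θ n t i = c.mass θ n (push α t) (α i) := by
  classical
  rw [mass, mass, ← push_levelPart, inc_push, sum_push_finset]
  refine Finset.sum_congr ?_ fun _ _ => rfl
  ext j
  simp [sameFrame_restrict]

lemma mass_congr {θ : ℝ → ℝ} {n : ℕ} {c : IChain k} {t : Fin (k + 1) → ℝ} {i j}
    (h : c.SameFrame i j) : c.mass θ n t i = c.mass θ n t j := by
  classical
  refine Finset.sum_congr ?_ fun _ _ => rfl
  ext a
  simp only [Finset.mem_filter, Finset.mem_univ, true_and]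
  exact ⟨h.symm.trans, h.trans⟩

/-- The frame of the vertex `i` at level `n` has the majority in the window `θ`. -/
def Maj (θ : ℝ → ℝ) (n : ℕ) (c : IChain k) (t : Fin (k + 1) → ℝ) (i : Fin (k + 1)) : Prop :=
  c.o i = n ∧ 1 / 2 < c.mass θ n t i

lemma Maj.pos {θ : ℝ → ℝ} {n : ℕ} {c : IChain k} {t : Fin (k + 1) → ℝ} (ht : ∀ i, 0 ≤ t i)
    {i} (h : c.Maj θ n t i) : 0 < push c.o t n := by
  refine lt_of_le_of_ne (push_nonneg _ ht _) fun h0 => ?_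
  have h2 := h.2
  rw [mass, levelPart_eq_zero n c h0.symm] at h2
  simp [inc] at h2
  linarith

lemma maj_restrict {θ : ℝ → ℝ} {n : ℕ} {c : IChain l} {α : Fin (k + 1) →o Fin (l + 1)}
    {t : Fin (k + 1) → ℝ} {i : Fin (k + 1)} :
    (c.restrict α).Maj θ n t i ↔ c.Maj θ n (push α t) (α i) := by
  rw [Maj, Maj, mass_restrict]; rfl

lemma Maj.exists_restrict {θ : ℝ → ℝ} {n : ℕ} {c : IChain l} {α : Fin (k + 1) →o Fin (l + 1)}
    {t : Fin (k + 1) → ℝ} {i : Fin (l + 1)} (h : c.Maj θ n (push α t) i) :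
    ∃ i', (c.restrict α).Maj θ n t i' := by
  classical
  have h0 : c.mass θ n (push α t) i ≠ 0 := by linarith [h.2]
  obtain ⟨j, hj, hne⟩ := Finset.exists_ne_zero_of_sum_ne_zero h0
  rw [← push_levelPart, inc_push] at hne
  obtain ⟨p, rfl⟩ := exists_ne_zero_of_push hne
  have hs : c.SameFrame i (α p) := (Finset.mem_filter.1 hj).2
  exact ⟨p, maj_restrict.2 ⟨hs.1.symm.trans h.1, (mass_congr hs) ▸ h.2⟩⟩

end IChain

/-- Windows: monotone continuous functions of total increment at most one. -/
structure Win where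
  θ : ℝ → ℝ
  cont : Continuous θ
  mono : Monotone θ
  le_one : θ 1 - θ 0 ≤ 1

instance : Nonempty Win := ⟨⟨fun _ => 0, continuous_const, monotone_const, by simp⟩⟩

namespace IChain
variable {k l : ℕ}

lemma Maj.sameFrame {w : Win} {n : ℕ} {c : IChain k} {t : Fin (k + 1) → ℝ} (ht : ∀ i, 0 ≤ t i)
    {i j} (hi : c.Maj w.θ n t i) (hj : c.Maj w.θ n t j) : c.SameFrame i j := by
  classical
  by_contra hcon
  have hdis : Disjoint (Finset.univ.filter fun a => c.SameFrame i a)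
      (Finset.univ.filter fun a => c.SameFrame j a) := by
    rw [Finset.disjoint_filter]
    exact fun a _ h h' => hcon (h.trans h'.symm)
  have h1 := Finset.sum_union (f := inc w.θ (c.levelPart n t)) hdis
  have h2 : ∑ a ∈ (Finset.univ.filter fun a => c.SameFrame i a) ∪
      (Finset.univ.filter fun a => c.SameFrame j a), inc w.θ (c.levelPart n t) a ≤
      ∑ a, inc w.θ (c.levelPart n t) a :=
    Finset.sum_le_univ_sum_of_nonneg fun a => inc_nonneg w.mono (levelPart_nonneg n c ht) a
  rw [h1, sum_inc, sum_levelPart n c (hi.pos ht).ne'] at h2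
  have h3 := hi.2
  have h4 := hj.2
  have h5 := w.le_one
  rw [mass] at h3 h4
  linarith

end IChain

variable {A B : ISpace}

/-- The open set of points with a majority frame at level `n` in a given window. -/
def vSet (A : ISpace) (n : ℕ) (w : Win) : Set (Hocolim A) :=
  {z | hlift (fun _ c _ t => ∃ i, c.Maj w.θ n t.1 i) (fun k l α c p t => by
    rw [push_simplexMap]
    exact propext ⟨fun ⟨i, hi⟩ => hi.exists_restrict, fun ⟨i, hi⟩ => ⟨α i, IChain.maj_restrict.1 hi⟩⟩) z}

lemma incl_mem_vSet {n : ℕ} {w : Win} {k : ℕ} {c : IChain k} {p : A.obj (c.o 0)} {t : Simplex k} :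
    incl A c p t ∈ vSet A n w ↔ ∃ i, c.Maj w.θ n t.1 i := Iff.rfl

lemma IHom.hmap_mem_vSet (f : IHom A B) {n : ℕ} {w : Win} (z : Hocolim A) :
    f.hmap z ∈ vSet B n w ↔ z ∈ vSet A n w := by
  revert z
  exact hocolim_ind fun k c p t => Iff.rfl

lemma isOpen_hocolim {V : Set (Hocolim A)} (h : ∀ (k : ℕ) (c : IChain k),
    IsOpen {p : A.obj (c.o 0) × Simplex k | incl A c p.1 p.2 ∈ V}) : IsOpen V :=
  continuous_Prop.1 (continuous_hocolim (f := fun z => z ∈ V) fun k c => continuous_Prop.2 (h k c))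

lemma isOpen_maj (n : ℕ) (w : Win) {k : ℕ} (c : IChain k) (i : Fin (k + 1)) :
    IsOpen {t : Simplex k | c.Maj w.θ n t.1 i} := by
  classical
  by_cases hi : c.o i = n
  swap
  · simp [IChain.Maj, hi]
  have hp : Continuous fun t : Simplex k => push c.o t.1 n :=
    continuous_push c.o continuous_simplex_apply n
  have hU : IsOpen {t : Simplex k | 0 < push c.o t.1 n} := isOpen_lt continuous_const hp
  have hl : ∀ j, ContinuousOn (fun t : Simplex k => c.levelPart n t.1 j)
      {t | 0 < push c.o t.1 n} := fun j => by
    unfold IChain.levelPart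
    refine (continuous_simplex_apply j).continuousOn.mul ?_
    split_ifs
    · exact hp.continuousOn.inv₀ fun t ht => ne_of_gt ht
    · exact continuousOn_const
  have hm : ContinuousOn (fun t : Simplex k => c.mass w.θ n t.1 i) {t | 0 < push c.o t.1 n} := by
    refine continuousOn_finsetSum _ fun j _ => ContinuousOn.sub ?_ ?_
    · exact w.cont.comp_continuousOn (continuousOn_finsetSum _ fun a _ => hl a)
    · exact w.cont.comp_continuousOn (continuousOn_finsetSum _ fun a _ => hl a)
  convert hm.isOpen_inter_preimage hU (isOpen_Ioi (a := (1 / 2 : ℝ))) using 1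
  ext t
  exact ⟨fun h => ⟨h.pos t.2.1, h.2⟩, fun h => ⟨hi, h.2⟩⟩

lemma isOpen_vSet (n : ℕ) (w : Win) : IsOpen (vSet A n w) := by
  refine isOpen_hocolim fun k c => ?_
  simp only [incl_mem_vSet, ofPred_exists]
  exact isOpen_iUnion fun i => (isOpen_maj n w c i).preimage continuous_snd

lemma iUnion_vSet : ⋃ x : ℕ × Win, vSet A x.1 x.2 = univ := by
  classical
  rw [iUnion_eq_univ_iff]
  refine hocolim_ind fun k c p t => ?_
  obtain ⟨i, hi⟩ := exists_pos t
  have hpos : 0 < push c.o t.1 (c.o i) :=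
    Finset.sum_pos' (fun j _ => by split_ifs; exacts [t.2.1 j, le_rfl])
      ⟨i, Finset.mem_univ _, by simpa using hi⟩
  set u := c.levelPart (c.o i) t.1 with hu
  have hui : 0 < u i := by
    simp only [hu, IChain.levelPart, if_true]
    positivity
  set a := ∑ j ∈ Finset.Iio i, u j with ha
  let w : Win :=
    { θ := fun x => max 0 (min 1 ((x - a) / u i))
      cont := by fun_prop
      mono := fun x y hxy => by
        refine max_le_max_left _ (min_le_min_left _ ?_)
        gcongr
      le_one := by
        have h1 : max 0 (min 1 ((1 - a) / u i)) ≤ 1 := max_le zero_le_one (min_le_left _ _)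
        have h2 : 0 ≤ max 0 (min 1 ((0 - a) / u i)) := le_max_left _ _
        linarith }
  refine ⟨(c.o i, w), incl_mem_vSet.2 ⟨i, rfl, ?_⟩⟩
  have h1 : inc w.θ u i = 1 := by
    rw [inc, sum_Iic_eq, ← ha]
    simp [w, hui.ne']
  have h2 : inc w.θ u i ≤ c.mass w.θ (c.o i) t.1 i :=
    Finset.single_le_sum (f := inc w.θ u)
      (fun j _ => inc_nonneg w.mono (IChain.levelPart_nonneg _ c t.2.1) j)
      (Finset.mem_filter.2 ⟨Finset.mem_univ _, .refl c i⟩)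
  linarith

end

section

open Set
open IFun Topology

variable {A B : ISpace}

namespace IChain
variable {k l : ℕ}

/-- The multiplier, depending on the level `m`, moving the weight `b` below level `n` to level `n`,
whose weight is `a`. -/
def mult (n : ℕ) (s a b : ℝ) (m : ℕ) : ℝ :=
  if 0 < a then (if m < n then 1 - s else if m = n then 1 + s * b / a else 1) else 1

/-- The weight of the vertices below level `n`. -/
def lowW (n : ℕ) (c : IChain k) (t : Fin (k + 1) → ℝ) : ℝ := push (fun i => c.o i < n) t True

/-- Moving the weight below level `n` to level `n`. -/
def resc (n : ℕ) (s : ℝ) (c : IChain k) (t : Fin (k + 1) → ℝ) (i : Fin (k + 1)) : ℝ :=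
  t i * mult n s (push c.o t n) (c.lowW n t) (c.o i)

lemma push_resc (n : ℕ) (s : ℝ) (c : IChain l) (α : Fin (k + 1) →o Fin (l + 1))
    (t : Fin (k + 1) → ℝ) :
    push α ((c.restrict α).resc n s t) = c.resc n s (push α t) := by
  have h : push (c.restrict α).o t n = push c.o (push α t) n := by rw [push_push]; rfl
  have h' : (c.restrict α).lowW n t = c.lowW n (push α t) := by
    rw [lowW, lowW, push_push]; rfl
  refine (congrArg (push α) ?_).trans (push_mul α t fun j => mult n s _ _ (c.o j))
  ext i
  rw [resc, h, h']
  rfl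

lemma mult_nonneg {n : ℕ} {s a b : ℝ} (hs : s ∈ Icc (0 : ℝ) 1) (hb : 0 ≤ b) (m : ℕ) :
    0 ≤ mult n s a b m := by
  have h0 := hs.1
  have h1 := hs.2
  rw [mult]
  split_ifs with h
  · linarith
  · positivity
  all_goals exact zero_le_one

lemma mult_pos {n : ℕ} {s a b : ℝ} (hs : s ∈ Icc (0 : ℝ) 1) (hb : 0 ≤ b) {m : ℕ} (hm : n ≤ m) :
    0 < mult n s a b m := by
  have h0 := hs.1
  rw [mult, if_neg hm.not_gt]
  split_ifs with h
  · positivity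
  all_goals exact zero_lt_one

lemma lowW_nonneg (n : ℕ) (c : IChain k) {t : Fin (k + 1) → ℝ} (ht : ∀ i, 0 ≤ t i) :
    0 ≤ c.lowW n t := push_nonneg _ ht _

lemma sum_resc (n : ℕ) (s : ℝ) (c : IChain k) (t : Fin (k + 1) → ℝ) :
    ∑ i, c.resc n s t i = ∑ i, t i := by
  classical
  by_cases ha : 0 < push c.o t n
  · have h : ∀ i, c.resc n s t i = t i - s * (if (c.o i < n) = True then t i else 0) +
        s * c.lowW n t / push c.o t n * (if c.o i = n then t i else 0) := fun i => by
      rw [resc, mult, if_pos ha]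
      by_cases h1 : c.o i < n
      · rw [if_pos h1, if_pos (eq_true h1), if_neg h1.ne]; ring
      · have h2 : ¬ ((c.o i < n) = True) := by simpa using h1
        rw [if_neg h1, if_neg h2]
        split_ifs <;> ring
    rw [Finset.sum_congr rfl fun i _ => h i, Finset.sum_add_distrib, Finset.sum_sub_distrib,
      ← Finset.mul_sum, ← Finset.mul_sum]
    have e1 : ∑ i, (if (c.o i < n) = True then t i else 0) = c.lowW n t := by
      rw [lowW, push]; congr!
    have e2 : ∑ i, (if c.o i = n then t i else 0) = push c.o t n := by
      rw [push]; congr!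
    rw [e1, e2]
    field_simp
    ring
  · simp [resc, mult, ha]

/-- `resc` on points of the simplex. -/
def rescale (n : ℕ) (s : unitInterval) (c : IChain k) (t : Simplex k) : Simplex k :=
  ⟨c.resc n s t.1, fun i => mul_nonneg (t.2.1 i) (mult_nonneg s.2 (c.lowW_nonneg n t.2.1) _),
    (c.sum_resc n s t.1).trans t.2.2⟩

lemma simplexMap_rescale (n : ℕ) (s : unitInterval) (c : IChain l)
    (α : Fin (k + 1) →o Fin (l + 1)) (t : Simplex k) :
    simplexMap α ((c.restrict α).rescale n s t) = c.rescale n s (simplexMap α t) := by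
  refine Subtype.ext ((push_simplexMap _ _).trans ((push_resc n s c α t.1).trans ?_))
  exact congrArg (c.resc n s) (push_simplexMap _ _).symm

lemma rescale_zero (n : ℕ) (c : IChain k) (t : Simplex k) : c.rescale n 0 t = t := by
  refine Subtype.ext (funext fun i => ?_)
  simp [rescale, resc, mult]

lemma push_o_resc (n : ℕ) (s : ℝ) (c : IChain k) (t : Fin (k + 1) → ℝ) (m : ℕ) :
    push c.o (c.resc n s t) m = push c.o t m * mult n s (push c.o t n) (c.lowW n t) m :=
  congrFun (push_mul c.o t fun m => mult n s (push c.o t n) (c.lowW n t) m) m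

lemma levelPart_resc {n m : ℕ} (hm : n ≤ m) {s : ℝ} (hs : s ∈ Icc (0 : ℝ) 1) (c : IChain k)
    {t : Fin (k + 1) → ℝ} (ht : ∀ i, 0 ≤ t i) :
    c.levelPart m (c.resc n s t) = c.levelPart m t := by
  ext i
  rw [levelPart, levelPart, push_o_resc, resc]
  by_cases h : c.o i = m
  · rw [if_pos h, if_pos h, h, mul_inv]
    have := (mult_pos (a := push c.o t n) hs (c.lowW_nonneg n ht) hm).ne'
    field_simp
  · rw [if_neg h, if_neg h, mul_zero, mul_zero]

lemma maj_rescale {θ : ℝ → ℝ} {n m : ℕ} (hm : n ≤ m) (s : unitInterval) (c : IChain k)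
    (t : Simplex k) (i : Fin (k + 1)) :
    c.Maj θ m (c.rescale n s t).1 i ↔ c.Maj θ m t.1 i := by
  unfold Maj mass
  rw [show c.levelPart m (c.rescale n s t).1 = c.levelPart m t.1 from
    levelPart_resc hm s.2 c t.2.1]

lemma continuousOn_resc (n : ℕ) (c : IChain k) (i : Fin (k + 1)) :
    ContinuousOn (fun p : Simplex k × ℝ => c.resc n p.2 p.1.1 i)
      {p | 0 < push c.o p.1.1 n} := by
  have h1 : Continuous fun p : Simplex k × ℝ => push c.o p.1.1 n :=
    continuous_push c.o (fun i => (continuous_simplex_apply i).comp continuous_fst) n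
  have h2 : Continuous fun p : Simplex k × ℝ => c.lowW n p.1.1 :=
    continuous_push _ (fun i => (continuous_simplex_apply i).comp continuous_fst) _
  have h3 : Continuous fun p : Simplex k × ℝ => p.1.1 i :=
    (continuous_simplex_apply i).comp continuous_fst
  have : ContinuousOn (fun p : Simplex k × ℝ => p.1.1 i * if c.o i < n then 1 - p.2 else
      if c.o i = n then 1 + p.2 * c.lowW n p.1.1 / push c.o p.1.1 n else 1)
      {p | 0 < push c.o p.1.1 n} := by
    refine h3.continuousOn.mul ?_
    split_ifs
    · fun_prop
    · refine continuousOn_const.add (ContinuousOn.div ?_ h1.continuousOn fun p hp => ne_of_gt hp)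
      exact (continuous_snd.mul h2).continuousOn
    · exact continuousOn_const
  refine this.congr fun p hp => ?_
  have hp' : 0 < push c.o p.1.1 n := hp
  unfold IChain.resc IChain.mult
  rw [if_pos hp']

lemma resc_one_eq_zero {n : ℕ} {c : IChain k} {t : Fin (k + 1) → ℝ} (ha : 0 < push c.o t n)
    {i : Fin (k + 1)} (hi : c.o i < n) : c.resc n 1 t i = 0 := by
  simp [resc, mult, ha, hi]

end IChain

/-- The flow moving the weight below level `n` to level `n`. -/
def flow (n : ℕ) (z : Hocolim A) (s : unitInterval) : Hocolim A :=
  hlift (fun _ c p t => incl A c p (c.rescale n s t)) (fun k l α c p t => by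
    rw [← IChain.simplexMap_rescale]
    exact incl_glue _ _ _ _ _) z

lemma flow_incl (n : ℕ) {k : ℕ} (c : IChain k) (p : A.obj (c.o 0)) (t) (s) :
    flow n (incl A c p t) s = incl A c p (c.rescale n s t) := rfl

lemma flow_zero (n : ℕ) (z : Hocolim A) : flow n z 0 = z := by
  revert z
  refine hocolim_ind fun k c p t => ?_
  rw [flow_incl, IChain.rescale_zero]

lemma IHom.hmap_flow (f : IHom A B) (n : ℕ) (z : Hocolim A) (s) :
    f.hmap (flow n z s) = flow n (f.hmap z) s := by
  revert z
  exact hocolim_ind fun k c p t => rfl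

lemma flow_mem_vSet {n m : ℕ} (hm : n ≤ m) {w : Win} {z : Hocolim A} (s) :
    flow n z s ∈ vSet A m w ↔ z ∈ vSet A m w := by
  revert z
  refine @hocolim_ind A _ fun k c p t => exists_congr fun i => IChain.maj_rescale hm s c t i

lemma continuousOn_flow (n : ℕ) (w : Win) :
    ContinuousOn (fun p : Hocolim A × unitInterval => flow n p.1 p.2) (vSet A n w ×ˢ univ) := by
  refine continuousOn_hocolim (isOpen_vSet n w) fun k c => ?_
  refine (continuous_incl A c).comp_continuousOn (f := fun p : (A.obj (c.o 0) × Simplex k) ×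
    unitInterval => (p.1.1, c.rescale n p.2 p.1.2)) ?_
  refine (continuous_fst.comp continuous_fst).continuousOn.prodMk ?_
  rw [continuousOn_iff_continuous_domRestrict]
  refine Continuous.subtype_mk (continuous_pi fun i => ?_) _
  refine (continuousOn_iff_continuous_domRestrict (f := fun p : (A.obj (c.o 0) × Simplex k) ×
    unitInterval => c.resc n p.2 p.1.2.1 i)).1 ?_
  refine (IChain.continuousOn_resc n c i).comp (f := fun p : (A.obj (c.o 0) × Simplex k) ×
    unitInterval => (p.1.2, (p.2 : ℝ))) (by fun_prop) ?_
  rintro p ⟨i, hi⟩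
  exact hi.pos p.1.2.2.1

end

section

open Set
open IFun Topology

variable {A B C : ISpace}

/-- The bijection between equal finite sets, as an embedding. -/
def castEmb {a b : ℕ} (h : a = b) : Fin a ↪ Fin b := ⟨Fin.cast h, Fin.cast_injective h⟩

namespace IChain
variable {k l : ℕ}

/-- The structure map from the bottom vertex to a vertex at level `n`. -/
def frame (c : IChain k) {n : ℕ} {i : Fin (k + 1)} (h : c.o i = n) : Fin (c.o 0) ↪ Fin n :=
  (c.hom 0 i (Fin.zero_le _)).trans (castEmb h)

lemma frame_eq {c : IChain k} {n : ℕ} {i j : Fin (k + 1)} (hs : c.SameFrame i j) (hi : c.o i = n)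
    (hj : c.o j = n) : c.frame hi = c.frame hj := by
  ext x
  have h1 := hs.2 (c.hom 0 i (Fin.zero_le _) x) (Fin.cast hs.1 (c.hom 0 i (Fin.zero_le _) x)) rfl
  rw [c.hom_hom, ← c.hom_hom (Fin.zero_le j) (Fin.le_last j)] at h1
  have h2 := (c.hom j _ _).injective h1
  change (c.hom 0 i (Fin.zero_le _) x).val = (c.hom 0 j (Fin.zero_le _) x).val
  rw [h2]; rfl

open Classical in
/-- The element at level `n` determined by the majority frame. -/
def rhoVal (A : ISpace) (n : ℕ) (w : Win) (c : IChain k) (p : A.obj (c.o 0)) (t : Simplex k) :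
    A.obj n :=
  if h : ∃ i, c.Maj w.θ n t.1 i then A.map (c.frame h.choose_spec.1) p else A.pt n

lemma rhoVal_eq {n : ℕ} {w : Win} {c : IChain k} (p : A.obj (c.o 0)) {t : Simplex k} {i}
    (hi : c.Maj w.θ n t.1 i) : c.rhoVal A n w p t = A.map (c.frame hi.1) p := by
  have h : ∃ i, c.Maj w.θ n t.1 i := ⟨i, hi⟩
  rw [rhoVal, dif_pos h]
  rw [frame_eq (Maj.sameFrame t.2.1 h.choose_spec hi) _ hi.1]

lemma rhoVal_restrict (A : ISpace) (n : ℕ) (w : Win) (α : Fin (k + 1) →o Fin (l + 1)) (c : IChain l)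
    (p : A.obj (c.o 0)) (t : Simplex k) : c.rhoVal A n w p (simplexMap α t) =
      (c.restrict α).rhoVal A n w (A.map (c.hom 0 (α 0) (Fin.zero_le _)) p) t := by
  by_cases h : ∃ i, (c.restrict α).Maj w.θ n t.1 i
  · obtain ⟨i, hi⟩ := h
    have hi' : c.Maj w.θ n (simplexMap α t).1 (α i) := by
      rw [push_simplexMap]; exact maj_restrict.1 hi
    refine (rhoVal_eq p hi').trans (Eq.trans ?_ (rhoVal_eq _ hi).symm)
    refine Eq.trans ?_ (A.map_comp _ _ _)
    refine congrArg (fun e => A.map e p) ?_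
    ext x
    change (c.hom 0 (α i) _ x).val = (c.hom (α 0) (α i) _ (c.hom 0 (α 0) _ x)).val
    exact congrArg Fin.val (c.hom_hom (Fin.zero_le _) (α.monotone (Fin.zero_le i)) x).symm
  · have h' : ¬ ∃ i, c.Maj w.θ n (simplexMap α t).1 i := fun ⟨i, hi⟩ => by
      rw [push_simplexMap] at hi
      exact h hi.exists_restrict
    rw [rhoVal, rhoVal, dif_neg h, dif_neg h']

end IChain

/-- The element at level `n` determined by the majority frame. -/
def rho (n : ℕ) (w : Win) : Hocolim A → A.obj n :=
  hlift (fun _ c p t => c.rhoVal A n w p t) fun _ _ α c p t => c.rhoVal_restrict A n w α p t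

lemma rho_incl {n : ℕ} {w : Win} {k : ℕ} {c : IChain k} (p : A.obj (c.o 0)) {t : Simplex k} {i}
    (hi : c.Maj w.θ n t.1 i) : rho n w (incl A c p t) = A.map (c.frame hi.1) p :=
  IChain.rhoVal_eq p hi

lemma IHom.rho_hmap (f : IHom A B) {n : ℕ} {w : Win} {z : Hocolim A} (hz : z ∈ vSet A n w) :
    rho n w (f.hmap z) = f.app n (rho n w z) := by
  revert z
  refine @hocolim_ind A _ fun k c p t ⟨i, hi⟩ => ?_
  rw [rho_incl p hi, f.nat]
  exact rho_incl (f.app _ p) hi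

lemma continuousOn_rho (n : ℕ) (w : Win) : ContinuousOn (rho n w) (vSet A n w) := by
  have : ContinuousOn (fun p : Hocolim A × Unit => rho n w p.1) (vSet A n w ×ˢ univ) := by
    refine continuousOn_hocolim (isOpen_vSet n w) fun k c => ?_
    rintro ⟨⟨p, t⟩, u⟩ ⟨i, hi⟩
    refine ContinuousAt.continuousWithinAt ?_
    have h1 : ContinuousAt (fun q : (A.obj (c.o 0) × Simplex k) × Unit =>
        A.map (c.frame hi.1) q.1.1) ((p, t), u) :=
      ((A.map_cont _).comp (continuous_fst.comp continuous_fst)).continuousAt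
    refine h1.congr ?_
    have h2 : ∀ᶠ q : (A.obj (c.o 0) × Simplex k) × Unit in 𝓝 ((p, t), u), c.Maj w.θ n q.1.2.1 i :=
      ((isOpen_maj n w c i).preimage (continuous_snd.comp continuous_fst)).mem_nhds hi
    filter_upwards [h2] with q hq
    exact (rho_incl q.1.1 hq).symm
  exact this.comp (f := fun z => (z, ())) (by fun_prop) fun z hz => ⟨hz, mem_univ _⟩

namespace IChain
variable {k l : ℕ}

/-- The vertices at level at least `n`. -/
abbrev Upper (n : ℕ) (c : IChain k) : Type := {i : Fin (k + 1) // n ≤ c.o i}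

/-- The inclusion of the vertices at level at least `n`. -/
abbrev upIn (n : ℕ) (c : IChain k) : c.Upper n →o Fin (k + 1) := ⟨Subtype.val, fun _ _ h => h⟩

/-- The map induced by a reindexing on vertices at level at least `n`. -/
abbrev upMap (n : ℕ) (c : IChain l) (α : Fin (k + 1) →o Fin (l + 1)) :
    (c.restrict α).Upper n →o c.Upper n := ⟨fun i => ⟨α i.1, i.2⟩, fun _ _ h => α.monotone h⟩

lemma resc_upper {n : ℕ} {c : IChain k} {t : Fin (k + 1) → ℝ} (ha : 0 < push c.o t n) :
    push (c.upIn n) (fun i => c.resc n 1 t i.1) = c.resc n 1 t := by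
  ext i
  by_cases hi : n ≤ c.o i
  · exact push_injective_apply (f := c.upIn n) Subtype.val_injective
      (fun i => c.resc n 1 t i.1) ⟨i, hi⟩
  · rw [resc_one_eq_zero ha (not_le.1 hi)]
    by_contra h
    obtain ⟨⟨p, hp⟩, rfl⟩ := exists_ne_zero_of_push h
    exact hi hp

lemma isWeight_resc {n : ℕ} {c : IChain k} {t : Simplex k} (ha : 0 < push c.o t.1 n) :
    IsWeight fun i : c.Upper n => c.resc n 1 t.1 i.1 where
  nonneg i := (c.rescale n 1 t).2.1 i.1
  sum_eq := by
    have h := sum_push (c.upIn n) fun i => c.resc n 1 t.1 i.1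
    rw [resc_upper ha] at h
    exact h.symm.trans (c.rescale n 1 t).2.2
  total i j _ _ := le_total i j

/-- The point of the homotopy colimit with a given element at level `n`. -/
def jAt (A : ISpace) {n : ℕ} (c : IChain k) {r : c.Upper n} (hr : ∀ r', r ≤ r')
    (g : Fin n ↪ Fin (c.o r.1)) (a : A.obj n) (t : Fin (k + 1) → ℝ) : Hocolim A :=
  ((ofChain c).pull (c.upIn n)).gpt A hr (A.map g a) fun i => c.resc n 1 t i.1

lemma jAt_restrict (A : ISpace) {n : ℕ} (c : IChain l) (α : Fin (k + 1) →o Fin (l + 1))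
    {r : c.Upper n} (hr : ∀ r', r ≤ r') (g : Fin n ↪ Fin (c.o r.1))
    {r' : (c.restrict α).Upper n} (hr' : ∀ s, r' ≤ s) (g' : Fin n ↪ Fin ((c.restrict α).o r'.1))
    (hg : g.trans (c.hom r.1 (α r'.1) (hr (c.upMap n α r'))) = g') (a : A.obj n) (t : Simplex k)
    (ha : 0 < push (c.restrict α).o t.1 n) :
    (c.restrict α).jAt A hr' g' a t.1 = c.jAt A hr g a (push α t.1) := by
  subst hg
  have ha' : 0 < push c.o (push α t.1) n := by rw [push_push]; exact ha
  have h := gpt_pull ((ofChain c).pull (c.upIn n)) A hr (A.map g a) (c.upMap n α) hr'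
    (isWeight_resc (c := c.restrict α) ha)
  have h2 : push (c.upMap n α) (fun i => (c.restrict α).resc n 1 t.1 i.1) =
      fun i : c.Upper n => c.resc n 1 (push α t.1) i.1 := by
    ext i
    rw [← resc_upper ha']
    have e1 := push_injective_apply (f := c.upIn n) Subtype.val_injective
      (push (c.upMap n α) (fun i => (c.restrict α).resc n 1 t.1 i.1)) i
    have e2 := push_injective_apply (f := c.upIn n) Subtype.val_injective
      (fun i => c.resc n 1 (push α t.1) i.1) i
    refine e1.symm.trans ?_
    rw [push_push]
    have e3 := push_push ((c.restrict α).upIn n) α (fun i => (c.restrict α).resc n 1 t.1 i.1)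
    rw [resc_upper ha, push_resc, ← resc_upper ha'] at e3
    exact congrFun e3.symm _
  rw [h2] at h
  refine Eq.trans ?_ h
  exact congrArg (fun y => ((ofChain (c.restrict α)).pull ((c.restrict α).upIn n)).gpt A hr' y
    fun i => (c.restrict α).resc n 1 t.1 i.1) (A.map_comp _ _ _)

/-- The embedding `g` corresponds to the frame of the vertex `i`. -/
def Compat {n : ℕ} (c : IChain k) (i r : Fin (k + 1)) (g : Fin n ↪ Fin (c.o r)) : Prop :=
  ∀ (x : Fin n) (y : Fin (c.o i)), x.val = y.val →
    c.hom i (Fin.last k) (Fin.le_last _) y = c.hom r (Fin.last k) (Fin.le_last _) (g x)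

lemma exists_compat {n : ℕ} {c : IChain k} {i r : Fin (k + 1)} (hi : c.o i = n) (hr : n ≤ c.o r)
    (hri : r ≤ i) : ∃ g : Fin n ↪ Fin (c.o r), c.Compat i r g := by
  have h1 : c.o r = n :=
    le_antisymm (by simpa [hi] using Fintype.card_le_of_embedding (c.hom r i hri)) hr
  let e := Equiv.ofBijective _ ((Fintype.bijective_iff_injective_and_card (c.hom r i hri)).2
    ⟨(c.hom r i hri).injective, by simp [h1, hi]⟩)
  refine ⟨(castEmb hi.symm).trans e.symm.toEmbedding, fun x y hxy => ?_⟩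
  rw [← c.hom_hom hri (Fin.le_last i)]
  refine congrArg _ ?_
  have h2 : c.hom r i hri (e.symm (castEmb hi.symm x)) = castEmb hi.symm x := e.apply_symm_apply _
  exact (Fin.ext hxy.symm : y = castEmb hi.symm x).trans h2.symm

lemma exists_bot {n : ℕ} {c : IChain k} {i : Fin (k + 1)} (hi : n ≤ c.o i) :
    ∃ r : c.Upper n, ∀ r', r ≤ r' := by
  obtain ⟨r, -, hr⟩ := WellFounded.has_min (α := c.Upper n) wellFounded_lt univ ⟨⟨i, hi⟩, mem_univ _⟩
  exact ⟨r, fun r' => not_lt.1 (hr r' (mem_univ _))⟩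

/-- The graph of `jVal`. -/
def JRel (A : ISpace) (n : ℕ) (w : Win) (c : IChain k) (a : A.obj n) (t : Fin (k + 1) → ℝ)
    (x : Hocolim A) : Prop :=
  ∃ (i : Fin (k + 1)) (r : c.Upper n) (hr : ∀ r', r ≤ r') (g : Fin n ↪ Fin (c.o r.1)),
    c.Maj w.θ n t i ∧ c.Compat i r.1 g ∧ x = c.jAt A hr g a t

lemma JRel.eq_of_restrict {n : ℕ} {w : Win} {c : IChain l} {α : Fin (k + 1) →o Fin (l + 1)}
    {a : A.obj n} {t : Simplex k} {x' x : Hocolim A} (h' : (c.restrict α).JRel A n w a t.1 x')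
    (h : c.JRel A n w a (push α t.1) x) : x' = x := by
  obtain ⟨i', r', hr', g', hi', hg', rfl⟩ := h'
  obtain ⟨i, r, hr, g, hi, hg, rfl⟩ := h
  refine jAt_restrict A c α hr g hr' g' ?_ a t (hi'.pos t.2.1)
  ext x
  have hs : c.SameFrame i (α i') :=
    Maj.sameFrame (fun j => push_nonneg _ t.2.1 j) hi (maj_restrict.1 hi')
  have h1 := hg x ⟨x, hi.1.symm ▸ x.2⟩ rfl
  have h2 : (c.hom (α i') (Fin.last l) (Fin.le_last _)) ⟨x, (hs.1.symm.trans hi.1).symm ▸ x.2⟩ =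
      c.hom (α r'.1) (Fin.last l) (Fin.le_last _) (g' x) := by
    refine (c.hom_hom (α.monotone (Fin.le_last i')) (Fin.le_last (α (Fin.last k))) _).symm.trans
      (Eq.trans ?_ (c.hom_hom (α.monotone (Fin.le_last r'.1)) (Fin.le_last (α (Fin.last k))) _))
    exact congrArg _ (hg' x _ rfl)
  have h3 := hs.2 ⟨x, hi.1.symm ▸ x.2⟩ ⟨x, (hs.1.symm.trans hi.1).symm ▸ x.2⟩ rfl
  have h4 := (h1.symm.trans h3).trans h2
  have h5 := (c.hom_hom (hr (c.upMap n α r')) (Fin.le_last (α r'.1)) (g x)).trans h4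
  exact congrArg Fin.val ((c.hom (α r'.1) _ _).injective h5)

lemma JRel.unique {n : ℕ} {w : Win} {c : IChain k} {a : A.obj n} {t : Simplex k}
    {x' x : Hocolim A} (h' : c.JRel A n w a t.1 x') (h : c.JRel A n w a t.1 x) : x' = x := by
  have h1 : push (OrderHom.id : Fin (k + 1) →o Fin (k + 1)) t.1 = t.1 := by
    ext i; exact push_injective_apply (f := (OrderHom.id : Fin (k + 1) →o Fin (k + 1)))
      (fun _ _ h => h) _ i
  exact JRel.eq_of_restrict (c := c) (α := OrderHom.id) h' (h1.symm ▸ h)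

lemma Maj.exists_jRel {n : ℕ} {w : Win} {c : IChain k} {t : Fin (k + 1) → ℝ} {i}
    (hi : c.Maj w.θ n t i) : ∃ (r : c.Upper n) (hr : ∀ r', r ≤ r') (g : Fin n ↪ Fin (c.o r.1)),
      c.Compat i r.1 g ∧ ∀ (A : ISpace) (a : A.obj n), c.JRel A n w a t (c.jAt A hr g a t) := by
  obtain ⟨r, hr⟩ := exists_bot hi.1.ge
  obtain ⟨g, hg⟩ := exists_compat hi.1 r.2 (hr ⟨i, hi.1.ge⟩)
  exact ⟨r, hr, g, hg, fun A a => ⟨i, r, hr, g, hi, hg, rfl⟩⟩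

open Classical in
/-- The point of the homotopy colimit with a given element at level `n` in the majority frame. -/
def jVal (A : ISpace) (n : ℕ) (w : Win) (c : IChain k) (a : A.obj n) (t : Simplex k) : Hocolim A :=
  if h : ∃ x, c.JRel A n w a t.1 x then h.choose else basept A

lemma JRel.jVal_eq {n : ℕ} {w : Win} {c : IChain k} {a : A.obj n} {t : Simplex k}
    {x : Hocolim A} (h : c.JRel A n w a t.1 x) : c.jVal A n w a t = x := by
  have h' : ∃ x, c.JRel A n w a t.1 x := ⟨x, h⟩
  rw [jVal, dif_pos h']
  exact h'.choose_spec.unique h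

lemma jVal_restrict (A : ISpace) (n : ℕ) (w : Win) (α : Fin (k + 1) →o Fin (l + 1)) (c : IChain l)
    (a : A.obj n) (t : Simplex k) :
    c.jVal A n w a (simplexMap α t) = (c.restrict α).jVal A n w a t := by
  by_cases h : ∃ i, (c.restrict α).Maj w.θ n t.1 i
  · obtain ⟨i, hi⟩ := h
    have hi' : c.Maj w.θ n (simplexMap α t).1 (α i) := by
      rw [push_simplexMap]; exact maj_restrict.1 hi
    obtain ⟨r, hr, g, -, h1⟩ := hi.exists_jRel
    obtain ⟨r', hr', g', -, h2⟩ := hi'.exists_jRel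
    rw [(h1 A a).jVal_eq, (h2 A a).jVal_eq]
    exact ((h1 A a).eq_of_restrict (push_simplexMap α t ▸ h2 A a)).symm
  · have h1 : ¬ ∃ x, (c.restrict α).JRel A n w a t.1 x := fun ⟨x, i, _, _, _, hi, _⟩ => h ⟨i, hi⟩
    have h2 : ¬ ∃ x, c.JRel A n w a (simplexMap α t).1 x := fun ⟨x, i, _, _, _, hi, _⟩ => by
      rw [push_simplexMap] at hi
      exact h hi.exists_restrict
    rw [jVal, jVal, dif_neg h1, dif_neg h2]

end IChain

/-- The point of the homotopy colimit with a given element at level `n` and a given shape. -/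
def jmap (n : ℕ) (w : Win) (a : A.obj n) : Hocolim B → Hocolim A :=
  hlift (fun _ c _ t => c.jVal A n w a t) fun _ _ α c _ t => c.jVal_restrict A n w α a t

lemma jmap_incl {n : ℕ} {w : Win} {k : ℕ} {c : IChain k} {t : Simplex k} {i}
    (hi : c.Maj w.θ n t.1 i) : ∃ (r : c.Upper n) (hr : ∀ r', r ≤ r') (g : Fin n ↪ Fin (c.o r.1)),
      c.Compat i r.1 g ∧ ∀ (u : Simplex k), c.Maj w.θ n u.1 i →
        ∀ (A B : ISpace) (a : A.obj n) (p : B.obj (c.o 0)),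
        jmap n w a (incl B c p u) = c.jAt A hr g a u.1 := by
  obtain ⟨r, hr, g, hg, -⟩ := hi.exists_jRel
  exact ⟨r, hr, g, hg, fun u hu A B a p =>
    IChain.JRel.jVal_eq ⟨i, r, hr, g, hu, hg, rfl⟩⟩

lemma jmap_hmap (f : IHom B C) {n : ℕ} {w : Win} (a : A.obj n) (z : Hocolim B) :
    jmap n w a (f.hmap z) = jmap n w a z := by
  revert z
  exact hocolim_ind fun k c p t => rfl

lemma jmap_rho {n : ℕ} {w : Win} {z : Hocolim A} (hz : z ∈ vSet A n w) :
    jmap n w (rho n w z) z = flow n z 1 := by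
  revert z
  refine @hocolim_ind A _ fun k c p t ⟨i, hi⟩ => ?_
  obtain ⟨r, hr, g, hg, h⟩ := jmap_incl hi
  rw [h t hi, rho_incl p hi, flow_incl, ← gpt_ofChain]
  have hw := IChain.isWeight_resc (hi.pos t.2.1)
  have h1 := gpt_pull (ofChain c) A (fun r => Fin.zero_le r) p (c.upIn n) hr hw
  rw [IChain.resc_upper (hi.pos t.2.1)] at h1
  refine Eq.trans ?_ h1
  refine congrArg (fun y => ((ofChain c).pull (c.upIn n)).gpt A hr y
    fun i => c.resc n 1 t.1 i.1) ?_
  rw [← A.map_comp]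
  congr 1
  ext x
  have h2 := hg (c.frame hi.1 x) (c.hom 0 i (Fin.zero_le _) x) rfl
  rw [c.hom_hom, ← c.hom_hom (Fin.zero_le r.1) (Fin.le_last r.1)] at h2
  exact congrArg Fin.val ((c.hom r.1 _ _).injective h2).symm

lemma IHom.hmap_gpt {R : Type} [PartialOrder R] [Fintype R] (f : IHom A B) (Γ : IFun R) {r : R}
    (h : ∀ r', r ≤ r') (y : A.obj (Γ.o r)) {w : R → ℝ} (hw : IsWeight w) :
    f.hmap (Γ.gpt A h y w) = Γ.gpt B h (f.app _ y) w := by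
  obtain ⟨k, m, t, rfl⟩ := exists_push hw
  rw [gpt_push, gpt_push]
  exact congrArg (fun z => incl B (Γ.chain m) z t) (f.nat (Γ.hom r (m 0) (h _)) y)

lemma IHom.hmap_jmap (f : IHom A C) {n : ℕ} {w : Win} (a : A.obj n) {z : Hocolim B}
    (hz : z ∈ vSet B n w) : f.hmap (jmap n w a z) = jmap n w (f.app n a) z := by
  revert z
  refine @hocolim_ind B _ fun k c p t ⟨i, hi⟩ => ?_
  obtain ⟨r, hr, g, hg, h⟩ := jmap_incl hi
  rw [h t hi, h t hi, IChain.jAt, f.hmap_gpt _ _ _ (IChain.isWeight_resc (hi.pos t.2.1)), f.nat]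
  rfl

/-- The terminal `𝓘`-space. -/
def pointISpace : ISpace where
  obj _ := Unit
  topo _ := inferInstance
  pt _ := ()
  map _ _ := ()
  map_cont _ := continuous_const
  map_id _ _ := rfl
  map_comp _ _ _ := rfl
  map_pt _ := rfl

/-- The map to the terminal `𝓘`-space. -/
def toPoint (A : ISpace) : IHom A pointISpace where
  app _ _ := ()
  cont _ := continuous_const
  nat _ _ := rfl

lemma jmap_mem_vSet {n m : ℕ} (hm : n ≤ m) {w w' : Win} (a : A.obj n) {z : Hocolim B}
    (hz : z ∈ vSet B n w) : jmap n w a z ∈ vSet A m w' ↔ z ∈ vSet B m w' := by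
  have h1 := (toPoint A).hmap_jmap a hz
  have h2 := jmap_rho (((toPoint B).hmap_mem_vSet z).2 hz)
  rw [jmap_hmap] at h2
  rw [← (toPoint A).hmap_mem_vSet, h1]
  have h3 : (toPoint A).app n a = rho n w ((toPoint B).hmap z) := rfl
  rw [h3, h2, flow_mem_vSet hm, (toPoint B).hmap_mem_vSet]

lemma continuousOn_jmap {T : Type} [TopologicalSpace T] [LocallyCompactSpace T] {n : ℕ} (w : Win)
    {a : T → A.obj n} (ha : Continuous a) :
    ContinuousOn (fun p : Hocolim B × T => jmap n w (a p.2) p.1) (vSet B n w ×ˢ univ) := by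
  refine continuousOn_hocolim (isOpen_vSet n w) fun k c => ?_
  rintro ⟨⟨p, t⟩, u⟩ ⟨i, hi⟩
  refine ContinuousAt.continuousWithinAt ?_
  obtain ⟨r, hr, g, hg, h⟩ := jmap_incl hi
  let S : Set ((B.obj (c.o 0) × Simplex k) × T) := {q | c.Maj w.θ n q.1.2.1 i}
  have hS : S ∈ 𝓝 ((p, t), u) :=
    ((isOpen_maj n w c i).preimage (continuous_snd.comp continuous_fst)).mem_nhds hi
  have h1 : ContinuousOn (fun q : (B.obj (c.o 0) × Simplex k) × T =>
      c.jAt A hr g (a q.2) q.1.2.1) S := by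
    refine gpt_continuousOn _ A hr ((A.map_cont g).comp (ha.comp continuous_snd)).continuousOn ?_
      fun q hq => IChain.isWeight_resc (IChain.Maj.pos q.1.2.2.1 hq)
    refine continuousOn_pi.2 fun j => ?_
    exact (IChain.continuousOn_resc n c j.1).comp (f := fun q : (B.obj (c.o 0) × Simplex k) × T =>
      (q.1.2, (1 : ℝ))) (by fun_prop) fun q hq => IChain.Maj.pos q.1.2.2.1 hq
  refine (h1.continuousAt hS).congr ?_
  filter_upwards [hS] with q hq
  exact (h q.1.2 hq A B _ _).symm

end

section

open Set
open IFun Topology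

variable {A B : ISpace}

lemma ContinuousOn.jmap {T : Type} [TopologicalSpace T] [LocallyCompactSpace T] {K : Set T}
    (hK : IsClosed K) {n : ℕ} {w : Win} {a : T → A.obj n} {z : T → Hocolim B}
    (ha : ContinuousOn a K) (hz : ContinuousOn z K) (hm : ∀ x ∈ K, z x ∈ vSet B n w) :
    ContinuousOn (fun x => jmap n w (a x) (z x)) K := by
  have : LocallyCompactSpace K := hK.isClosedEmbedding_subtypeVal.locallyCompactSpace
  rw [continuousOn_iff_continuous_domRestrict] at *
  exact (continuousOn_jmap (B := B) w ha).comp_continuous (f := fun x : K => (z x, x))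
    (hz.prodMk continuous_id) fun x => ⟨hm x x.2, mem_univ _⟩

lemma IHom.liftsOn_hmap (f : IHom A B) {q : ℕ} {S : Set (ℕ × Win)} {n : ℕ} {w : Win}
    (hS : (n, w) ∈ S) (hmin : ∀ x ∈ S, n ≤ x.1) (h : Lifts (Fin q → ℝ) (f.app n)) :
    LiftsOn (Fin q → ℝ) f.hmap (⋂ x ∈ S, vSet B x.1 x.2) := by
  intro F g cF cg hfg hU
  have hFv : ∀ x ∈ uBall (Fin q → ℝ), F x ∈ vSet B n w := fun x hx => by
    simpa using mem_iInter₂.1 (hU x hx) (n, w) hS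
  have hgv : ∀ x ∈ uSph (Fin q → ℝ), g x ∈ vSet A n w := fun x hx => by
    rw [← f.hmap_mem_vSet, hfg x hx]; exact hFv x (uSph_subset hx)
  let proj : ℝ → unitInterval := projIcc 0 1 zero_le_one
  have hproj : Continuous proj := continuous_projIcc
  have hp0 : proj 0 = 0 := projIcc_left _
  have hp1 : proj 1 = 1 := projIcc_right _
  have hUz : ∀ {C : ISpace} (z : Hocolim C), (∀ x ∈ S, z ∈ vSet C x.1 x.2) ↔
      z ∈ ⋂ x ∈ S, vSet C x.1 x.2 := fun z => by simp
  have key : Solvable f.hmap (⋂ x ∈ S, vSet B x.1 x.2) (fun x => flow n (F x) (proj 0))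
      (fun x => flow n (g x) (proj 0)) := by
    refine Solvable.of_homotopy f.continuous_hmap (F := fun p => flow n (F p.1) (proj p.2))
      (g := fun p => flow n (g p.1) (proj p.2)) ?_ ?_ ?_ ?_ ?_
    · refine (continuousOn_flow n w).comp (f := fun p : (Fin q → ℝ) × ℝ => (F p.1, proj p.2))
        ((cF.comp continuousOn_fst fun p hp => hp.1).prodMk (by fun_prop)) fun p hp =>
          ⟨hFv p.1 hp.1, mem_univ _⟩
    · refine (continuousOn_flow n w).comp (f := fun p : (Fin q → ℝ) × ℝ => (g p.1, proj p.2))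
        ((cg.comp continuousOn_fst fun p hp => hp.1).prodMk (by fun_prop)) fun p hp =>
          ⟨hgv p.1 hp.1, mem_univ _⟩
    · intro x hx r _
      change f.hmap (flow n (g x) (proj r)) = flow n (F x) (proj r)
      rw [f.hmap_flow, hfg x hx]
    · intro x hx r _
      exact (hUz _).1 fun y hy => (flow_mem_vSet (hmin y hy) _).2 ((hUz _).2 (hU x hx) y hy)
    · obtain ⟨G, H, cG, cH, Gg, H0, H1, HS, -⟩ := h (fun x => rho n w (F x))
        (fun x => rho n w (g x)) ((continuousOn_rho n w).comp cF hFv)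
        ((continuousOn_rho n w).comp cg hgv) (fun x hx => by
          rw [← hfg x hx, f.rho_hmap (hgv x hx)]) fun _ _ => mem_univ _
      refine ⟨fun x => jmap n w (G x) (F x), fun p => jmap n w (H p) (F p.1),
        cG.jmap (isClosed_uBall _) cF hFv, cH.jmap ((isClosed_uBall _).prod isClosed_Icc)
          (cF.comp continuousOn_fst fun p hp => hp.1) fun p hp => hFv p.1 hp.1, ?_, ?_, ?_, ?_, ?_⟩
      · intro x hx
        change jmap n w (G x) (F x) = flow n (g x) (proj 1)
        rw [hp1, Gg x hx, ← hfg x hx, jmap_hmap, jmap_rho (hgv x hx)]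
      · intro x hx
        change jmap n w (H (x, 0)) (F x) = flow n (F x) (proj 1)
        rw [hp1, H0 x hx, jmap_rho (hFv x hx)]
      · intro x hx
        change jmap n w (H (x, 1)) (F x) = f.hmap (jmap n w (G x) (F x))
        rw [H1 x hx, f.hmap_jmap _ (hFv x hx)]
      · intro x hx s hs
        change jmap n w (H (x, s)) (F x) = flow n (F x) (proj 1)
        rw [hp1, HS x hx s hs, jmap_rho (hFv x (uSph_subset hx))]
      · intro x hx s hs
        exact (hUz _).1 fun y hy =>
          (jmap_mem_vSet (hmin y hy) _ (hFv x hx)).2 ((hUz _).2 (hU x hx) y hy)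
  simpa only [hp0, flow_zero] using key

/-- Levelwise highly connected maps induce highly connected maps of homotopy colimits. -/
lemma IHom.lifts_hmap (f : IHom A B) {q : ℕ}
    (h : ∀ j ≤ q, ∀ n, Lifts (Fin j → ℝ) (f.app n)) : Lifts (Fin q → ℝ) f.hmap := by
  refine Lifts.of_cover f.continuous_hmap (W := fun x : ℕ × Win => vSet B x.1 x.2)
    (fun x => isOpen_vSet _ _) iUnion_vSet fun S hS j hj => ?_
  obtain ⟨x, hx, hmin⟩ := WellFounded.has_min (measure (Prod.fst : ℕ × Win → ℕ)).wf S hS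
  exact f.liftsOn_hmap hx (fun y hy => not_lt.1 (hmin y hy)) (h j hj x.1)

end

section

open Set
open IFun Topology

variable {A B : ISpace}

lemma homotopic_of_continuous {Z W : Type} [TopologicalSpace Z] [TopologicalSpace W] {f g : C(Z, W)}
    {η : Z × ℝ → W} (hη : Continuous η) (h0 : ∀ z, η (z, 0) = f z) (h1 : ∀ z, η (z, 1) = g z) :
    f.Homotopic g :=
  ⟨{ toFun := fun p => η (p.2, p.1)
     continuous_toFun := by fun_prop
     map_zero_left := h0
     map_one_left := h1 }⟩

lemma IEndo.pmap_one (z : Hocolim (IEndo.one.precomp A)) : IEndo.one.pmap A z = z := by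
  revert z
  exact hocolim_ind fun k c p t => rfl

namespace INat

/-- The transformation from the constant functor at the initial object to the identity. -/
abbrev init : INat IEndo.zero IEndo.one where
  app := fun _ => ⟨fun i => i.elim0, fun i => i.elim0⟩
  nat := fun _ => by ext i; exact i.elim0

lemma lifts_pmap_zero {j : ℕ} (h : ∀ i ≤ j, ∀ n, Lifts (Fin i → ℝ) (A.map (init.app n))) :
    Lifts (Fin j → ℝ) (IEndo.zero.pmap A) := by
  have h1 : Lifts (Fin j → ℝ) (init.hom A).hmap := (init.hom A).lifts_hmap h
  refine Lifts.of_homotopy (f := (init.hom A).hmap) (η := fun p => init.htpy A p.2 (1 - p.1))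
    ?_ ?_ ?_ h1
  · exact (init.continuous_htpy A).comp
      (f := fun p : ℝ × Hocolim (IEndo.zero.precomp A) => (p.2, 1 - p.1)) (by fun_prop)
  · intro a
    change init.htpy A a (1 - 0) = _
    rw [sub_zero]; exact init.htpy_one A a
  · intro a
    change init.htpy A a (1 - 1) = _
    rw [sub_self]; exact (init.htpy_zero A a).trans (IEndo.pmap_one _)

end INat

open INat

/-- The homotopy colimit of a constant `𝓘`-space retracts to its value. -/
def constRetr (A : ISpace) : Hocolim (IEndo.zero.precomp A) → A.obj 0 :=
  hlift (fun _ _ p _ => p) fun _ _ _ _ p _ => (A.map_id 0 p).symm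

lemma continuous_constRetr : Continuous (constRetr A) :=
  continuous_hocolim fun _ _ => continuous_fst

lemma simplexMap_zero {k : ℕ} (α : Fin (k + 1) →o Fin (0 + 1)) (t : Simplex k) :
    simplexMap α t = vertex := by
  refine Subtype.ext (funext fun j => ?_)
  have h := (simplexMap α t).2.2
  rw [Fin.sum_univ_one] at h
  obtain rfl : j = 0 := Fin.ext (by omega)
  exact h

lemma incl_zero {k : ℕ} (c : IChain k) (p : A.obj 0) (t : Simplex k) :
    incl A (IEndo.zero.chain c) p t = uMap A 0 p := by
  have h := incl_glue A (k := k) (l := 0) ⟨fun _ => 0, fun _ _ _ => le_rfl⟩ (constChain 0) p t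
  rw [simplexMap_zero] at h
  refine Eq.trans ?_ h.symm
  exact congrArg (fun z => incl A (IEndo.zero.chain c) z t) (A.map_id 0 p).symm

lemma lifts_uMap_const {E : Type} [NormedAddCommGroup E] [NormedSpace ℝ E] [FiniteDimensional ℝ E] :
    Lifts E (uMap (IEndo.zero.precomp A) 0) := by
  refine Lifts.of_leftRightInverse (f := ⟨uMap (IEndo.zero.precomp A) 0, continuous_uMap _ _⟩)
    (f' := ⟨constRetr A, continuous_constRetr⟩) ?_ ?_
  · refine homotopic_of_continuous
      (η := fun p => init.htpy (IEndo.zero.precomp A) p.1 p.2)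
      (init.continuous_htpy (IEndo.zero.precomp A)) ?_ ?_
    · refine hocolim_ind fun k c p t => (init.htpy_zero (IEndo.zero.precomp A) _).trans ?_
      exact congrArg (fun z => incl (IEndo.zero.precomp A) c z t) (A.map_id 0 p)
    · refine hocolim_ind fun k c p t => (init.htpy_one (IEndo.zero.precomp A) _).trans ?_
      exact incl_zero (A := IEndo.zero.precomp A) c p t
  · have : (ContinuousMap.comp ⟨constRetr A, continuous_constRetr⟩
      ⟨uMap (IEndo.zero.precomp A) 0, continuous_uMap _ _⟩) = ContinuousMap.id (A.obj 0) := by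
      ext p; rfl
    rw [this]

lemma lifts_uMap_zero {j : ℕ} (h : ∀ i ≤ j, ∀ n, Lifts (Fin i → ℝ) (A.map (init.app n))) :
    Lifts (Fin j → ℝ) (uMap A 0) :=
  Lifts.comp (f := uMap (IEndo.zero.precomp A) 0) (g := IEndo.zero.pmap A) (continuous_uMap _ _)
    (IEndo.continuous_pmap _ _) lifts_uMap_const (lifts_pmap_zero h)

lemma lifts_uMap_of_init {k : ℕ} (h : ∀ i ≤ k, ∀ n, Lifts (Fin i → ℝ) (A.map (init.app n))) (N : ℕ)
    {j : ℕ} (hj : j ≤ k) : Lifts (Fin j → ℝ) (uMap A N) := by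
  let _ : Nonempty (A.obj 0) := ⟨A.pt 0⟩
  refine Lifts.of_comp_right (i := A.map (init.app N)) (A.map_cont _) (continuous_uMap A N)
    (fun j hj => h j hj N) (fun j hj => ?_) j hj
  refine Lifts.of_homotopy (f := uMap A 0)
    (η := fun p => init.htpy A (incl (IEndo.zero.precomp A) (constChain N) p.2 vertex) p.1)
    ?_ ?_ ?_ (lifts_uMap_zero fun i hi => h i (hi.trans hj))
  · refine (init.continuous_htpy A).comp
      (f := fun p : ℝ × A.obj 0 => (uMap (IEndo.zero.precomp A) N p.2, p.1)) ?_
    exact ((continuous_uMap (IEndo.zero.precomp A) N).comp continuous_snd).prodMk continuous_fst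
  · intro p
    exact (init.htpy_zero A _).trans (IEndo.pmap_one _)
  · intro p
    exact (init.htpy_one A _)

/-- The injection induced by adding `N` points. -/
def addPoints (N : ℕ) {n m : ℕ} (f : Fin n ↪ Fin m) : Fin (N + n) ↪ Fin (N + m) :=
  ⟨fun i => finSumFinEquiv (Sum.map id f (finSumFinEquiv.symm i)), fun _ _ h =>
    finSumFinEquiv.symm.injective
      (Sum.map_injective.2 ⟨Function.injective_id, f.injective⟩ (finSumFinEquiv.injective h))⟩

lemma addPoints_apply (N : ℕ) {n m : ℕ} (f : Fin n ↪ Fin m) (i : Fin (N + n)) :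
    addPoints N f i = finSumFinEquiv (Sum.map id f (finSumFinEquiv.symm i)) := rfl

lemma addPoints_refl (N n : ℕ) :
    addPoints N (Function.Embedding.refl (Fin n)) = Function.Embedding.refl _ := by
  ext i
  obtain ⟨s, rfl⟩ := finSumFinEquiv.surjective i
  rcases s with s | s <;> simp [addPoints_apply]

lemma addPoints_trans (N : ℕ) {n m l : ℕ} (f : Fin n ↪ Fin m) (g : Fin m ↪ Fin l) :
    addPoints N (f.trans g) = (addPoints N f).trans (addPoints N g) := by
  ext i
  obtain ⟨s, rfl⟩ := finSumFinEquiv.surjective i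
  rcases s with s | s <;> simp [addPoints_apply]

lemma natAddEmb_addPoints (N : ℕ) {n m : ℕ} (f : Fin n ↪ Fin m) :
    f.trans (Fin.natAddEmb N) = (Fin.natAddEmb N).trans (addPoints N f) := by
  ext i; simp [addPoints_apply]

/-- The functor adding `N` points. -/
abbrev IEndo.shift (N : ℕ) : IEndo where
  o := fun n => N + n
  map := addPoints N
  map_refl := addPoints_refl N
  map_trans := addPoints_trans N

/-- The transformation from the identity to the functor adding `N` points. -/
abbrev INat.shift (N : ℕ) : INat IEndo.one (IEndo.shift N) where
  app := fun n => Fin.natAddEmb N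
  nat := natAddEmb_addPoints N

/-- Vertices in a highly connected range include into the homotopy colimit by a highly connected
map. -/
lemma ISpace.Convergent.lifts_uMap (hA : A.Convergent) (k : ℕ) :
    ∃ N₀, ∀ N, N₀ ≤ N → ∀ j ≤ k, Lifts (Fin j → ℝ) (uMap A N) := by
  obtain ⟨N, hN⟩ := hA k
  refine ⟨N, fun M hM j hj => ?_⟩
  have h1 : Lifts (Fin j → ℝ) (uMap ((IEndo.shift M).precomp A) M) :=
    lifts_uMap_of_init (A := (IEndo.shift M).precomp A)
      (fun i hi n => (hN _ _ (hM.trans (Nat.le_add_right _ _)) _).lifts i hi) M hj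
  have h2 : Lifts (Fin j → ℝ) (A.map ((INat.shift M).app M)) := (hN _ _ hM _).lifts j hj
  have h3 := Lifts.comp (A.map_cont _) (continuous_uMap ((IEndo.shift M).precomp A) M) h2 h1
  refine Lifts.of_comp_left (u := ⟨uMap A M, continuous_uMap A M⟩)
    (σ := ⟨((INat.shift M).hom A).hmap, IHom.continuous_hmap _⟩)
    (τ := ⟨(IEndo.shift M).pmap A, IEndo.continuous_pmap _ _⟩) ?_ h3
  refine (homotopic_of_continuous (η := fun p => (INat.shift M).htpy A p.1 p.2)
    ((INat.shift M).continuous_htpy A) ?_ ?_).symm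
  · intro z
    exact (INat.shift M).htpy_zero A z
  · intro z
    exact ((INat.shift M).htpy_one A z).trans (IEndo.pmap_one _)

end

section

open Set
open IFun Topology

/-! ### Conjugation of loops by paths -/

section Conj

variable {T Z : Type} [TopologicalSpace T] [TopologicalSpace Z]

/-- A continuous family of loops as a map into the loop space. -/
def mkLoop {z : Z} (φ : T × ℝ → Z) (hφ : Continuous φ) (h0 : ∀ t, φ (t, 0) = z)
    (h1 : ∀ t, φ (t, 1) = z) : C(T, OmegaSpace Z z) where
  toFun := fun t => ⟨⟨fun s => φ (t, s), by fun_prop⟩, h0 t, h1 t⟩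
  continuous_toFun := by
    refine Continuous.subtype_mk ?_ _
    exact (ContinuousMap.curry (⟨fun p : T × unitInterval => φ (p.1, p.2), by fun_prop⟩ :
      C(T × unitInterval, Z))).continuous

/-- Extension of a loop to the real line by constants. -/
def evalLoop {z : Z} (γ : OmegaSpace Z z) (s : ℝ) : Z := γ.1 (projIcc 0 1 zero_le_one s)

lemma evalLoop_zero {z : Z} (γ : OmegaSpace Z z) : evalLoop γ 0 = z := by
  simp [evalLoop, γ.2.1]

lemma evalLoop_one {z : Z} (γ : OmegaSpace Z z) : evalLoop γ 1 = z := by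
  simp [evalLoop, γ.2.2]

lemma evalLoop_coe {z : Z} (γ : OmegaSpace Z z) (s : unitInterval) : evalLoop γ s = γ.1 s := by
  simp [evalLoop]

lemma continuous_evalLoop {z : Z} : Continuous fun p : OmegaSpace Z z × ℝ => evalLoop p.1 p.2 := by
  refine ContinuousEval.continuous_eval.comp
    (f := fun p : OmegaSpace Z z × ℝ => (p.1.1, projIcc 0 1 zero_le_one p.2)) ?_
  fun_prop

/-- The path `b` backwards, followed by the path `e`, followed by the path `b`. -/
def conjFun (b e : ℝ → Z) (v : ℝ) : Z := if v ≤ 0 then b (-v) else if v ≤ 1 then e v else b (v - 1)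

lemma conjFun_of_mem {b e : ℝ → Z} (h0 : e 0 = b 0) {v : ℝ} (hv : v ∈ uI) :
    conjFun b e v = e v := by
  rw [conjFun, if_pos hv.2]
  split_ifs with h
  · obtain rfl : v = 0 := le_antisymm h hv.1
    rw [neg_zero, h0]
  · rfl

lemma conjFun_neg_one (b e : ℝ → Z) : conjFun b e (-1) = b 1 := by simp [conjFun]

lemma conjFun_two (b e : ℝ → Z) : conjFun b e 2 = b 1 := by norm_num [conjFun]

lemma conjFun_const {z : Z} {e : ℝ → Z} (h0 : e 0 = z) (h1 : e 1 = z) (v : ℝ) :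
    conjFun (fun _ => z) e v = e (projIcc 0 1 zero_le_one v) := by
  rw [conjFun]
  split_ifs with h h'
  · rw [projIcc_of_le_left _ h]; exact h0.symm
  · rw [projIcc_of_mem _ ⟨(not_le.1 h).le, h'⟩]
  · rw [projIcc_of_right_le _ (not_le.1 h').le]; exact h1.symm

lemma continuous_conjFun {b e : T × ℝ → Z} (hb : Continuous b) (he : Continuous e)
    (h0 : ∀ t, e (t, 0) = b (t, 0)) (h1 : ∀ t, e (t, 1) = b (t, 0)) {v : T → ℝ}
    (hv : Continuous v) :
    Continuous fun t => conjFun (fun s => b (t, s)) (fun s => e (t, s)) (v t) := by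
  refine Continuous.if_le (by fun_prop) (Continuous.if_le (by fun_prop) (by fun_prop) hv
    continuous_const ?_) hv continuous_const ?_
  · intro t ht
    rw [ht, sub_self]
    exact h1 t
  · intro t ht
    rw [if_pos (by rw [ht]; exact zero_le_one), ht, neg_zero]
    exact (h0 t).symm

variable {p z : Z}

/-- Conjugation of loops by a path. -/
def conjLoop (β : C(ℝ, Z)) (h0 : β 0 = p) (h1 : β 1 = z) : C(OmegaSpace Z p, OmegaSpace Z z) :=
  mkLoop (fun x => conjFun β (evalLoop x.1) (3 * x.2 - 1))
    (continuous_conjFun (T := OmegaSpace Z p × ℝ) (b := fun x => β x.2)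
      (e := fun x => evalLoop x.1.1 x.2) (by fun_prop)
      (continuous_evalLoop.comp (f := fun x : (OmegaSpace Z p × ℝ) × ℝ => (x.1.1, x.2))
        (by fun_prop))
      (fun x => (evalLoop_zero _).trans h0.symm) (fun x => (evalLoop_one _).trans h0.symm)
      (v := fun x => 3 * x.2 - 1) (by fun_prop))
    (fun γ => by
      change conjFun β (evalLoop γ) (3 * 0 - 1) = z
      rw [mul_zero, zero_sub, conjFun_neg_one, h1])
    (fun γ => by
      change conjFun β (evalLoop γ) (3 * 1 - 1) = z
      rw [show (3 * 1 - 1 : ℝ) = 2 by norm_num, conjFun_two, h1])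

/-- Conjugation by a path and then by the inverse path is homotopic to the identity. -/
lemma conjLoop_conjLoop (β β' : C(ℝ, Z)) (h0 : β 0 = p) (h1 : β 1 = z) (h0' : β' 0 = z)
    (h1' : β' 1 = p) (hβ : ∀ s, β' s = β (1 - s)) :
    ((conjLoop β' h0' h1').comp (conjLoop β h0 h1)).Homotopic (ContinuousMap.id _) := by
  let P : ℝ → ℝ := fun v => (projIcc (0 : ℝ) 1 zero_le_one v : ℝ)
  have hP : Continuous P := by fun_prop
  have P0 : P (-1) = 0 := by simp [P, projIcc_of_le_left]
  have P0' : P 0 = 0 := by simp [P]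
  have P1' : P 1 = 1 := by simp [P]
  have P1 : P 2 = 1 := by simp [P, projIcc_of_right_le]
  have hPm : ∀ v, P v ∈ uI := fun v => (projIcc (0 : ℝ) 1 zero_le_one v).2
  let inn : (OmegaSpace Z p × ℝ) × ℝ → Z := fun x =>
    conjFun (fun s => β (x.1.2 * s)) (evalLoop x.1.1) (3 * P x.2 - 1)
  have hinn : Continuous inn :=
    continuous_conjFun (T := (OmegaSpace Z p × ℝ) × ℝ) (b := fun x => β (x.1.1.2 * x.2))
      (e := fun x => evalLoop x.1.1.1 x.2) (by fun_prop)
      (continuous_evalLoop.comp (f := fun x : ((OmegaSpace Z p × ℝ) × ℝ) × ℝ => (x.1.1.1, x.2))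
        (by fun_prop))
      (fun x => (evalLoop_zero _).trans (by simp [h0]))
      (fun x => (evalLoop_one _).trans (by simp [h0]))
      (v := fun x => 3 * P x.2 - 1) (by fun_prop)
  have inn0 : ∀ x, inn (x, 0) = β x.2 := fun x => by
    simp only [inn, P0', mul_zero, zero_sub, conjFun_neg_one, mul_one]
  have inn1 : ∀ x, inn (x, 1) = β x.2 := fun x => by
    simp only [inn, P1']
    rw [show (3 * 1 - 1 : ℝ) = 2 by norm_num, conjFun_two, mul_one]
  let out : (OmegaSpace Z p × ℝ) × ℝ → Z := fun x =>
    conjFun (fun s => β (x.1.2 * (1 - s))) (fun s => inn (x.1, s)) (3 * x.2 - 1)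
  have hout : Continuous out :=
    continuous_conjFun (T := (OmegaSpace Z p × ℝ) × ℝ) (b := fun x => β (x.1.1.2 * (1 - x.2)))
      (e := fun x => inn (x.1.1, x.2)) (by fun_prop) (by fun_prop)
      (fun x => by simp [inn0]) (fun x => by simp [inn1]) (v := fun x => 3 * x.2 - 1) (by fun_prop)
  let η := mkLoop (z := p) out hout
    (fun x => by
      simp only [out, mul_zero, zero_sub, conjFun_neg_one, sub_self, h0])
    (fun x => by
      simp only [out, show (3 * 1 - 1 : ℝ) = 2 by norm_num, conjFun_two, sub_self, mul_zero, h0])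
  let w : ℝ → ℝ := fun s => P (3 * P (3 * s - 1) - 1)
  have hw : Continuous w := by fun_prop
  have w0 : w 0 = 0 := by simp [w, P0]
  have w1 : w 1 = 1 := by
    simp only [w, show (3 * 1 - 1 : ℝ) = 2 by norm_num, P1]
  let θ := mkLoop (T := OmegaSpace Z p × ℝ) (z := p)
    (fun x => evalLoop x.1.1 ((1 - x.1.2) * w x.2 + x.1.2 * x.2))
    (continuous_evalLoop.comp (f := fun x : (OmegaSpace Z p × ℝ) × ℝ =>
      (x.1.1, (1 - x.1.2) * w x.2 + x.1.2 * x.2)) (by fun_prop))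
    (fun x => by simp [w0, evalLoop_zero]) (fun x => by simp [w1, evalLoop_one])
  have hη0 : ∀ γ, η (γ, 0) = θ (γ, 0) := fun γ => by
    refine Subtype.ext (ContinuousMap.ext fun s => ?_)
    change out ((γ, 0), s) = evalLoop γ ((1 - 0) * w s + 0 * s)
    have e1 : (fun s : ℝ => β (0 * (1 - s))) = fun _ => p := by ext; simp [h0]
    have e2 : (fun s : ℝ => β (0 * s)) = fun _ => p := by ext; simp [h0]
    have e3 : ∀ s, inn ((γ, 0), s) = evalLoop γ (P (3 * P s - 1)) := fun s => by
      simp only [inn, e2]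
      exact conjFun_const (evalLoop_zero γ) (evalLoop_one γ) _
    simp only [out, e1]
    rw [conjFun_const ((inn0 _).trans h0) ((inn1 _).trans h0), e3, sub_zero, one_mul, zero_mul,
      add_zero]
    simp [w, P]
  have hη1 : ∀ γ, η (γ, 1) = conjLoop β' h0' h1' (conjLoop β h0 h1 γ) := fun γ => by
    refine Subtype.ext (ContinuousMap.ext fun s => ?_)
    change conjFun (fun s => β (1 * (1 - s))) (fun s => conjFun (fun s => β (1 * s)) (evalLoop γ)
      (3 * P s - 1)) (3 * s - 1) = conjFun β' _ (3 * s - 1)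
    simp only [one_mul, ← hβ]
    rfl
  have hθ1 : ∀ γ, θ (γ, 1) = γ := fun γ => by
    refine Subtype.ext (ContinuousMap.ext fun s => ?_)
    change evalLoop γ ((1 - 1) * w s + 1 * s) = γ.1 s
    rw [sub_self, zero_mul, zero_add, one_mul, evalLoop_coe]
  let m : C(OmegaSpace Z p, OmegaSpace Z p) := ⟨fun γ => η (γ, 0), by fun_prop⟩
  have a1 : m.Homotopic ((conjLoop β' h0' h1').comp (conjLoop β h0 h1)) :=
    homotopic_of_continuous η.continuous (fun _ => rfl) hη1
  have a2 : m.Homotopic (ContinuousMap.id _) :=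
    homotopic_of_continuous θ.continuous (fun γ => (hη0 γ).symm) hθ1
  exact a1.symm.trans a2

lemma lifts_conjLoop {E : Type} [NormedAddCommGroup E] [NormedSpace ℝ E] [FiniteDimensional ℝ E]
    (β : C(ℝ, Z)) (h0 : β 0 = p) (h1 : β 1 = z) : Lifts E (conjLoop β h0 h1) := by
  let β' : C(ℝ, Z) := ⟨fun s => β (1 - s), by fun_prop⟩
  have h0' : β' 0 = z := by simp [β', h1]
  have h1' : β' 1 = p := by simp [β', h0]
  exact Lifts.of_leftRightInverse (f := conjLoop β h0 h1) (f' := conjLoop β' h0' h1')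
    (conjLoop_conjLoop β' β h0' h1' h0 h1 fun s => by simp [β']).symm
    (conjLoop_conjLoop β β' h0 h1 h0' h1' fun s => rfl)

end Conj

end

section

open Set
open IFun Topology

variable (X : ISpace)

/-! ### The comparison map -/

/-- The basepoints as a transformation from the loop space to the constant `𝓘`-space. -/
abbrev ptHom : IHom (loopISpace X) (IEndo.zero.precomp X) where
  app := fun _ _ => X.pt 0
  cont := fun _ => continuous_const
  nat := fun _ _ => (X.map_id 0 _).symm

/-- The path from the basepoint of a cell to the basepoint of the homotopy colimit. -/
def basePath (x : Hocolim (loopISpace X) × ℝ) : Hocolim X :=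
  INat.init.htpy X ((ptHom X).hmap x.1) x.2

lemma continuous_basePath : Continuous (basePath X) :=
  (INat.init.continuous_htpy X).comp
    (f := fun x : Hocolim (loopISpace X) × ℝ => ((ptHom X).hmap x.1, x.2))
    (((ptHom X).continuous_hmap.comp continuous_fst).prodMk continuous_snd)

lemma basePath_one (z) : basePath X (z, 1) = basept X := by
  refine (INat.init.htpy_one X _).trans ?_
  revert z
  exact hocolim_ind fun k c γ t => incl_zero c (X.pt 0) t

lemma basePath_incl {k : ℕ} (c : IChain k) (γ) (t : Simplex k) :
    basePath X (incl _ c γ t, 0) = incl X c (X.pt _) t := by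
  refine (INat.init.htpy_zero X _).trans ((IEndo.pmap_one _).trans ?_)
  exact congrArg (fun z => incl X c z t) (X.map_pt _)

/-- Evaluation of a loop in a cell. -/
def evalHocolim (x : Hocolim (loopISpace X) × ℝ) : Hocolim X :=
  hlift (A := loopISpace X) (fun _ c γ t => incl X c (evalLoop γ x.2) t)
    (fun _ _ α c _ t => incl_glue X α c _ t) x.1

lemma continuous_evalHocolim : Continuous (evalHocolim X) := by
  refine continuous_hocolim_prod fun k c => ?_
  refine (continuous_incl X c).comp
    (f := fun p : ((loopISpace X).obj (c.o 0) × Simplex k) × ℝ => (evalLoop p.1.1 p.2, p.1.2)) ?_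
  exact (continuous_evalLoop.comp
    (f := fun p : ((loopISpace X).obj (c.o 0) × Simplex k) × ℝ => (p.1.1, p.2))
    (by fun_prop)).prodMk (by fun_prop)

lemma evalHocolim_zero (z) : evalHocolim X (z, 0) = basePath X (z, 0) := by
  revert z
  refine hocolim_ind fun k c γ t => Eq.trans ?_ (basePath_incl X c γ t).symm
  exact congrArg (fun z => incl X c z t) (evalLoop_zero γ)

lemma evalHocolim_one (z) : evalHocolim X (z, 1) = basePath X (z, 0) := by
  revert z
  refine hocolim_ind fun k c γ t => Eq.trans ?_ (basePath_incl X c γ t).symm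
  exact congrArg (fun z => incl X c z t) (evalLoop_one γ)

lemma continuous_conjHocolim {T : Type} [TopologicalSpace T] {z : T → Hocolim (loopISpace X)}
    (hz : Continuous z) {v : T → ℝ} (hv : Continuous v) : Continuous fun t =>
    conjFun (fun s => basePath X (z t, s)) (fun s => evalHocolim X (z t, s)) (v t) :=
  continuous_conjFun (b := fun x : T × ℝ => basePath X (z x.1, x.2))
    (e := fun x : T × ℝ => evalHocolim X (z x.1, x.2))
    ((continuous_basePath X).comp (by fun_prop : Continuous fun x : T × ℝ => (z x.1, x.2)))
    ((continuous_evalHocolim X).comp (by fun_prop : Continuous fun x : T × ℝ => (z x.1, x.2)))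
    (fun _ => evalHocolim_zero X _) (fun _ => evalHocolim_one X _) hv

/-- The comparison map from the homotopy colimit of the loop spaces to the loop space of the
homotopy colimit: loops in cells are conjugated by paths to the basepoint. -/
def loopComparison : C(Hocolim (loopISpace X), OmegaSpace (Hocolim X) (basept X)) :=
  mkLoop (fun x => conjFun (fun s => basePath X (x.1, s)) (fun s => evalHocolim X (x.1, s))
      (3 * x.2 - 1))
    (continuous_conjHocolim X (T := Hocolim (loopISpace X) × ℝ) continuous_fst (by fun_prop))
    (fun z => by
      rw [mul_zero, zero_sub, conjFun_neg_one, basePath_one])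
    (fun z => by
      rw [show (3 * 1 - 1 : ℝ) = 2 by norm_num, conjFun_two, basePath_one])

lemma loopComparison_apply (z) (s : unitInterval) : (loopComparison X z).1 s =
    conjFun (fun s => basePath X (z, s)) (fun s => evalHocolim X (z, s)) (3 * (s : ℝ) - 1) := rfl

lemma loopComparison_homotopic {k : ℕ} (c : IChain k) (γ : (loopISpace X).obj (c.o 0))
    (t : Simplex k) (hc : Continuous fun s : unitInterval => incl X c (γ.1 s) t) :
    ContinuousMap.Homotopic ((loopComparison X (incl _ c γ t)).1)
      ⟨fun s => incl X c (γ.1 s) t, hc⟩ := by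
  let z : Hocolim (loopISpace X) := incl _ c γ t
  refine homotopic_of_continuous (η := fun x : unitInterval × ℝ =>
    conjFun (fun s => basePath X (z, s)) (fun s => evalHocolim X (z, s))
      ((3 - 2 * x.2) * x.1 - (1 - x.2)))
    (continuous_conjHocolim X continuous_const (by fun_prop)) ?_ ?_
  · intro s
    refine Eq.trans ?_ (loopComparison_apply X z s).symm
    simp
  · intro s
    change conjFun _ _ ((3 - 2 * 1) * (s : ℝ) - (1 - 1)) = incl X c (γ.1 s) t
    rw [show (3 - 2 * 1) * (s : ℝ) - (1 - 1) = s by ring,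
      conjFun_of_mem (evalHocolim_zero X z) s.2]
    exact congrArg (fun z => incl X c z t) (evalLoop_coe γ s)

variable {X}

lemma lifts_loopComparison_comp_uMap {N j : ℕ} (h : Lifts (Fin (j + 1) → ℝ) (uMap X N)) :
    Lifts (Fin j → ℝ) (loopComparison X ∘ uMap (loopISpace X) N) := by
  let β : C(ℝ, Hocolim X) :=
    ⟨fun s => basePath X (uMap (loopISpace X) N ((loopISpace X).pt N), s),
      (continuous_basePath X).comp (by fun_prop)⟩
  have h0 : β 0 = uMap X N (X.pt N) := basePath_incl X (constChain N) _ vertex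
  have h1 : β 1 = basept X :=
    basePath_one X (uMap (loopISpace X) N ((loopISpace X).pt N))
  exact Lifts.comp (f := loopMap (continuous_uMap X N) rfl) (g := conjLoop β h0 h1)
    (continuous_loopMap _ _) (conjLoop β h0 h1).continuous
    (Lifts.loopMap _ _ (LiftsOn.to_prod h)) (lifts_conjLoop β h0 h1)

lemma isWeakHomotopyEquiv_loopComparison (hX : X.Convergent) :
    IsWeakHomotopyEquiv (loopComparison X).continuous := by
  let _ : Nonempty (Hocolim (loopISpace X)) := ⟨basept _⟩
  refine isWeakHomotopyEquiv_of_lifts _ fun q => ?_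
  obtain ⟨N₁, h₁⟩ := hX.loopISpace.lifts_uMap q
  obtain ⟨N₂, h₂⟩ := hX.lifts_uMap (q + 1)
  let N := max N₁ N₂
  let _ : Nonempty ((loopISpace X).obj N) := ⟨(loopISpace X).pt N⟩
  exact Lifts.of_comp_right (i := uMap (loopISpace X) N) (continuous_uMap _ _)
    (loopComparison X).continuous (fun j hj => h₁ N (le_max_left _ _) j hj)
    (fun j hj => lifts_loopComparison_comp_uMap (h₂ N (le_max_right _ _) (j + 1) (by lia))) q le_rfl

end

/-- Let `X` be a convergent based 𝓘-space.  Then the levelwise loop space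
`ΩX` is a convergent 𝓘-space, and the canonical comparison map `(ΩX)_{h𝓘} → Ω(X_{h𝓘})`
(which on the piece indexed by a chain `c` and a simplex coordinate `t` is induced, up to free
homotopy of loops, by the inclusion `X(c₀) → X_{h𝓘}` of `0`-simplices) is a weak homotopy
equivalence: it induces isomorphisms of all homotopy groups at all basepoints. -/
theorem loop_hocolim_weak_equiv (X : ISpace) (hX : X.Convergent) :
    (loopISpace X).Convergent ∧
    ∃ (ψ : Hocolim (loopISpace X) → OmegaSpace (Hocolim X) (basept X))
      (hψ : Continuous ψ),
      (∀ (k : ℕ) (c : IChain k) (γ : (loopISpace X).obj (c.o 0)) (t : Simplex k)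
          (hc : Continuous fun s : unitInterval => incl X c (γ.1 s) t),
        ContinuousMap.Homotopic ((ψ (incl _ c γ t)).1)
          ⟨fun s => incl X c (γ.1 s) t, hc⟩) ∧
      IsWeakHomotopyEquiv hψ :=
  ⟨hX.loopISpace, loopComparison X, (loopComparison X).continuous,
    fun _ c γ t hc => loopComparison_homotopic X c γ t hc, isWeakHomotopyEquiv_loopComparison hX⟩

end
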